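/- Let p ∈ ℝ[z] be a polynomial of degree d ≥ 3 in reduced form, and suppose p(z) = z^m·q(z^n) where m ≥ 0, n ≥ 1, q ∈ ℝ[z] is monic of positive degree with q(0) ≠ 0, and n is maximal with this property (equivalently the symmetry group H_p = {cz : c ∈ ℂ*, ∃λ ∈ ℂ*, p(cz) = λp(z)} is cyclic of order n). Let B = ℂ[x,y,z]/(xy − p(z)). Then: (a) if n is odd, B has exactly three isomorphism classes of real forms, represented by ℝ[x,y,z]/(x² + y² + z^m q(z^n)), ℝ[x,y,z]/(x² + y² − z^m q(z^n)) and ℝ[x,y,z]/(x² − y² − z^m q(z^n)); (b) if n is even and d is odd, B has exactly four isomorphism classes of real forms, represented by ℝ[x,y,z]/(x² ± y² − z^m q(± z^n)); (c) if n is even and d is even, B has exactly six isomorphism classes of real forms, represented by ℝ[x,y,z]/(x² + y² + z^m q(± z^n)) and ℝ[x,y,z]/(x² ± y² − z^m q(± z^n)). In each case the listed representatives are pairwise non-isomorphic ℝ-algebras and every real form of B is isomorphic to one of them. -/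

import Mathlib

section
open MvPolynomial
open scoped TensorProduct

/-- `A` is a real form of the complex algebra `B` if the complexification `ℂ ⊗[ℝ] A`
is isomorphic to `B` as a `ℂ`-algebra. -/
def IsRealForm (A : Type) [CommRing A] [Algebra ℝ A]
    (B : Type) [CommRing B] [Algebra ℂ B] : Prop :=
  Nonempty ((ℂ ⊗[ℝ] A) ≃ₐ[ℂ] B)

/-- The polynomial `x² + (-1)^a y² + (-1)^b z^m q((-1)^c z^n)`. -/
noncomputable def sPoly (m n : ℕ) (q : Polynomial ℝ) (a b c : Fin 2) :
    MvPolynomial (Fin 3) ℝ :=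
  X 0 ^ 2 + (-1 : MvPolynomial (Fin 3) ℝ) ^ (a : ℕ) * X 1 ^ 2
    + (-1 : MvPolynomial (Fin 3) ℝ) ^ (b : ℕ)
      * (X 2 ^ m * Polynomial.aeval ((-1 : MvPolynomial (Fin 3) ℝ) ^ (c : ℕ) * X 2 ^ n) q)

/-- The real algebra `ℝ[x,y,z]/(x² + (-1)^a y² + (-1)^b z^m q((-1)^c z^n))`. -/
noncomputable abbrev SAlg (m n : ℕ) (q : Polynomial ℝ) (i : Fin 2 × Fin 2 × Fin 2) :=
  MvPolynomial (Fin 3) ℝ ⧸ Ideal.span {sPoly m n q i.1 i.2.1 i.2.2}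

/-- The complex algebra `B = ℂ[x,y,z]/(xy - p(z))` for a real polynomial `p`. -/
noncomputable abbrev BpC (p : Polynomial ℝ) :=
  MvPolynomial (Fin 3) ℂ ⧸
    Ideal.span {(X 0 * X 1 : MvPolynomial (Fin 3) ℂ) -
      Polynomial.aeval (X 2) (p.map (algebraMap ℝ ℂ))}

/-- The isomorphism classes of real forms of `B_p` are exactly the classes of the
algebras indexed by the list `L`. -/
def ClassifiedBy (p : Polynomial ℝ) (m n : ℕ) (q : Polynomial ℝ)
    (L : List (Fin 2 × Fin 2 × Fin 2)) : Prop :=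
  (∀ i ∈ L, ∀ j ∈ L, i ≠ j → IsEmpty (SAlg m n q i ≃ₐ[ℝ] SAlg m n q j)) ∧
  (∀ (A : Type) [CommRing A] [Algebra ℝ A],
    IsRealForm A (BpC p) → ∃ i ∈ L, Nonempty (A ≃ₐ[ℝ] SAlg m n q i))

end

namespace RF

abbrev LR := AddMonoidAlgebra ℂ (ℤ × ℤ)

noncomputable section

def mo (i j : ℤ) : LR := AddMonoidAlgebra.single (i, j) 1

lemma mo_mul (i j k l : ℤ) : mo i j * mo k l = mo (i + k) (j + l) := by
  simp [mo, AddMonoidAlgebra.single_mul_single]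

lemma mo_zero : mo 0 0 = 1 := rfl

lemma mo_pow (i j : ℤ) (n : ℕ) : mo i j ^ n = mo (n * i) (n * j) := by
  simp [mo, AddMonoidAlgebra.single_pow]

lemma mo_coeff (i j : ℤ) (m : ℤ × ℤ) : (mo i j).coeff m = if (i, j) = m then 1 else 0 := by
  classical
  simp only [mo, AddMonoidAlgebra.coeff_single, Finsupp.single_apply]

lemma mo_ne_zero (i j : ℤ) : mo i j ≠ 0 := by
  simp [mo, AddMonoidAlgebra.single_eq_zero]

lemma single_eq (m : ℤ × ℤ) (c : ℂ) : (AddMonoidAlgebra.single m c : LR) = c • mo m.1 m.2 := by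
  simp [mo, AddMonoidAlgebra.smul_single]

lemma supp_induction (s : Set (ℤ × ℤ)) {P : LR → Prop} (f : LR)
    (hf : ∀ m, f.coeff m ≠ 0 → m ∈ s) (h0 : P 0) (ha : ∀ f g, P f → P g → P (f + g))
    (hs : ∀ m ∈ s, ∀ c : ℂ, P (c • mo m.1 m.2)) : P f := by
  rw [← AddMonoidAlgebra.sum_coeff_single f, Finsupp.sum]
  apply Finset.sum_induction _ P ha h0
  intro m hm
  rw [single_eq]
  exact hs m (hf m (by simpa using hm)) _

instance : NoZeroDivisors LR := inferInstance
instance : IsDomain LR := inferInstance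

def wt (a b : ℤ) (m : ℤ × ℤ) : ℤ := a * m.1 + b * m.2

lemma wt_add (a b : ℤ) (m m' : ℤ × ℤ) : wt a b (m + m') = wt a b m + wt a b m' := by
  simp [wt]; ring

def Le (a b n : ℤ) (f : LR) : Prop := ∀ m, f.coeff m ≠ 0 → wt a b m ≤ n

def comp (a b n : ℤ) : LR →ₗ[ℂ] LR where
  toFun f := AddMonoidAlgebra.ofCoeff (f.coeff.filter (fun m => wt a b m = n))
  map_add' f g := by
    rw [AddMonoidAlgebra.coeff_add, Finsupp.filter_add, AddMonoidAlgebra.ofCoeff_add]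
  map_smul' c f := by
    rw [AddMonoidAlgebra.coeff_smul, Finsupp.filter_smul]; rfl

lemma comp_coeff (a b n : ℤ) (f : LR) (m : ℤ × ℤ) :
    (comp a b n f).coeff m = if wt a b m = n then f.coeff m else 0 := by
  change (f.coeff.filter (fun m => wt a b m = n)) m = _
  rw [Finsupp.filter_apply]

lemma comp_mo (a b n i j : ℤ) : comp a b n (mo i j) = if a * i + b * j = n then mo i j else 0 := by
  apply AddMonoidAlgebra.coeff_injective
  ext m
  rw [comp_coeff, mo_coeff]
  by_cases h : (i, j) = m
  · subst h
    by_cases h' : a * i + b * j = n <;> simp [wt, h', mo_coeff]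
  · by_cases h' : a * i + b * j = n <;> simp [h, h', mo_coeff]

lemma comp_smul_mo (a b n i j : ℤ) (c : ℂ) :
    comp a b n (c • mo i j) = if a * i + b * j = n then c • mo i j else 0 := by
  rw [map_smul, comp_mo]; split_ifs <;> simp

lemma Le_zero (a b n : ℤ) : Le a b n 0 := fun m h => by simp at h

lemma Le.add {a b n : ℤ} {f g : LR} (hf : Le a b n f) (hg : Le a b n g) : Le a b n (f + g) := by
  intro m hm
  by_cases h1 : f.coeff m = 0
  · apply hg; intro h2; apply hm; simp [h1, h2]
  · exact hf m h1

lemma Le.smul {a b n : ℤ} {f : LR} (hf : Le a b n f) (c : ℂ) : Le a b n (c • f) := by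
  intro m hm
  apply hf; intro h; apply hm; simp [h]

lemma Le.neg {a b n : ℤ} {f : LR} (hf : Le a b n f) : Le a b n (-f) := by
  have := hf.smul (-1); simpa using this

lemma Le.mono {a b n n' : ℤ} {f : LR} (hf : Le a b n f) (h : n ≤ n') : Le a b n' f :=
  fun m hm => (hf m hm).trans h

lemma Le_mo {a b n i j : ℤ} (h : a * i + b * j ≤ n) : Le a b n (mo i j) := by
  intro m hm
  rw [mo_coeff] at hm
  have : (i, j) = m := by by_contra h'; simp [h'] at hm
  subst this; exact h

lemma Le.sum {a b n : ℤ} {ι : Type*} (s : Finset ι) (f : ι → LR) (hf : ∀ i ∈ s, Le a b n (f i)) :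
    Le a b n (∑ i ∈ s, f i) :=
  Finset.sum_induction f (Le a b n) (fun _ _ => Le.add) (Le_zero a b n) hf

lemma Le.induction {a b n : ℤ} {P : LR → Prop} {f : LR} (hf : Le a b n f) (h0 : P 0)
    (ha : ∀ f g, P f → P g → P (f + g))
    (hs : ∀ i j : ℤ, a * i + b * j ≤ n → ∀ c : ℂ, P (c • mo i j)) : P f :=
  supp_induction {m | wt a b m ≤ n} f hf h0 ha (fun m hm c => hs m.1 m.2 hm c)

lemma Le.mul_comp {a b n n' : ℤ} {f g : LR} (hf : Le a b n f) (hg : Le a b n' g) :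
    Le a b (n + n') (f * g) ∧ comp a b (n + n') (f * g) = comp a b n f * comp a b n' g := by
  refine hf.induction (P := fun f => Le a b (n + n') (f * g) ∧
    comp a b (n + n') (f * g) = comp a b n f * comp a b n' g) ?_ ?_ ?_
  · simp [Le_zero]
  · rintro f1 f2 ⟨h1, h2⟩ ⟨h3, h4⟩
    rw [add_mul]
    exact ⟨h1.add h3, by rw [map_add, map_add, h2, h4, add_mul]⟩
  intro i j hij c
  refine hg.induction (P := fun g => Le a b (n + n') ((c • mo i j) * g) ∧
    comp a b (n + n') ((c • mo i j) * g) = comp a b n (c • mo i j) * comp a b n' g) ?_ ?_ ?_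
  · simp [Le_zero]
  · rintro f1 f2 ⟨h1, h2⟩ ⟨h3, h4⟩
    rw [mul_add]
    exact ⟨h1.add h3, by rw [map_add, map_add, h2, h4, mul_add]⟩
  intro k l hkl e
  rw [smul_mul_smul_comm, mo_mul]
  refine ⟨(Le_mo (by linarith)).smul _, ?_⟩
  rw [comp_smul_mo, comp_smul_mo, comp_smul_mo]
  by_cases h1 : a * i + b * j = n
  · by_cases h2 : a * k + b * l = n'
    · rw [if_pos (by linarith), if_pos h1, if_pos h2, smul_mul_smul_comm, mo_mul]
    · rw [if_neg (fun h => h2 (by linarith)), if_neg h2, mul_zero]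
  · rw [if_neg (fun h => h1 (by linarith)), if_neg h1, zero_mul]

lemma Le.mul {a b n n' : ℤ} {f g : LR} (hf : Le a b n f) (hg : Le a b n' g) :
    Le a b (n + n') (f * g) := (hf.mul_comp hg).1

lemma comp_mul {a b n n' : ℤ} {f g : LR} (hf : Le a b n f) (hg : Le a b n' g) :
    comp a b (n + n') (f * g) = comp a b n f * comp a b n' g := (hf.mul_comp hg).2

lemma Le_one (a b : ℤ) : Le a b 0 1 := by rw [← mo_zero]; exact Le_mo (by simp)

lemma comp_one (a b : ℤ) : comp a b 0 1 = 1 := by rw [← mo_zero, comp_mo]; simp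

lemma Le.pow_comp {a b n : ℤ} {f : LR} (hf : Le a b n f) (k : ℕ) :
    Le a b (k * n) (f ^ k) ∧ comp a b (k * n) (f ^ k) = comp a b n f ^ k := by
  induction k with
  | zero => simp [Le_one, comp_one]
  | succ k ih =>
    rw [pow_succ, pow_succ, show ((k + 1 : ℕ) : ℤ) * n = k * n + n by push_cast; ring]
    exact ⟨ih.1.mul hf, by rw [comp_mul ih.1 hf, ih.2]⟩

lemma comp_of_lt {a b n n' : ℤ} {f : LR} (hf : Le a b n f) (h : n < n') : comp a b n' f = 0 := by
  apply AddMonoidAlgebra.coeff_injective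
  ext m
  rw [comp_coeff]
  split_ifs with h1
  · by_contra h2
    have := hf m h2
    omega
  · simp

lemma Le_comp (a b n : ℤ) (f : LR) : Le a b n (comp a b n f) := by
  intro m hm
  rw [comp_coeff] at hm
  by_contra h
  exact hm (if_neg (by omega))

lemma Le.pred {a b n : ℤ} {f : LR} (hf : Le a b n f) (h : comp a b n f = 0) : Le a b (n - 1) f := by
  intro m hm
  have h1 := hf m hm
  rcases lt_or_eq_of_le h1 with h2 | h2
  · omega
  · exfalso
    have := comp_coeff a b n f m
    rw [h, if_pos h2] at this
    exact hm (by simpa using this.symm)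

/-- `f` has weighted degree exactly `n`. -/
def HD (a b n : ℤ) (f : LR) : Prop := Le a b n f ∧ comp a b n f ≠ 0

lemma HD.ne_zero {a b n : ℤ} {f : LR} (h : HD a b n f) : f ≠ 0 := by
  rintro rfl; exact h.2 (by simp)

lemma HD.mul {a b n n' : ℤ} {f g : LR} (hf : HD a b n f) (hg : HD a b n' g) :
    HD a b (n + n') (f * g) :=
  ⟨hf.1.mul hg.1, by rw [comp_mul hf.1 hg.1]; exact mul_ne_zero hf.2 hg.2⟩

lemma HD.pow {a b n : ℤ} {f : LR} (hf : HD a b n f) (k : ℕ) : HD a b (k * n) (f ^ k) :=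
  ⟨(hf.1.pow_comp k).1, by rw [(hf.1.pow_comp k).2]; exact pow_ne_zero _ hf.2⟩

lemma HD.unique {a b n n' : ℤ} {f : LR} (h : HD a b n f) (h' : HD a b n' f) : n = n' := by
  rcases lt_trichotomy n n' with h1 | h1 | h1
  · exact absurd (comp_of_lt h.1 h1) h'.2
  · exact h1
  · exact absurd (comp_of_lt h'.1 h1) h.2

lemma HD.le {a b n n' : ℤ} {f : LR} (h : HD a b n f) (h' : Le a b n' f) : n ≤ n' := by
  by_contra h1
  exact h.2 (comp_of_lt h' (by omega))

lemma HD.add_lt {a b n n' : ℤ} {f g : LR} (hf : HD a b n f) (hg : Le a b n' g) (h : n' < n) :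
    HD a b n (f + g) :=
  ⟨hf.1.add (hg.mono h.le), by rw [map_add, comp_of_lt hg h, add_zero]; exact hf.2⟩

lemma HD.smul {a b n : ℤ} {f : LR} (hf : HD a b n f) {c : ℂ} (hc : c ≠ 0) : HD a b n (c • f) :=
  ⟨hf.1.smul c, by rw [map_smul]; exact smul_ne_zero hc hf.2⟩

lemma HD_mo (a b i j : ℤ) : HD a b (a * i + b * j) (mo i j) :=
  ⟨Le_mo le_rfl, by rw [comp_mo, if_pos rfl]; exact mo_ne_zero i j⟩

lemma HD_one (a b : ℤ) : HD a b 0 1 := ⟨Le_one a b, by rw [comp_one]; exact one_ne_zero⟩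

lemma HD_exists (a b : ℤ) {f : LR} (hf : f ≠ 0) : ∃ n, HD a b n f := by
  have hne : f.coeff.support.Nonempty := by
    rw [Finsupp.support_nonempty_iff]; simpa using hf
  obtain ⟨m, hm, hmax⟩ := f.coeff.support.exists_max_image (wt a b) hne
  refine ⟨wt a b m, fun m' hm' => hmax m' (by simpa using hm'), fun h => ?_⟩
  have := comp_coeff a b (wt a b m) f m
  rw [h, if_pos rfl] at this
  exact (Finsupp.mem_support_iff.1 hm) (by simpa using this.symm)

/-- Euler type derivations. -/
def EuLin (χ : ℤ × ℤ →+ ℂ) : LR →ₗ[ℂ] LR where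
  toFun f := AddMonoidAlgebra.ofCoeff
    (Finsupp.onFinset f.coeff.support (fun m => χ m * f.coeff m) (by
      intro m h; simp at h ⊢; exact h.2))
  map_add' f g := by
    apply AddMonoidAlgebra.coeff_injective; ext m; simp [mul_add]
  map_smul' c f := by
    apply AddMonoidAlgebra.coeff_injective; ext m; simp; ring

lemma EuLin_coeff (χ : ℤ × ℤ →+ ℂ) (f : LR) (m : ℤ × ℤ) :
    (EuLin χ f).coeff m = χ m * f.coeff m := rfl

lemma EuLin_mo (χ : ℤ × ℤ →+ ℂ) (i j : ℤ) : EuLin χ (mo i j) = χ (i, j) • mo i j := by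
  apply AddMonoidAlgebra.coeff_injective; ext m
  rw [EuLin_coeff, AddMonoidAlgebra.coeff_smul, Finsupp.smul_apply, mo_coeff]
  split_ifs with h
  · rw [h]; simp
  · simp

lemma all_induction {P : LR → Prop} (f : LR) (h0 : P 0)
    (ha : ∀ f g, P f → P g → P (f + g)) (hs : ∀ (i j : ℤ) (c : ℂ), P (c • mo i j)) : P f :=
  supp_induction Set.univ f (fun _ _ => trivial) h0 ha (fun m _ c => hs m.1 m.2 c)

def Eu (χ : ℤ × ℤ →+ ℂ) : Derivation ℂ LR LR := Derivation.mk' (EuLin χ) (by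
  intro f g
  induction f using all_induction with
  | h0 => simp
  | ha f1 f2 h1 h2 => rw [add_mul, map_add, h1, h2, map_add, add_smul, smul_add]; abel
  | hs i j c =>
    induction g using all_induction with
    | h0 => simp
    | ha f1 f2 h1 h2 => rw [mul_add, map_add, h1, h2, map_add, add_smul, smul_add]; abel
    | hs k l e =>
      simp only [smul_mul_smul_comm, mo_mul, map_smul, EuLin_mo, smul_eq_mul, smul_mul_assoc,
        mul_smul_comm, smul_smul,
        show ((i + k, j + l) : ℤ × ℤ) = (i, j) + (k, l) from rfl, map_add]
      rw [add_comm k i, add_comm l j, ← add_smul]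
      congr 1; ring)

lemma Eu_apply (χ : ℤ × ℤ →+ ℂ) (f : LR) : Eu χ f = EuLin χ f := rfl

lemma Eu_mo (χ : ℤ × ℤ →+ ℂ) (i j : ℤ) : Eu χ (mo i j) = χ (i, j) • mo i j := EuLin_mo χ i j

lemma Eu_Le {χ : ℤ × ℤ →+ ℂ} {a b n : ℤ} {f : LR} (h : Le a b n f) : Le a b n (Eu χ f) := by
  intro m hm
  rw [Eu_apply, EuLin_coeff] at hm
  exact h m (right_ne_zero_of_mul hm)

lemma Eu_comp (χ : ℤ × ℤ →+ ℂ) (a b n : ℤ) (f : LR) :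
    comp a b n (Eu χ f) = Eu χ (comp a b n f) := by
  apply AddMonoidAlgebra.coeff_injective; ext m
  rw [comp_coeff, Eu_apply, Eu_apply, EuLin_coeff, EuLin_coeff, comp_coeff]
  split_ifs <;> simp

def χ1 : ℤ × ℤ →+ ℂ := (Int.castAddHom ℂ).comp (AddMonoidHom.fst ℤ ℤ)
def χ2 : ℤ × ℤ →+ ℂ := (Int.castAddHom ℂ).comp (AddMonoidHom.snd ℤ ℤ)

/-- The derivation `P u ∂_u + Q v ∂_v`. -/
def DR (P Q : LR) : Derivation ℂ LR LR := P • Eu χ1 + Q • Eu χ2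

lemma DR_apply (P Q f : LR) : DR P Q f = P * Eu χ1 f + Q * Eu χ2 f := rfl

lemma DR_mo (P Q : LR) (i j : ℤ) :
    DR P Q (mo i j) = ((i : ℂ) • P + (j : ℂ) • Q) * mo i j := by
  rw [DR_apply, Eu_mo, Eu_mo, add_mul, mul_smul_comm, mul_smul_comm, smul_mul_assoc, smul_mul_assoc]
  rfl

lemma DR_comp {a b N n : ℤ} {P Q f : LR} (hP : Le a b N P) (hQ : Le a b N Q) (hf : Le a b n f) :
    Le a b (N + n) (DR P Q f) ∧
    comp a b (N + n) (DR P Q f) = DR (comp a b N P) (comp a b N Q) (comp a b n f) := by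
  rw [DR_apply, DR_apply]
  refine ⟨(hP.mul (Eu_Le hf)).add (hQ.mul (Eu_Le hf)), ?_⟩
  rw [map_add, comp_mul hP (Eu_Le hf), comp_mul hQ (Eu_Le hf), Eu_comp, Eu_comp]

lemma DR_iter {a b N : ℤ} {P Q : LR} (hP : Le a b N P) (hQ : Le a b N Q) (k : ℕ) :
    ∀ {n : ℤ} {f : LR}, Le a b n f →
    comp a b (k * N + n) ((DR P Q)^[k] f) =
      (DR (comp a b N P) (comp a b N Q))^[k] (comp a b n f) := by
  induction k with
  | zero => intro n f hf; simp
  | succ k ih =>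
    intro n f hf
    have h := DR_comp hP hQ hf
    rw [Function.iterate_succ_apply, Function.iterate_succ_apply, ← h.2, ← ih h.1]
    congr 2
    push_cast; ring

end

end RF

namespace RF

section LND
variable {R : Type*} [CommRing R] [Algebra ℂ R] (D : Derivation ℂ R R)

def NN (f : R) : Prop := ∃ k : ℕ, D^[k] f = 0
def ND (f : R) (n : ℕ) : Prop := D^[n] f ≠ 0 ∧ D^[n + 1] f = 0

lemma it_zero (k : ℕ) : D^[k] (0 : R) = 0 := by
  induction k with
  | zero => rfl
  | succ k ih => rw [Function.iterate_succ_apply', ih, map_zero]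

lemma it_add (k : ℕ) (f g : R) : D^[k] (f + g) = D^[k] f + D^[k] g := by
  induction k with
  | zero => rfl
  | succ k ih => rw [Function.iterate_succ_apply', ih, map_add,
      Function.iterate_succ_apply', Function.iterate_succ_apply']

lemma it_smul (k : ℕ) (c : ℂ) (f : R) : D^[k] (c • f) = c • D^[k] f := by
  induction k with
  | zero => rfl
  | succ k ih => rw [Function.iterate_succ_apply', ih, D.map_smul, Function.iterate_succ_apply']

lemma it_vanish {f : R} {k l : ℕ} (h : D^[k] f = 0) (hl : k ≤ l) : D^[l] f = 0 := by
  obtain ⟨r, rfl⟩ := Nat.exists_eq_add_of_le hl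
  rw [add_comm, Function.iterate_add_apply, h, it_zero]

lemma it_const {f : R} (hf : D f = 0) (k : ℕ) (g : R) : D^[k] (f * g) = f * D^[k] g := by
  induction k with
  | zero => rfl
  | succ k ih => rw [Function.iterate_succ_apply', ih, Function.iterate_succ_apply', D.leibniz, hf]; simp

lemma it_mul (N : ℕ) : ∀ (m n : ℕ) (f g : R), m + n = N → D^[m + 1] f = 0 → D^[n + 1] g = 0 →
    D^[m + n] (f * g) = ((m + n).choose m : R) * (D^[m] f * D^[n] g) := by
  induction N with
  | zero =>
    intro m n f g h hf hg
    obtain rfl : m = 0 := by omega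
    obtain rfl : n = 0 := by omega
    simp
  | succ N ih =>
    intro m n f g h hf hg
    rcases m with _ | m
    · have : D f = 0 := hf
      rw [zero_add, it_const D this]; simp
    rcases n with _ | n
    · have : D g = 0 := hg
      rw [add_zero, mul_comm f g, it_const D this]; simp [mul_comm]
    have e : m + 1 + (n + 1) = (m + n + 1) + 1 := by ring
    rw [e, Function.iterate_succ_apply, D.leibniz, it_add, smul_eq_mul, smul_eq_mul]
    have h1 := ih (m + 1) n f (D g) (by omega) hf hg
    have h2 := ih m (n + 1) (D f) g (by omega) hf hg
    rw [show m + n + 1 = m + 1 + n by ring, h1, mul_comm g, show m + 1 + n = m + (n + 1) by ring, h2]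
    rw [Function.iterate_succ_apply _ n g, Function.iterate_succ_apply _ m f,
      show m + (n + 1) + 1 = (m + n + 1) + 1 by ring, Nat.choose_succ_succ]
    push_cast
    rw [show m + (n + 1) = m + n + 1 by ring]
    ring

lemma it_mul_vanish {m n : ℕ} {f g : R} (hf : D^[m + 1] f = 0) (hg : D^[n + 1] g = 0) :
    D^[m + n + 1] (f * g) = 0 := by
  rw [Function.iterate_succ_apply', it_mul D _ m n f g rfl hf hg]
  rw [D.leibniz, D.leibniz, ← Function.iterate_succ_apply' (⇑D), ← Function.iterate_succ_apply' (⇑D), hf, hg]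
  simp

variable {D}

lemma NN.add {f g : R} (hf : NN D f) (hg : NN D g) : NN D (f + g) := by
  obtain ⟨k, hk⟩ := hf
  obtain ⟨l, hl⟩ := hg
  exact ⟨k + l, by rw [it_add, it_vanish D hk (by omega), it_vanish D hl (by omega), add_zero]⟩

lemma NN.smul {f : R} (hf : NN D f) (c : ℂ) : NN D (c • f) := by
  obtain ⟨k, hk⟩ := hf
  exact ⟨k, by rw [it_smul, hk, smul_zero]⟩

lemma NN.mul {f g : R} (hf : NN D f) (hg : NN D g) : NN D (f * g) := by
  obtain ⟨k, hk⟩ := hf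
  obtain ⟨l, hl⟩ := hg
  exact ⟨k + l + 1, it_mul_vanish D (it_vanish D hk (by omega)) (it_vanish D hl (by omega))⟩

lemma NN_of_ker {f : R} (hf : D f = 0) : NN D f := ⟨1, hf⟩

lemma NN_of_D {f : R} (hf : NN D (D f)) : NN D f := by
  obtain ⟨k, hk⟩ := hf
  exact ⟨k + 1, hk⟩

lemma NN_one : NN D 1 := NN_of_ker (by simp)

lemma NN.pow {f : R} (hf : NN D f) (k : ℕ) : NN D (f ^ k) := by
  induction k with
  | zero => rw [pow_zero]; exact NN_one
  | succ k ih => rw [pow_succ]; exact ih.mul hf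

lemma NN_algebraMap (c : ℂ) : NN D (algebraMap ℂ R c) := NN_of_ker (by simp)

lemma NN_adjoin {s : Set R} (h : ∀ f ∈ s, NN D f) {f : R} (hf : f ∈ Algebra.adjoin ℂ s) : NN D f := by
  induction hf using Algebra.adjoin_induction with
  | mem x hx => exact h x hx
  | algebraMap r => exact NN_algebraMap r
  | add x y _ _ hx hy => exact hx.add hy
  | mul x y _ _ hx hy => exact hx.mul hy

lemma NN.exists {f : R} (hf : NN D f) (h0 : f ≠ 0) : ∃ n, ND D f n := by
  classical
  have hk : D^[Nat.find hf] f = 0 := Nat.find_spec hf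
  have : Nat.find hf ≠ 0 := by
    intro h; rw [h] at hk; exact h0 hk
  obtain ⟨n, hn⟩ := Nat.exists_eq_succ_of_ne_zero this
  refine ⟨n, Nat.find_min hf (by omega), ?_⟩
  rw [hn] at hk; exact hk

lemma ND.unique {f : R} {m n : ℕ} (h : ND D f m) (h' : ND D f n) : m = n := by
  rcases lt_trichotomy m n with h1 | h1 | h1
  · exact absurd (it_vanish D h.2 h1) h'.1
  · exact h1
  · exact absurd (it_vanish D h'.2 h1) h.1

lemma ND.zero_iff {f : R} {m : ℕ} (h : ND D f m) : D f = 0 ↔ m = 0 := by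
  constructor
  · intro h'
    rcases m with _ | m
    · rfl
    · exact absurd (by rw [Function.iterate_succ_apply, h', it_zero]) h.1
  · rintro rfl; exact h.2

lemma ND.deriv {f : R} {m : ℕ} (h : ND D f (m + 1)) : ND D (D f) m := h

variable [IsDomain R]

lemma ND.mul {f g : R} {m n : ℕ} (hf : ND D f m) (hg : ND D g n) : ND D (f * g) (m + n) := by
  refine ⟨?_, it_mul_vanish D hf.2 hg.2⟩
  rw [it_mul D _ m n f g rfl hf.2 hg.2]
  refine mul_ne_zero ?_ (mul_ne_zero hf.1 hg.1)
  have : CharZero R := charZero_of_injective_algebraMap (FaithfulSMul.algebraMap_injective ℂ R)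
  exact_mod_cast (Nat.choose_pos (by omega)).ne'

lemma ND.pow {f : R} {m : ℕ} (hf : ND D f m) (k : ℕ) : ND D (f ^ k) (k * m) := by
  induction k with
  | zero => simp [ND]
  | succ k ih => rw [pow_succ, show (k + 1) * m = k * m + m by ring]; exact ih.mul hf

lemma ND.smul {f : R} {m : ℕ} (hf : ND D f m) {c : ℂ} (hc : c ≠ 0) : ND D (c • f) m := by
  refine ⟨?_, ?_⟩
  · rw [it_smul]; exact smul_ne_zero hc hf.1
  · rw [it_smul, hf.2, smul_zero]

lemma ker_of_mul {f g : R} (hf : NN D f) (hg : NN D g) (h0 : f * g ≠ 0) (h : D (f * g) = 0) :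
    D f = 0 ∧ D g = 0 := by
  obtain ⟨m, hm⟩ := hf.exists (left_ne_zero_of_mul h0)
  obtain ⟨n, hn⟩ := hg.exists (right_ne_zero_of_mul h0)
  have := ((hm.mul hn).zero_iff).1 h
  exact ⟨hm.zero_iff.2 (by omega), hn.zero_iff.2 (by omega)⟩

lemma ker_of_pow {f : R} {k : ℕ} (hk : k ≠ 0) (h : D (f ^ k) = 0) : D f = 0 := by
  by_cases h0 : f = 0
  · simp [h0]
  rw [D.leibniz_pow] at h
  have : CharZero R := charZero_of_injective_algebraMap (FaithfulSMul.algebraMap_injective ℂ R)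
  rcases smul_eq_zero.1 h with h | h
  · exact absurd h hk
  · rcases smul_eq_zero.1 h with h | h
    · exact absurd h (pow_ne_zero _ h0)
    · exact h

end LND

end RF

namespace RF
open Polynomial

noncomputable section

structure Dan (d : ℕ) (p : Polynomial ℂ) {B : Type} [CommRing B] [Algebra ℂ B] (x y z : B) : Prop where
  hd : 3 ≤ d
  monic : p.Monic
  deg : p.natDegree = d
  red : p.coeff (d - 1) = 0
  real : p.map (starRingEnd ℂ) = p
  rel : x * y = Polynomial.aeval z p
  gen : Algebra.adjoin ℂ {x, y, z} = (⊤ : Subalgebra ℂ B)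
  lift : ∀ {C : Type} [CommRing C] (k : ℂ →+* C) (X Y Z : C), X * Y = p.eval₂ k Z →
    ∃ f : B →+* C, (∀ c, f (algebraMap ℂ B c) = k c) ∧ f x = X ∧ f y = Y ∧ f z = Z

lemma Dan.swap {d : ℕ} {p : Polynomial ℂ} {B : Type} [CommRing B] [Algebra ℂ B] {x y z : B}
    (H : Dan d p x y z) : Dan d p y x z where
  hd := H.hd
  monic := H.monic
  deg := H.deg
  red := H.red
  real := H.real
  rel := by rw [mul_comm]; exact H.rel
  gen := by rw [← H.gen, Set.insert_comm]
  lift k X Y Z h := by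
    obtain ⟨f, h1, h2, h3, h4⟩ := H.lift k Y X Z (by rw [mul_comm]; exact h)
    exact ⟨f, h1, h3, h2, h4⟩

lemma Le_aeval {a b w : ℤ} (hw : 0 < w) {Z : LR} (hZ : Le a b w Z) {p : Polynomial ℂ} (hp : p.Monic) :
    Le a b (p.natDegree * w) (aeval Z p) ∧
      comp a b (p.natDegree * w) (aeval Z p) = comp a b w Z ^ p.natDegree := by
  have e : aeval Z p = Z ^ p.natDegree + ∑ i ∈ Finset.range p.natDegree, p.coeff i • Z ^ i := by
    conv_lhs => rw [hp.as_sum]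
    simp [Algebra.smul_def]
  have h2 : Le a b (p.natDegree * w - 1) (∑ i ∈ Finset.range p.natDegree, p.coeff i • Z ^ i) := by
    apply Le.sum
    intro i hi
    refine (((hZ.pow_comp i).1).smul _).mono ?_
    rw [Finset.mem_range] at hi
    have : (i : ℤ) + 1 ≤ p.natDegree := by exact_mod_cast hi
    nlinarith
  rw [e]
  refine ⟨(hZ.pow_comp _).1.add (h2.mono (by omega)), ?_⟩
  rw [map_add, comp_of_lt h2 (by omega), (hZ.pow_comp _).2, add_zero]

def yL (d : ℕ) (p : Polynomial ℂ) : LR := aeval (mo 1 1) p * mo (-d) 0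

lemma yL_top {a b : ℤ} (hab : 0 < a + b) {d : ℕ} {p : Polynomial ℂ} (hp : p.Monic) (hd : p.natDegree = d) :
    Le a b (b * d) (yL d p) ∧ comp a b (b * d) (yL d p) = mo 0 d := by
  have h1 : Le a b (a + b) (mo 1 1) := Le_mo (by omega)
  have h2 := Le_aeval hab h1 hp
  have h3 : Le a b (-(a * d)) (mo (-d) 0) := Le_mo (by linarith)
  rw [hd] at h2
  have e : b * d = d * (a + b) + -(a * d) := by ring
  rw [yL, e]
  refine ⟨h2.1.mul h3, ?_⟩
  rw [comp_mul h2.1 h3, h2.2, comp_mo, comp_mo, if_pos (by ring), if_pos (by ring), mo_pow, mo_mul]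
  congr 1 <;> ring

variable {d : ℕ} {p : Polynomial ℂ} {B : Type} [CommRing B] [Algebra ℂ B] {x y z : B}

namespace Dan

lemma dpos (H : Dan d p x y z) : 0 < d := by have := H.hd; omega

lemma io_exists (H : Dan d p x y z) :
    ∃ f : B →ₐ[ℂ] LR, f x = mo d 0 ∧ f y = yL d p ∧ f z = mo 1 1 := by
  obtain ⟨f, h1, h2⟩ := H.lift (algebraMap ℂ LR) (mo d 0) (yL d p) (mo 1 1) (by
    rw [yL, mul_comm, mul_assoc, mo_mul]
    simp only [neg_add_cancel, add_zero, mo_zero, mul_one]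
    rfl)
  exact ⟨{ f with commutes' := h1 }, h2⟩

def io (H : Dan d p x y z) : B →ₐ[ℂ] LR := H.io_exists.choose
lemma io_x (H : Dan d p x y z) : H.io x = mo d 0 := H.io_exists.choose_spec.1
lemma io_y (H : Dan d p x y z) : H.io y = yL d p := H.io_exists.choose_spec.2.1
lemma io_z (H : Dan d p x y z) : H.io z = mo 1 1 := H.io_exists.choose_spec.2.2

lemma be_top (H : Dan d p x y z) {a b : ℤ} (hab : 0 < a + b) (s t j : ℕ) :
    Le a b (a * (d * s + j) + b * (d * t + j)) (H.io (x ^ s * y ^ t * z ^ j)) ∧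
    comp a b (a * (d * s + j) + b * (d * t + j)) (H.io (x ^ s * y ^ t * z ^ j)) =
      mo (d * s + j) (d * t + j) := by
  have hx : Le a b (a * d) (mo d 0) := Le_mo (by linarith)
  have hz : Le a b (a + b) (mo 1 1) := Le_mo (by linarith)
  have hy := yL_top hab H.monic H.deg
  have e : a * (d * s + j) + b * (d * t + j) = s * (a * d) + t * (b * d) + j * (a + b) := by ring
  rw [map_mul, map_mul, map_pow, map_pow, map_pow, H.io_x, H.io_y, H.io_z, e]
  have h1 := ((hx.pow_comp s).1.mul (hy.1.pow_comp t).1)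
  have h2 := (hz.pow_comp j).1
  refine ⟨h1.mul h2, ?_⟩
  rw [comp_mul h1 h2, comp_mul (hx.pow_comp s).1 (hy.1.pow_comp t).1, (hx.pow_comp s).2,
    (hy.1.pow_comp t).2, (hz.pow_comp j).2, hy.2, comp_mo, comp_mo, if_pos (by ring), if_pos (by ring),
    mo_pow, mo_pow, mo_pow, mo_mul, mo_mul]
  congr 1 <;> ring

end Dan

abbrev II := {i : ℕ × ℕ × ℕ // i.1 = 0 ∨ i.2.1 = 0}

def be (x y z : B) (i : II) : B := x ^ i.1.1 * y ^ i.1.2.1 * z ^ i.1.2.2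

def ee (d : ℕ) (i : II) : ℤ × ℤ := (d * i.1.1 + i.1.2.2, d * i.1.2.1 + i.1.2.2)

lemma ee_inj {d : ℕ} (hd : 0 < d) : Function.Injective (ee d) := by
  rintro ⟨⟨s, t, j⟩, h⟩ ⟨⟨s', t', j'⟩, h'⟩ he
  simp only [ee, Prod.mk.injEq] at he
  obtain ⟨h1, h2⟩ := he
  norm_cast at h1 h2
  have key : s = s' ∧ t = t' := by
    rcases h with h | h <;> rcases h' with h' | h' <;> simp only at h h' <;> subst h <;> subst h'
    · have : j = j' := by omega
      subst this
      exact ⟨rfl, Nat.eq_of_mul_eq_mul_left hd (by omega)⟩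
    · have h3 : d * s' = 0 := by omega
      have h4 : d * t = 0 := by omega
      have := Nat.pos_iff_ne_zero.1 hd
      simp [this] at h3 h4
      simp [h3, h4]
    · have h3 : d * s = 0 := by omega
      have h4 : d * t' = 0 := by omega
      have := Nat.pos_iff_ne_zero.1 hd
      simp [this] at h3 h4
      simp [h3, h4]
    · have : j = j' := by omega
      subst this
      exact ⟨Nat.eq_of_mul_eq_mul_left hd (by omega), rfl⟩
  obtain ⟨rfl, rfl⟩ := key
  have : j = j' := by omega
  subst this; rfl

namespace Dan

lemma be_span_z (V : Submodule ℂ B) (s t : ℕ) (hV : ∀ j, x ^ s * y ^ t * z ^ j ∈ V) (q : Polynomial ℂ) (j : ℕ) :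
    aeval z q * (x ^ s * y ^ t * z ^ j) ∈ V := by
  rw [aeval_eq_sum_range, Finset.sum_mul]
  refine Submodule.sum_mem _ (fun i _ => ?_)
  rw [smul_mul_assoc]
  refine V.smul_mem _ ?_
  convert hV (i + j) using 1
  ring

lemma span (H : Dan d p x y z) : Submodule.span ℂ (Set.range (be x y z)) = ⊤ := by
  set V := Submodule.span ℂ (Set.range (be x y z)) with hV
  have hm : ∀ s t j : ℕ, s = 0 ∨ t = 0 → x ^ s * y ^ t * z ^ j ∈ V := fun s t j h =>
    Submodule.subset_span ⟨⟨⟨s, t, j⟩, h⟩, rfl⟩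
  have key : ∀ b : B, b ∈ Algebra.adjoin ℂ {x, y, z} → ∀ v ∈ V, b * v ∈ V := by
    intro b hb
    induction hb using Algebra.adjoin_induction with
    | algebraMap r => intro v hv; rw [← Algebra.smul_def]; exact V.smul_mem _ hv
    | add a b _ _ h1 h2 => intro v hv; rw [add_mul]; exact V.add_mem (h1 v hv) (h2 v hv)
    | mul a b _ _ h1 h2 => intro v hv; rw [mul_assoc]; exact h1 _ (h2 v hv)
    | mem b hb =>
      intro v hv
      induction hv using Submodule.span_induction with
      | zero => simp
      | add v w _ _ h1 h2 => rw [mul_add]; exact V.add_mem h1 h2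
      | smul c v _ h1 => rw [mul_smul_comm]; exact V.smul_mem _ h1
      | mem v hv =>
        obtain ⟨⟨⟨s, t, j⟩, h⟩, rfl⟩ := hv
        simp only [be] at h ⊢
        rcases hb with rfl | rfl | rfl
        · rcases t with _ | t
          · convert hm (s + 1) 0 j (Or.inr rfl) using 1
            ring
          · obtain rfl : s = 0 := by omega
            convert be_span_z V 0 t (fun j => hm 0 t j (Or.inl rfl)) p j using 1
            rw [← H.rel]; ring
        · rcases s with _ | s
          · convert hm 0 (t + 1) j (Or.inl rfl) using 1
            ring
          · obtain rfl : t = 0 := by omega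
            convert be_span_z V s 0 (fun j => hm s 0 j (Or.inr rfl)) p j using 1
            rw [← H.rel]; ring
        · convert hm s t (j + 1) h using 1
          ring
  rw [eq_top_iff]
  intro b _
  have := key b (by rw [H.gen]; trivial) 1 (by simpa using hm 0 0 0 (Or.inl rfl))
  simpa using this

lemma be_top' (H : Dan d p x y z) {a b : ℤ} (hab : 0 < a + b) (i : II) :
    Le a b (wt a b (ee d i)) (H.io (be x y z i)) ∧
    comp a b (wt a b (ee d i)) (H.io (be x y z i)) = mo (ee d i).1 (ee d i).2 :=
  H.be_top hab _ _ _

lemma nf_coeff (H : Dan d p x y z) {a b : ℤ} (hab : 0 < a + b) (c : II →₀ ℂ) (i0 : II)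
    (hmax : ∀ i ∈ c.support, wt a b (ee d i) ≤ wt a b (ee d i0)) :
    (comp a b (wt a b (ee d i0)) (H.io (c.sum fun i r => r • be x y z i))).coeff (ee d i0) = c i0 := by
  classical
  rw [Finsupp.sum, map_sum, map_sum]
  have : ∀ i ∈ c.support, comp a b (wt a b (ee d i0)) (H.io (c i • be x y z i)) =
      if wt a b (ee d i) = wt a b (ee d i0) then c i • mo (ee d i).1 (ee d i).2 else 0 := by
    intro i hi
    rw [map_smul, map_smul]
    split_ifs with h
    · rw [← h, (H.be_top' hab i).2]
    · rw [comp_of_lt (H.be_top' hab i).1 (lt_of_le_of_ne (hmax i hi) h), smul_zero]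
  rw [Finset.sum_congr rfl this, AddMonoidAlgebra.coeff_sum, Finsupp.finsetSum_apply]
  rw [Finset.sum_eq_single i0]
  · simp [mo_coeff]
  · intro i _ hne
    split_ifs
    · simp only [AddMonoidAlgebra.coeff_smul, Finsupp.smul_apply, mo_coeff, smul_eq_mul]
      rw [if_neg (fun h => hne (ee_inj H.dpos h)), mul_zero]
    · simp
  · intro h
    rw [Finsupp.notMem_support_iff] at h
    simp [h]

/-- normal form lemma -/
lemma nf (H : Dan d p x y z) {a b : ℤ} (hab : 0 < a + b) {n : ℤ} {f : B} (hf : Le a b n (H.io f)) :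
    f ∈ Submodule.span ℂ (be x y z '' {i | wt a b (ee d i) ≤ n}) := by
  have hmem : f ∈ Submodule.span ℂ (Set.range (be x y z)) := by rw [H.span]; trivial
  obtain ⟨c, rfl⟩ := Finsupp.mem_span_range_iff_exists_finsupp.1 hmem
  by_cases h0 : c.support.Nonempty
  · obtain ⟨i0, hi0, hmax⟩ := c.support.exists_max_image (fun i => wt a b (ee d i)) h0
    have hle : wt a b (ee d i0) ≤ n := by
      by_contra hlt
      have := H.nf_coeff hab c i0 hmax
      rw [comp_of_lt hf (by omega)] at this
      exact (Finsupp.mem_support_iff.1 hi0) (by simpa using this.symm)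
    refine Submodule.sum_mem _ (fun i hi => Submodule.smul_mem _ _ (Submodule.subset_span ⟨i, ?_, rfl⟩))
    exact (hmax i hi).trans hle
  · rw [Finset.not_nonempty_iff_eq_empty, Finsupp.support_eq_empty] at h0
    subst h0
    simp

lemma io_inj (H : Dan d p x y z) : Function.Injective H.io := by
  rw [injective_iff_map_eq_zero]
  intro f hf
  have hmem : f ∈ Submodule.span ℂ (Set.range (be x y z)) := by rw [H.span]; trivial
  obtain ⟨c, rfl⟩ := Finsupp.mem_span_range_iff_exists_finsupp.1 hmem
  by_cases h0 : c.support.Nonempty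
  · exfalso
    obtain ⟨i0, hi0, hmax⟩ := c.support.exists_max_image (fun i => wt 1 1 (ee d i)) h0
    have := H.nf_coeff (a := 1) (b := 1) (by norm_num) c i0 hmax
    rw [hf] at this
    exact (Finsupp.mem_support_iff.1 hi0) (by simpa using this.symm)
  · rw [Finset.not_nonempty_iff_eq_empty, Finsupp.support_eq_empty] at h0
    subst h0
    simp

lemma isDomain (H : Dan d p x y z) : IsDomain B :=
  H.io_inj.isDomain H.io.toRingHom

lemma io_ne (H : Dan d p x y z) {f : B} (hf : f ≠ 0) : H.io f ≠ 0 := by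
  rw [Ne, map_eq_zero_iff _ H.io_inj]; exact hf

lemma x_ne (H : Dan d p x y z) : x ≠ 0 := by
  intro h
  have h1 : H.io x = 0 := (congrArg H.io h).trans (map_zero _)
  rw [H.io_x] at h1; exact mo_ne_zero _ _ h1

lemma induct (H : Dan d p x y z) {a b : ℤ} (hab : 0 < a + b) {n : ℤ} {f : B} (hf : Le a b n (H.io f))
    {P : B → Prop} (h0 : P 0) (ha : ∀ f g, P f → P g → P (f + g)) (hs : ∀ (c : ℂ) f, P f → P (c • f))
    (hb : ∀ s t j : ℕ, s = 0 ∨ t = 0 → a * (d * s + j) + b * (d * t + j) ≤ n → P (x ^ s * y ^ t * z ^ j)) : P f := by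
  have := H.nf hab hf
  clear hf
  induction this using Submodule.span_induction with
  | zero => exact h0
  | add f g _ _ h1 h2 => exact ha f g h1 h2
  | smul c f _ h => exact hs c f h
  | mem f hf =>
    obtain ⟨⟨⟨s, t, j⟩, h⟩, hi, rfl⟩ := hf
    exact hb s t j h hi

/-- support in the monoid, residue `r` -/
def _root_.RF.SS (d : ℕ) (r : ℤ) (f : LR) : Prop :=
  ∀ m, f.coeff m ≠ 0 → 0 ≤ m.1 ∧ 0 ≤ m.2 ∧ (d : ℤ) ∣ m.1 - m.2 - r

lemma comp_SS (H : Dan d p x y z) {a b : ℤ} (hab : 0 < a + b) {n : ℤ} {f : B} (hf : Le a b n (H.io f)) :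
    SS d 0 (comp a b n (H.io f)) := by
  have : Le a b n (H.io f) ∧ SS d 0 (comp a b n (H.io f)) := by
    refine H.induct hab hf (P := fun f => Le a b n (H.io f) ∧ SS d 0 (comp a b n (H.io f))) ?_ ?_ ?_ ?_
    · refine ⟨by rw [map_zero]; exact Le_zero _ _ _, ?_⟩
      intro m hm; simp at hm
    · rintro f g ⟨h1, h2⟩ ⟨h3, h4⟩
      refine ⟨by rw [map_add]; exact h1.add h3, ?_⟩
      intro m hm
      rw [map_add, map_add] at hm
      by_cases h : (comp a b n (H.io f)).coeff m = 0
      · apply h4; intro h'; apply hm; simp [h, h']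
      · exact h2 m h
    · rintro c f ⟨h1, h2⟩
      refine ⟨by rw [map_smul]; exact h1.smul c, ?_⟩
      intro m hm
      apply h2; intro h; apply hm; simp [h]
    · intro s t j h hle
      have hb := H.be_top hab s t j
      refine ⟨hb.1.mono hle, ?_⟩
      rcases lt_or_eq_of_le hle with h' | h'
      · rw [comp_of_lt hb.1 h']; intro m hm; simp at hm
      · rw [← h', hb.2]
        intro m hm
        rw [mo_coeff] at hm
        have : ((d * s + j : ℤ), (d * t + j : ℤ)) = m := by by_contra h'; simp [h'] at hm
        subst this
        refine ⟨by positivity, by positivity, ⟨s - t, by simp only; ring⟩⟩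
  exact this.2

lemma exists_be {a b : ℤ} (H : Dan d p x y z) (hab : 0 < a + b) {i j : ℤ} (hi : 0 ≤ i) (hj : 0 ≤ j)
    (hdvd : (d : ℤ) ∣ i - j) : ∃ f : B, Le a b (a * i + b * j) (H.io f) ∧
      comp a b (a * i + b * j) (H.io f) = mo i j := by
  obtain ⟨k, hk⟩ := hdvd
  lift i to ℕ using hi
  lift j to ℕ using hj
  rcases le_total 0 k with h | h
  · lift k to ℕ using h
    have := H.be_top hab k 0 j
    have e : (i : ℤ) = d * k + j := by omega
    have e2 : (d : ℤ) * (0 : ℕ) + j = j := by simp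
    rw [e2, ← e] at this
    exact ⟨_, this⟩
  · obtain ⟨k', rfl⟩ : ∃ k', k = -k' := ⟨-k, by ring⟩
    have h' : 0 ≤ k' := by omega
    lift k' to ℕ using h'
    have := H.be_top hab 0 k' i
    have e : (j : ℤ) = d * k' + i := by
      have : (d : ℤ) * (-(k' : ℤ)) = - (d * k') := by ring
      omega
    have e2 : (d : ℤ) * (0 : ℕ) + i = i := by simp
    rw [e2, ← e] at this
    exact ⟨_, this⟩

lemma v_nonneg (H : Dan d p x y z) (f : B) : Le 0 (-1) 0 (H.io f) := by
  have h1 : ∀ b ∈ ({x, y, z} : Set B), Le 0 (-1) 0 (H.io b) := by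
    rintro b (rfl | rfl | rfl)
    · rw [H.io_x]; exact Le_mo (by simp)
    · rw [H.io_y, yL]
      have : Le 0 (-1) 0 (aeval (mo 1 1) p) := by
        rw [aeval_eq_sum_range]
        refine Le.sum _ _ fun i _ => Le.smul ?_ _
        rw [mo_pow]; exact Le_mo (by simp)
      exact this.mul (Le_mo (n := 0) (by simp))
    · rw [H.io_z]; exact Le_mo (by simp)
  have hf : f ∈ Algebra.adjoin ℂ {x, y, z} := by rw [H.gen]; trivial
  induction hf using Algebra.adjoin_induction with
  | mem b hb => exact h1 b hb
  | algebraMap r =>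
    rw [AlgHom.commutes, Algebra.algebraMap_eq_smul_one]; exact (Le_one _ _).smul r
  | add f g _ _ h1 h2 => rw [map_add]; exact h1.add h2
  | mul f g _ _ h1 h2 => rw [map_mul]; exact h1.mul h2

/-- extensionality -/
lemma hom_ext (H : Dan d p x y z) {C : Type*} [CommRing C] [IsDomain C] {f g : B →+* C}
    (hc : ∀ c, f (algebraMap ℂ B c) = g (algebraMap ℂ B c)) (hx : f x = g x) (hz : f z = g z) (h0 : f x ≠ 0) :
    f = g := by
  have hp : ∀ q : Polynomial ℂ, f (aeval z q) = g (aeval z q) := by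
    intro q
    rw [aeval_eq_sum_range, map_sum, map_sum]
    refine Finset.sum_congr rfl fun i _ => ?_
    rw [Algebra.smul_def, map_mul, map_mul, hc, map_pow, map_pow, hz]
  have hy : f y = g y := by
    have h1 := hp p
    rw [← H.rel, map_mul, map_mul, ← hx] at h1
    exact mul_left_cancel₀ h0 h1
  ext b
  have hb : b ∈ Algebra.adjoin ℂ {x, y, z} := by rw [H.gen]; trivial
  induction hb using Algebra.adjoin_induction with
  | mem b hb => rcases hb with rfl | rfl | rfl <;> assumption
  | algebraMap r => exact hc r
  | add a b _ _ h1 h2 => rw [map_add, map_add, h1, h2]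
  | mul a b _ _ h1 h2 => rw [map_mul, map_mul, h1, h2]

end Dan

end

end RF

namespace RF
open Polynomial

noncomputable section

lemma SS_zero (d : ℕ) (r : ℤ) : SS d r 0 := fun m hm => by simp at hm

lemma SS.add {d : ℕ} {r : ℤ} {f g : LR} (hf : SS d r f) (hg : SS d r g) : SS d r (f + g) := by
  intro m hm
  by_cases h : f.coeff m = 0
  · apply hg; intro h'; apply hm; simp [h, h']
  · exact hf m h

lemma SS.smul {d : ℕ} {r : ℤ} {f : LR} (hf : SS d r f) (c : ℂ) : SS d r (c • f) := by
  intro m hm; apply hf; intro h; apply hm; simp [h]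

lemma SS_mo {d : ℕ} {r i j : ℤ} (hi : 0 ≤ i) (hj : 0 ≤ j) (h : (d : ℤ) ∣ i - j - r) : SS d r (mo i j) := by
  intro m hm
  rw [mo_coeff] at hm
  have : (i, j) = m := by by_contra h'; simp [h'] at hm
  subst this
  exact ⟨hi, hj, h⟩

lemma SS.congr {d : ℕ} {r r' : ℤ} {f : LR} (hf : SS d r f) (h : (d : ℤ) ∣ r - r') : SS d r' f := by
  intro m hm
  obtain ⟨h1, h2, h3⟩ := hf m hm
  refine ⟨h1, h2, ?_⟩
  have := dvd_add h3 h
  rwa [show m.1 - m.2 - r' = m.1 - m.2 - r + (r - r') by abel]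

lemma SS.induction {d : ℕ} {r : ℤ} {P : LR → Prop} {f : LR} (hf : SS d r f) (h0 : P 0)
    (ha : ∀ f g, P f → P g → P (f + g))
    (hs : ∀ i j : ℤ, 0 ≤ i → 0 ≤ j → (d : ℤ) ∣ i - j - r → ∀ c : ℂ, P (c • mo i j)) : P f :=
  supp_induction {m | 0 ≤ m.1 ∧ 0 ≤ m.2 ∧ (d : ℤ) ∣ m.1 - m.2 - r} f hf h0 ha
    (fun m hm c => hs m.1 m.2 hm.1 hm.2.1 hm.2.2 c)

lemma SS.mul {d : ℕ} {r r' : ℤ} {f g : LR} (hf : SS d r f) (hg : SS d r' g) : SS d (r + r') (f * g) := by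
  refine hf.induction (P := fun f => SS d (r + r') (f * g)) ?_ ?_ ?_
  · rw [zero_mul]; exact SS_zero _ _
  · intro f1 f2 h1 h2; rw [add_mul]; exact h1.add h2
  intro i j hi hj hij c
  refine hg.induction (P := fun g => SS d (r + r') ((c • mo i j) * g)) ?_ ?_ ?_
  · rw [mul_zero]; exact SS_zero _ _
  · intro f1 f2 h1 h2; rw [mul_add]; exact h1.add h2
  intro k l hk hl hkl e
  rw [smul_mul_smul_comm, mo_mul]
  refine (SS_mo (by omega) (by omega) ?_).smul _
  rw [show i + k - (j + l) - (r + r') = (i - j - r) + (k - l - r') by abel]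
  exact dvd_add hij hkl

lemma SS_one (d : ℕ) : SS d 0 1 := by rw [← mo_zero]; exact SS_mo le_rfl le_rfl (by simp)

lemma SS.pow {d : ℕ} {r : ℤ} {f : LR} (hf : SS d r f) (k : ℕ) : SS d (k * r) (f ^ k) := by
  induction k with
  | zero => simpa using SS_one d
  | succ k ih => rw [pow_succ]; exact (ih.mul hf).congr (by push_cast; ring_nf; simp)

lemma SS.pow_d {d : ℕ} {r : ℤ} {f : LR} (hf : SS d r f) : SS d 0 (f ^ d) :=
  (hf.pow d).congr (by simp)

lemma mul_mo_coeff (f : LR) (i j : ℤ) (m : ℤ × ℤ) :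
    (f * mo i j).coeff m = f.coeff (m.1 - i, m.2 - j) := by
  induction f using all_induction with
  | h0 => simp
  | ha f g hf hg => rw [add_mul]; simp [hf, hg]
  | hs k l c =>
    rw [smul_mul_assoc, mo_mul]
    simp only [AddMonoidAlgebra.coeff_smul, Finsupp.smul_apply, mo_coeff]
    congr 2
    apply propext
    rcases m with ⟨m1, m2⟩
    simp only [Prod.mk.injEq]
    constructor <;> rintro ⟨h1, h2⟩ <;> constructor <;> omega

structure TF (d : ℕ) (P Q : LR) : Prop where
  hd : 0 < d
  hN : ∀ f, SS d 0 f → NN (DR P Q) f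
  hS : ∀ f, SS d 0 f → SS d 0 (DR P Q f)
  hne : ¬ (P = 0 ∧ Q = 0)

namespace TF
variable {d : ℕ} {P Q : LR}

lemma fac (T : TF d P Q) {r r' : ℤ} {f g : LR} (hf : SS d r f) (hg : SS d r' g) (h0 : f * g ≠ 0)
    (h : DR P Q (f * g) = 0) : DR P Q f = 0 ∧ DR P Q g = 0 := by
  have h1 : DR P Q (f ^ d * g ^ d) = 0 := by
    rw [← mul_pow, Derivation.leibniz_pow, h]; simp
  have h2 : f ^ d * g ^ d ≠ 0 := by rw [← mul_pow]; exact pow_ne_zero _ h0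
  have h3 := ker_of_mul (T.hN _ hf.pow_d) (T.hN _ hg.pow_d) h2 h1
  exact ⟨ker_of_pow T.hd.ne' h3.1, ker_of_pow T.hd.ne' h3.2⟩

lemma lemC (T : TF d P Q) {α β : ℕ} (hα : 0 < α) (hβ : 0 < β) (hdvd : d ∣ α + β) {ρ : ℂ} (hρ : ρ ≠ 0)
    (h : DR P Q (mo 0 α - ρ • mo β 0) = 0) : α = 1 ∨ β = 1 := by
  by_contra hcon
  push Not at hcon
  obtain ⟨α, rfl⟩ : ∃ k, α = k + 2 := ⟨α - 2, by omega⟩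
  obtain ⟨β, rfl⟩ : ∃ k, β = k + 2 := ⟨β - 2, by omega⟩
  clear hcon hα hβ
  have hαC : ((α + 2 : ℕ) : ℂ) ≠ 0 := Nat.cast_ne_zero.2 (by omega)
  have hβC : ((β + 2 : ℕ) : ℂ) ≠ 0 := Nat.cast_ne_zero.2 (by omega)
  have hdC : (d : ℂ) ≠ 0 := by exact_mod_cast T.hd.ne'
  rw [map_sub, Derivation.map_smul, DR_mo, DR_mo] at h
  simp only [Int.cast_zero, zero_smul, zero_add, add_zero, Int.cast_natCast] at h
  set κ : ℂ := ρ * (β + 2 : ℕ) / (α + 2 : ℕ) with hκ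
  have hκ0 : κ ≠ 0 := div_ne_zero (mul_ne_zero hρ hβC) hαC
  set h' : LR := P * mo 1 (-1 - α) with hh
  have hP : P = h' * mo (-1) (α + 1) := by
    rw [hh, mul_assoc, mo_mul, show (1 : ℤ) + -1 = 0 by ring, show (-1 : ℤ) - α + (α + 1) = 0 by ring, mo_zero, mul_one]
  have hQ : Q = κ • (h' * mo (β + 1) (-1)) := by
    have h2 : ((α + 2 : ℕ) : ℂ) • (Q * mo 0 (α + 2 : ℕ)) = (ρ * (β + 2 : ℕ)) • (P * mo (β + 2 : ℕ) 0) := by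
      rw [← sub_eq_zero, ← h, mul_smul, smul_mul_assoc, smul_mul_assoc]
    have h3 : Q * mo 0 (α + 2 : ℕ) = κ • (P * mo (β + 2 : ℕ) 0) := by
      rw [hκ, div_eq_inv_mul, mul_smul, ← h2, smul_smul, inv_mul_cancel₀ hαC, one_smul]
    have h4 : Q = (Q * mo 0 (α + 2 : ℕ)) * mo 0 (-(α + 2 : ℕ)) := by
      rw [mul_assoc, mo_mul, add_zero, add_neg_cancel, mo_zero, mul_one]
    rw [h4, h3, hh, smul_mul_assoc, mul_assoc, mul_assoc, mo_mul, mo_mul]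
    congr 3 <;> push_cast <;> ring
  clear_value h'
  have hh0 : h' ≠ 0 := by
    intro h0
    apply T.hne
    rw [h0] at hP hQ
    exact ⟨by rw [hP, zero_mul], by rw [hQ, zero_mul, smul_zero]⟩
  have hP0 : P ≠ 0 := by
    rw [hP]; exact mul_ne_zero hh0 (mo_ne_zero _ _)
  have hQ0 : Q ≠ 0 := by
    rw [hQ]; exact smul_ne_zero hκ0 (mul_ne_zero hh0 (mo_ne_zero _ _))
  have hdx : DR P Q (mo d 0) = (d : ℂ) • (h' * mo (d - 1) (α + 1)) := by
    rw [DR_mo]; simp only [Int.cast_zero, zero_smul, add_zero, Int.cast_natCast]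
    rw [hP, smul_mul_assoc, mul_assoc, mo_mul]
    congr 3 <;> ring
  have hdy : DR P Q (mo 0 d) = ((d : ℂ) * κ) • (h' * mo (β + 1) (d - 1)) := by
    rw [DR_mo]; simp only [Int.cast_zero, zero_smul, zero_add, Int.cast_natCast]
    rw [hQ, smul_mul_assoc, smul_mul_assoc, smul_smul, mul_assoc, mo_mul]
    congr 3 <;> ring
  have hdz : DR P Q (mo 1 1) = h' * mo 0 (α + 2) + κ • (h' * mo (β + 2) 0) := by
    rw [DR_mo]; simp only [Int.cast_one, one_smul]
    have eP : P * mo 1 1 = h' * mo 0 (α + 2) := by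
      calc P * mo 1 1 = (h' * mo (-1) (α + 1)) * mo 1 1 := by rw [← hP]
        _ = _ := by
          rw [mul_assoc, mo_mul]
          congr 2
    have eQ : Q * mo 1 1 = κ • (h' * mo (β + 2) 0) := by
      rw [hQ, smul_mul_assoc, mul_assoc, mo_mul]
      congr 2
    rw [add_mul, eP, eQ]
  have hSx := T.hS _ (SS_mo (i := d) (j := 0) (d := d) (r := 0) (by positivity) le_rfl (by simp))
  have hSz := T.hS _ (SS_mo (i := 1) (j := 1) (d := d) (r := 0) (by positivity) (by positivity) (by simp))
  rw [hdx] at hSx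
  rw [hdz] at hSz
  have hres : ∀ m, h'.coeff m ≠ 0 → (d : ℤ) ∣ m.1 - m.2 - (α + 2) := by
    intro m hm
    have := (hSx (m.1 + (d - 1), m.2 + (α + 1)) (by
      simp only [AddMonoidAlgebra.coeff_smul, Finsupp.smul_apply, mul_mo_coeff, smul_eq_mul, add_sub_cancel_right]
      exact mul_ne_zero hdC hm)).2.2
    have h2 := dvd_sub this (dvd_refl (d : ℤ))
    rwa [show m.1 - m.2 - ((α : ℤ) + 2) = m.1 + (d - 1) - (m.2 + (α + 1)) - 0 - d by ring]
  have hne : h'.coeff.support.Nonempty := by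
    rw [Finsupp.support_nonempty_iff]; simpa using hh0
  have hi : ∀ m, h'.coeff m ≠ 0 → 0 ≤ m.1 := by
    obtain ⟨m0, hm0, hmin⟩ := h'.coeff.support.exists_min_image (fun m => m.1) hne
    have := (hSz (m0.1, m0.2 + (α + 2)) (by
      simp only [AddMonoidAlgebra.coeff_add, AddMonoidAlgebra.coeff_smul, Finsupp.add_apply,
        Finsupp.smul_apply, mul_mo_coeff, smul_eq_mul, add_sub_cancel_right, sub_zero]
      have : h'.coeff (m0.1 - (β + 2), m0.2 + (α + 2)) = 0 := by
        by_contra h0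
        have := hmin _ (Finsupp.mem_support_iff.2 h0)
        simp only at this
        omega
      rw [this, mul_zero, add_zero]
      exact Finsupp.mem_support_iff.1 hm0)).1
    intro m hm
    exact le_trans this (hmin m (Finsupp.mem_support_iff.2 hm))
  have hj : ∀ m, h'.coeff m ≠ 0 → 0 ≤ m.2 := by
    obtain ⟨m0, hm0, hmin⟩ := h'.coeff.support.exists_min_image (fun m => m.2) hne
    have := (hSz (m0.1 + (β + 2), m0.2) (by
      simp only [AddMonoidAlgebra.coeff_add, AddMonoidAlgebra.coeff_smul, Finsupp.add_apply,
        Finsupp.smul_apply, mul_mo_coeff, smul_eq_mul, add_sub_cancel_right, sub_zero]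
      have : h'.coeff (m0.1 + (β + 2), m0.2 - (α + 2)) = 0 := by
        by_contra h0
        have := hmin _ (Finsupp.mem_support_iff.2 h0)
        simp only at this
        omega
      rw [this, zero_add]
      exact mul_ne_zero hκ0 (Finsupp.mem_support_iff.1 hm0))).2.1
    intro m hm
    exact le_trans this (hmin m (Finsupp.mem_support_iff.2 hm))
  have hSh : SS d (α + 2) h' := fun m hm => ⟨hi m hm, hj m hm, hres m hm⟩
  obtain ⟨Hd, hHd⟩ := (T.hN _ hSh.pow_d).exists (pow_ne_zero _ hh0)
  obtain ⟨A, hA⟩ := (T.hN _ (SS_mo (i := d) (j := 0) (d := d) (r := 0) (by positivity) le_rfl (by simp))).exists (mo_ne_zero _ _)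
  obtain ⟨C, hC⟩ := (T.hN _ (SS_mo (i := 0) (j := d) (d := d) (r := 0) le_rfl (by positivity) (by simp))).exists (mo_ne_zero _ _)
  have hx0 : DR P Q (mo d 0) ≠ 0 := by
    rw [hdx]; exact smul_ne_zero hdC (mul_ne_zero hh0 (mo_ne_zero _ _))
  have hy0 : DR P Q (mo 0 d) ≠ 0 := by
    rw [hdy]; exact smul_ne_zero (mul_ne_zero hdC hκ0) (mul_ne_zero hh0 (mo_ne_zero _ _))
  obtain ⟨A, rfl⟩ : ∃ k, A = k + 1 := ⟨A - 1, by
    have : A ≠ 0 := fun h => hx0 (hA.zero_iff.2 h)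
    omega⟩
  obtain ⟨C, rfl⟩ : ∃ k, C = k + 1 := ⟨C - 1, by
    have : C ≠ 0 := fun h => hy0 (hC.zero_iff.2 h)
    omega⟩
  obtain ⟨e, rfl⟩ : ∃ k, d = k + 1 := ⟨d - 1, by have := T.hd; omega⟩
  have e1 : DR P Q (mo (e + 1 : ℕ) 0) ^ (e + 1) =
      (((e + 1 : ℕ) : ℂ) ^ (e + 1)) • (h' ^ (e + 1) * mo (e + 1 : ℕ) 0 ^ e * mo 0 (e + 1 : ℕ) ^ (α + 1)) := by
    rw [hdx, _root_.smul_pow, mul_pow, mo_pow, mo_pow, mo_pow, mul_assoc, mo_mul]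
    congr 3 <;> push_cast <;> ring
  have e2 : DR P Q (mo 0 (e + 1 : ℕ)) ^ (e + 1) =
      ((((e + 1 : ℕ) : ℂ) * κ) ^ (e + 1)) • (h' ^ (e + 1) * mo (e + 1 : ℕ) 0 ^ (β + 1) * mo 0 (e + 1 : ℕ) ^ e) := by
    rw [hdy, _root_.smul_pow, mul_pow h', mo_pow, mo_pow, mo_pow, mul_assoc, mo_mul]
    congr 3 <;> push_cast <;> ring
  have f1 := hA.deriv.pow (e + 1)
  have f2 := hC.deriv.pow (e + 1)
  rw [e1] at f1
  rw [e2] at f2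
  have g1 := f1.unique (((hHd.mul (hA.pow e)).mul (hC.pow (α + 1))).smul (pow_ne_zero _ hdC))
  have g2 := f2.unique (((hHd.mul (hA.pow (β + 1))).mul (hC.pow e)).smul (pow_ne_zero _ (mul_ne_zero hdC hκ0)))
  have i1 : C < A := by nlinarith [Nat.zero_le (α * C), Nat.zero_le α, Nat.zero_le Hd, Nat.zero_le (e * A)]
  have i2 : A < C := by nlinarith [Nat.zero_le (β * A), Nat.zero_le β, Nat.zero_le Hd, Nat.zero_le (e * C)]
  omega

end TF

end

end RF

namespace RF
open Polynomial (aeval)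

noncomputable section

lemma exists_g (d s : ℕ) (hd : 0 < d) : ∃ g : ℕ, 0 < g ∧ d ∣ g * s ∧
    ∀ t : ℤ, (d : ℤ) ∣ t * s → (g : ℤ) ∣ t := by
  obtain ⟨g, s', hc, h1, h2⟩ := Nat.exists_coprime d s
  have hG : 0 < Nat.gcd d s := Nat.gcd_pos_of_pos_left _ hd
  have hg : 0 < g := by
    rcases Nat.eq_zero_or_pos g with h | h
    · rw [h, zero_mul] at h1; omega
    · exact h
  generalize Nat.gcd d s = G at *
  subst h1 h2
  refine ⟨g, hg, ⟨s', by ring⟩, ?_⟩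
  rintro t ⟨k, hk⟩
  have h3 : (g : ℤ) ∣ t * s' := by
    refine ⟨k, ?_⟩
    have hG' : (G : ℤ) ≠ 0 := by exact_mod_cast hG.ne'
    apply mul_right_cancel₀ hG'
    push_cast at hk
    linarith
  exact IsCoprime.dvd_of_dvd_mul_right (by exact_mod_cast (Nat.isCoprime_iff_coprime.2 hc)) h3

lemma sum_mo (f : LR) : f = ∑ m ∈ f.coeff.support, f.coeff m • mo m.1 m.2 := by
  conv_lhs => rw [← AddMonoidAlgebra.sum_coeff_single f, Finsupp.sum]
  exact Finset.sum_congr rfl fun m _ => single_eq m _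

lemma line_form {d a b : ℕ} (hd : 0 < d) (ha : 0 < a) (hb : 0 < b) (hab : Nat.Coprime a b)
    {g : ℕ} (hg : 0 < g) (hg2 : ∀ t : ℤ, (d : ℤ) ∣ t * (a + b : ℕ) → (g : ℤ) ∣ t)
    {X : LR} {n : ℤ} (hX : SS d 0 X) (hw : ∀ m, X.coeff m ≠ 0 → wt a b m = n) (h0 : X ≠ 0) :
    ∃ (c : ℂ) (i j : ℕ) (R : Multiset ℂ), c ≠ 0 ∧
      X = c • (mo i j * (R.map (fun ρ => mo 0 (g * a : ℕ) - ρ • mo (g * b : ℕ) 0)).prod) := by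
  have hne : X.coeff.support.Nonempty := by
    rw [Finsupp.support_nonempty_iff]; simpa using h0
  obtain ⟨m0, hm0, hmin⟩ := X.coeff.support.exists_min_image (fun m => m.2) hne
  have key : ∀ m ∈ X.coeff.support, ∃ t : ℕ, m.1 = m0.1 - g * b * t ∧ m.2 = m0.2 + g * a * t := by
    intro m hm
    have h1 := hw m (Finsupp.mem_support_iff.1 hm)
    have h2 := hw m0 (Finsupp.mem_support_iff.1 hm0)
    have h3 := (hX m (Finsupp.mem_support_iff.1 hm)).2.2
    have h4 := (hX m0 (Finsupp.mem_support_iff.1 hm0)).2.2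
    have h5 := hmin m hm
    simp only [wt] at h1 h2
    have h6 : (a : ℤ) ∣ (m.2 - m0.2) * b := ⟨m0.1 - m.1, by linarith⟩
    have hco : IsCoprime (a : ℤ) (b : ℤ) := Nat.isCoprime_iff_coprime.2 hab
    obtain ⟨t, ht⟩ := hco.dvd_of_dvd_mul_right h6
    have ha' : (a : ℤ) ≠ 0 := by exact_mod_cast ha.ne'
    have h7 : m.1 - m0.1 = - (b * t) := by
      apply mul_left_cancel₀ ha'
      have : m.2 = m0.2 + a * t := by linarith
      rw [this] at h1
      linarith
    have h8 : (d : ℤ) ∣ t * (a + b : ℕ) := by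
      have e : t * ((a + b : ℕ) : ℤ) = (m0.1 - m0.2 - 0) - (m.1 - m.2 - 0) := by
        push_cast
        linear_combination h7 - ht
      rw [e]
      exact dvd_sub h4 h3
    obtain ⟨t', rfl⟩ := hg2 t h8
    have h9 : 0 ≤ t' := by
      by_contra hneg
      push Not at hneg
      have : (a : ℤ) * (g * t') < 0 := by
        apply mul_neg_of_pos_of_neg (by exact_mod_cast ha)
        exact mul_neg_of_pos_of_neg (by exact_mod_cast hg) hneg
      linarith
    lift t' to ℕ using h9
    exact ⟨t', by linarith, by linarith⟩
  choose! t ht1 ht2 using key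
  set θ : LR := mo (-(g * b : ℕ)) (g * a : ℕ) with hθ
  set F : Polynomial ℂ := ∑ m ∈ X.coeff.support, Polynomial.C (X.coeff m) * Polynomial.X ^ (t m) with hF
  have hXF : X = mo m0.1 m0.2 * aeval θ F := by
    conv_lhs => rw [sum_mo X]
    rw [hF, map_sum, Finset.mul_sum]
    refine Finset.sum_congr rfl fun m hm => ?_
    rw [map_mul, Polynomial.aeval_C, ← Algebra.smul_def, map_pow, Polynomial.aeval_X, hθ, mo_pow, mul_smul_comm, mo_mul]
    congr 2
    · rw [ht1 m hm]; push_cast; ring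
    · rw [ht2 m hm]; push_cast; ring
  have hF0 : F ≠ 0 := by
    intro h; rw [h, map_zero, mul_zero] at hXF; exact h0 hXF
  have hK : F.coeff F.natDegree ≠ 0 := by simpa using hF0
  obtain ⟨mK, hmK, hmK2⟩ : ∃ m ∈ X.coeff.support, t m = F.natDegree := by
    rw [hF, Polynomial.finsetSum_coeff] at hK
    obtain ⟨m, hm, hm2⟩ := Finset.exists_ne_zero_of_sum_ne_zero hK
    refine ⟨m, hm, ?_⟩
    rw [Polynomial.coeff_C_mul, Polynomial.coeff_X_pow] at hm2
    by_contra h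
    rw [if_neg (fun h' => h h'.symm), mul_zero] at hm2
    exact hm2 rfl
  have hi1 : 0 ≤ m0.1 - g * b * F.natDegree := by
    rw [← hmK2, ← ht1 mK hmK]
    exact (hX mK (Finsupp.mem_support_iff.1 hmK)).1
  have hj0 : 0 ≤ m0.2 := (hX m0 (Finsupp.mem_support_iff.1 hm0)).2.1
  have hs := IsAlgClosed.splits F
  have hcard := hs.natDegree_eq_card_roots
  obtain ⟨i, hi⟩ := Int.eq_ofNat_of_zero_le hi1
  obtain ⟨j, hj⟩ := Int.eq_ofNat_of_zero_le hj0
  refine ⟨F.leadingCoeff, i, j, F.roots, by simpa using hF0, ?_⟩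
  have e1 : aeval θ F = F.leadingCoeff • (F.roots.map (fun ρ => θ - algebraMap ℂ LR ρ)).prod := by
    conv_lhs => rw [hs.eq_prod_roots]
    rw [map_mul, Polynomial.aeval_C, ← Algebra.smul_def, map_multiset_prod, Multiset.map_map]
    congr 3
    ext ρ : 1
    simp
  have e2 : (F.roots.map (fun ρ => mo 0 (g * a : ℕ) - ρ • mo (g * b : ℕ) 0)).prod =
      (F.roots.map (fun ρ => θ - algebraMap ℂ LR ρ)).prod * mo (g * b : ℕ) 0 ^ F.natDegree := by
    rw [hcard, ← Multiset.prod_replicate, ← Multiset.map_const', ← Multiset.prod_map_mul]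
    congr 2
    ext ρ : 1
    rw [sub_mul, hθ, mo_mul, ← Algebra.smul_def]
    simp
  rw [e2, hXF, e1, mul_smul_comm]
  congr 1
  rw [mo_pow, mul_comm (Multiset.prod _) (mo _ _), ← mul_assoc, mo_mul]
  congr 2
  · push_cast at hi ⊢; linarith

namespace TF
variable {d : ℕ} {P Q : LR}

lemma ker_mo (T : TF d P Q) {i j : ℤ} (h : DR P Q (mo i j) = 0) : (i : ℂ) • P + (j : ℂ) • Q = 0 := by
  rw [DR_mo] at h
  exact (mul_eq_zero.1 h).resolve_right (mo_ne_zero _ _)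

lemma ker_u (T : TF d P Q) {i : ℤ} (hi : i ≠ 0) (h : DR P Q (mo i 0) = 0) : P = 0 := by
  have := T.ker_mo h
  simp at this
  exact this.resolve_left hi

lemma ker_v (T : TF d P Q) {i : ℤ} (hi : i ≠ 0) (h : DR P Q (mo 0 i) = 0) : Q = 0 := by
  have := T.ker_mo h
  simp at this
  exact this.resolve_left hi

lemma ker_uv (T : TF d P Q) {i j : ℤ} (hi : i ≠ 0) (hj : j ≠ 0) (h : DR P Q (mo i 0) = 0)
    (h' : DR P Q (mo 0 j) = 0) : False := T.hne ⟨T.ker_u hi h, T.ker_v hj h'⟩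

lemma SS_f {α β : ℕ} (hdvd : d ∣ α + β) (ρ : ℂ) : SS d (-α) (mo 0 α - ρ • mo β 0) := by
  rw [sub_eq_add_neg, ← neg_smul]
  refine (SS_mo le_rfl (by positivity) (by simp)).add ((SS_mo (by positivity) le_rfl ?_).smul _)
  have : ((d : ℕ) : ℤ) ∣ ((α + β : ℕ) : ℤ) := by exact_mod_cast hdvd
  convert this using 1
  push_cast; ring

lemma SS_prod {α β : ℕ} (hdvd : d ∣ α + β) (R : Multiset ℂ) : ∃ r,
    SS d r (R.map (fun ρ => mo 0 α - ρ • mo β 0)).prod := by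
  induction R using Multiset.induction_on with
  | empty => exact ⟨0, by simpa using SS_one d⟩
  | cons ρ R ih =>
    obtain ⟨r, hr⟩ := ih
    rw [Multiset.map_cons, Multiset.prod_cons]
    exact ⟨_, (SS_f hdvd ρ).mul hr⟩

lemma SS_mo' (d : ℕ) {i j : ℤ} (hi : 0 ≤ i) (hj : 0 ≤ j) : SS d (i - j) (mo i j) :=
  SS_mo hi hj (by simp)

lemma mono_case (T : TF d P Q) {a b : ℕ} {n : ℤ} (hn : 0 < n) {c : ℂ} (hc : c ≠ 0) {i j : ℕ}
    (hX : SS d 0 (c • mo i j)) (hw : ∀ m, (c • mo i j).coeff m ≠ 0 → wt a b m = n)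
    (hD : DR P Q (c • mo i j) = 0) :
    (∃ k : ℕ, 0 < k ∧ c • mo i j = c • mo (d * k : ℕ) 0) ∨
    (∃ k : ℕ, 0 < k ∧ c • mo i j = c • mo 0 (d * k : ℕ)) := by
  have hco : (c • mo i j).coeff (i, j) ≠ 0 := by simp [mo_coeff, hc]
  have h1 := hw _ hco
  obtain ⟨-, -, h2⟩ := hX _ hco
  simp only [wt] at h1 h2
  rw [Derivation.map_smul, smul_eq_zero] at hD
  have hD := hD.resolve_left hc
  have e : mo i j = mo i 0 * mo 0 j := by rw [mo_mul]; simp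
  rw [e] at hD
  have h3 := T.fac (SS_mo' d (by positivity) le_rfl) (SS_mo' d le_rfl (by positivity))
    (mul_ne_zero (mo_ne_zero _ _) (mo_ne_zero _ _)) hD
  by_cases hi : i = 0
  · right
    subst hi
    have h4 : (d : ℤ) ∣ j := by
      have := (dvd_neg).2 h2
      simpa using this
    obtain ⟨k, rfl⟩ : d ∣ j := by exact_mod_cast h4
    refine ⟨k, ?_, by simp⟩
    rcases Nat.eq_zero_or_pos k with h | h
    · subst h; simp at h1; omega
    · exact h
  · by_cases hj : j = 0
    · left
      subst hj
      obtain ⟨k, rfl⟩ : d ∣ i := by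
        have h4 : (d : ℤ) ∣ i := by simpa using h2
        exact_mod_cast h4
      refine ⟨k, ?_, by simp⟩
      rcases Nat.eq_zero_or_pos k with h | h
      · subst h; simp at hi
      · exact h
    · exact (T.ker_uv (by exact_mod_cast hi) (by exact_mod_cast hj) h3.1 h3.2).elim

lemma main (T : TF d P Q) {a b : ℕ} (ha : 0 < a) (hb : 0 < b) (hab : Nat.Coprime a b)
    {X : LR} {n : ℤ} (hn : 0 < n) (hX : SS d 0 X) (hw : ∀ m, X.coeff m ≠ 0 → wt a b m = n) (h0 : X ≠ 0)
    (hD : DR P Q X = 0) :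
    (∃ (c : ℂ) (k : ℕ), c ≠ 0 ∧ 0 < k ∧ X = c • mo (d * k : ℕ) 0) ∨
    (∃ (c : ℂ) (k : ℕ), c ≠ 0 ∧ 0 < k ∧ X = c • mo 0 (d * k : ℕ)) ∨
    (∃ (c ρ : ℂ) (M : ℕ), c ≠ 0 ∧ ρ ≠ 0 ∧ 0 < M ∧ d ∣ a + b ∧ (a = 1 ∨ b = 1) ∧
      X = c • (mo 0 a - ρ • mo b 0) ^ M) := by
  obtain ⟨g, hg, hg1, hg2⟩ := exists_g d (a + b) T.hd
  obtain ⟨c, i, j, R, hc, hXe⟩ := line_form T.hd ha hb hab hg hg2 hX hw h0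
  have hdvd : d ∣ g * a + g * b := by rw [← mul_add]; exact hg1
  have hga : 0 < g * a := by positivity
  have hgb : 0 < g * b := by positivity
  have hmono : ∀ i j : ℕ, X = c • mo i j → (∃ (c : ℂ) (k : ℕ), c ≠ 0 ∧ 0 < k ∧ X = c • mo (d * k : ℕ) 0) ∨
    (∃ (c : ℂ) (k : ℕ), c ≠ 0 ∧ 0 < k ∧ X = c • mo 0 (d * k : ℕ)) := by
    intro i j h
    subst h
    rcases T.mono_case hn hc hX hw hD with ⟨k, h1, h2⟩ | ⟨k, h1, h2⟩
    · exact Or.inl ⟨c, k, hc, h1, h2⟩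
    · exact Or.inr ⟨c, k, hc, h1, h2⟩
  by_cases hR : R = 0
  · subst hR
    rcases hmono i j (by rw [hXe]; simp) with h | h
    · exact Or.inl h
    · exact Or.inr (Or.inl h)
  obtain ⟨ρ, hρ⟩ := Multiset.exists_mem_of_ne_zero hR
  have hD2 : DR P Q (mo i j * (R.map (fun ρ => mo 0 (g * a : ℕ) - ρ • mo (g * b : ℕ) 0)).prod) = 0 := by
    rw [hXe, Derivation.map_smul, smul_eq_zero] at hD
    exact hD.resolve_left hc
  have hne0 : mo i j * (R.map (fun ρ => mo 0 (g * a : ℕ) - ρ • mo (g * b : ℕ) 0)).prod ≠ 0 := by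
    intro h; rw [h, smul_zero] at hXe; exact h0 hXe
  obtain ⟨r, hr⟩ := SS_prod hdvd R
  obtain ⟨hD3, hD4⟩ := T.fac (SS_mo' d (by positivity) (by positivity)) hr hne0 hD2
  have hroots : ∀ ρ ∈ R, DR P Q (mo 0 (g * a : ℕ) - ρ • mo (g * b : ℕ) 0) = 0 := by
    intro ρ hρ
    obtain ⟨R', rfl⟩ := Multiset.exists_cons_of_mem hρ
    rw [Multiset.map_cons, Multiset.prod_cons] at hD4 hne0
    obtain ⟨r', hr'⟩ := SS_prod hdvd R'
    exact (T.fac (SS_f hdvd ρ) hr' (right_ne_zero_of_mul hne0) hD4).1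
  have hgb' : ((g * b : ℕ) : ℤ) ≠ 0 := by exact_mod_cast hgb.ne'
  have hga' : ((g * a : ℕ) : ℤ) ≠ 0 := by exact_mod_cast hga.ne'
  have hall : ∀ ρ' ∈ R, ρ' = ρ := by
    intro ρ' hρ'
    by_contra hne
    have h1 := hroots ρ hρ
    have h2 := hroots ρ' hρ'
    rw [map_sub, Derivation.map_smul] at h1 h2
    have h3 : (ρ' - ρ) • DR P Q (mo (g * b : ℕ) 0) = 0 := by
      rw [sub_smul, ← sub_eq_zero.1 h1, ← sub_eq_zero.1 h2, sub_self]
    have h4 := (smul_eq_zero.1 h3).resolve_left (sub_ne_zero.2 hne)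
    rw [h4, smul_zero, sub_zero] at h1
    exact T.ker_uv hgb' hga' h4 h1
  have hRr := Multiset.eq_replicate_of_mem hall
  have hM : 0 < R.card := Multiset.card_pos.2 hR
  rw [hRr, Multiset.map_replicate, Multiset.prod_replicate] at hXe
  have h1 := hroots ρ hρ
  by_cases hρ0 : ρ = 0
  · subst hρ0
    have : X = c • mo i (j + R.card * (g * a) : ℕ) := by
      rw [hXe, zero_smul, sub_zero, mo_pow, mo_mul]
      congr 2
    rcases hmono _ _ this with h | h
    · exact Or.inl h
    · exact Or.inr (Or.inl h)
  have e : mo i j = mo i 0 * mo 0 j := by rw [mo_mul]; simp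
  rw [e] at hD3
  obtain ⟨h5, h6⟩ := T.fac (SS_mo' d (by positivity) le_rfl) (SS_mo' d le_rfl (by positivity))
    (mul_ne_zero (mo_ne_zero _ _) (mo_ne_zero _ _)) hD3
  rw [map_sub, Derivation.map_smul] at h1
  have hi0 : i = 0 := by
    by_contra hi
    have hP := T.ker_u (by exact_mod_cast hi) h5
    have hu : DR P Q (mo (g * b : ℕ) 0) = 0 := by rw [DR_mo, hP]; simp
    rw [hu, smul_zero, sub_zero] at h1
    exact T.ker_uv hgb' hga' hu h1
  have hj0 : j = 0 := by
    by_contra hj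
    have hQ := T.ker_v (by exact_mod_cast hj) h6
    have hv : DR P Q (mo 0 (g * a : ℕ)) = 0 := by rw [DR_mo, hQ]; simp
    rw [hv, zero_sub, neg_eq_zero, smul_eq_zero] at h1
    exact T.ker_uv hgb' hga' (h1.resolve_left hρ0) hv
  subst hi0 hj0
  have hC := T.lemC hga hgb hdvd hρ0 (hroots ρ hρ)
  have hg1' : g = 1 := by
    rcases hC with h | h
    · exact Nat.eq_one_of_mul_eq_one_right h
    · exact Nat.eq_one_of_mul_eq_one_right h
  subst hg1'
  simp only [one_mul] at hC hXe hg1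
  refine Or.inr (Or.inr ⟨c, ρ, R.card, hc, hρ0, hM, hg1, hC, ?_⟩)
  rw [hXe]
  congr 1
  change mo 0 0 * _ = _
  rw [mo_zero, one_mul]

end TF

end

end RF

namespace RF
open Polynomial

noncomputable section

variable {d : ℕ} {p : Polynomial ℂ} {B : Type} [CommRing B] [Algebra ℂ B] {x y z : B}

namespace Dan

lemma ind (H : Dan d p x y z) {P : B → Prop} (hx : P x) (hy : P y) (hz : P z)
    (hc : ∀ c, P (algebraMap ℂ B c)) (ha : ∀ f g, P f → P g → P (f + g)) (hm : ∀ f g, P f → P g → P (f * g))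
    (b : B) : P b := by
  have hb : b ∈ Algebra.adjoin ℂ {x, y, z} := by rw [H.gen]; trivial
  induction hb using Algebra.adjoin_induction with
  | mem b hb => rcases hb with rfl | rfl | rfl <;> assumption
  | algebraMap r => exact hc r
  | add a b _ _ h1 h2 => exact ha _ _ h1 h2
  | mul a b _ _ h1 h2 => exact hm _ _ h1 h2

lemma exists_Dx (H : Dan d p x y z) :
    ∃ D : Derivation ℂ B B, D x = 0 ∧ D z = x ∧ D y = aeval z p.derivative := by
  obtain ⟨f, h1, h2, h3, h4⟩ := H.lift (C := DualNumber B) (algebraMap ℂ (DualNumber B))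
    (TrivSqZeroExt.inl x) (TrivSqZeroExt.inl y + TrivSqZeroExt.inr (aeval z p.derivative))
    (TrivSqZeroExt.inl z + TrivSqZeroExt.inr x) (by
      change _ = aeval _ p
      rw [Polynomial.aeval_add_of_sq_eq_zero _ _ _ (by rw [pow_two, TrivSqZeroExt.inr_mul_inr])]
      have e : ∀ q : Polynomial ℂ, aeval (TrivSqZeroExt.inl z : DualNumber B) q =
          TrivSqZeroExt.inl (aeval z q) := by
        intro q
        have := Polynomial.aeval_algHom_apply (TrivSqZeroExt.inlAlgHom ℂ B B) z q
        exact this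
      rw [e, e, ← H.rel, mul_add, ← TrivSqZeroExt.inl_mul, TrivSqZeroExt.inl_mul_inr,
        TrivSqZeroExt.inl_mul_inr]
      congr 2
      simp [mul_comm])
  have hfst : ∀ b, (f b).fst = b := by
    refine H.ind (P := fun b => (f b).fst = b) ?_ ?_ ?_ ?_ ?_ ?_
    · rw [h2]; simp
    · rw [h3]; simp
    · rw [h4]; simp
    · intro c; rw [h1]; rfl
    · intro a b ha hb; simp [ha, hb]
    · intro a b ha hb; simp [ha, hb]
  refine ⟨Derivation.mk'
    { toFun := fun b => (f b).snd
      map_add' := by intro a b; simp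
      map_smul' := by
        intro c b
        have : (algebraMap ℂ (DualNumber B) c) = TrivSqZeroExt.inl (algebraMap ℂ B c) := rfl
        rw [Algebra.smul_def, map_mul, h1, this]
        simp [Algebra.smul_def] } ?_, ?_, ?_, ?_⟩
  · intro a b
    simp [hfst, mul_comm]
  · simp [h2]
  · simp [h4]
  · simp [h3]

lemma der_ext (H : Dan d p x y z) {D : Derivation ℂ B B} {E : Derivation ℂ LR LR}
    (hx : H.io (D x) = E (H.io x)) (hz : H.io (D z) = E (H.io z)) (b : B) : H.io (D b) = E (H.io b) := by
  have hp : ∀ q : Polynomial ℂ, H.io (D (aeval z q)) = E (H.io (aeval z q)) := by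
    intro q
    rw [← Polynomial.aeval_algHom_apply H.io, Derivation.map_aeval, Derivation.map_aeval, smul_eq_mul,
      smul_eq_mul, map_mul, hz, ← Polynomial.aeval_algHom_apply]
  refine H.ind (P := fun b => H.io (D b) = E (H.io b)) hx ?_ hz ?_ ?_ ?_ b
  · have h1 := hp p
    rw [← H.rel, Derivation.leibniz, map_mul, Derivation.leibniz] at h1
    simp only [smul_eq_mul, map_add, map_mul] at h1
    rw [hx] at h1
    have h2 := add_right_cancel h1
    exact mul_left_cancel₀ (H.io_ne H.x_ne) h2
  · intro c; rw [AlgHom.commutes, Derivation.map_algebraMap, Derivation.map_algebraMap, map_zero]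
  · intro a b h1 h2; simp [h1, h2]
  · intro a b h1 h2; simp [h1, h2]

lemma of_Le01 (H : Dan d p x y z) {f : B} (hf : Le 0 1 0 (H.io f)) : ∃ F : Polynomial ℂ, f = aeval x F := by
  refine H.induct (by norm_num) hf (P := fun f => ∃ F : Polynomial ℂ, f = aeval x F) ⟨0, by simp⟩ ?_ ?_ ?_
  · rintro _ _ ⟨F, rfl⟩ ⟨G, rfl⟩; exact ⟨F + G, by simp⟩
  · rintro c _ ⟨F, rfl⟩; exact ⟨c • F, by simp⟩
  · intro s t j _ h
    have h1 : (d : ℤ) * t + j ≤ 0 := by linarith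
    have h2 : d * t + j ≤ 0 := by exact_mod_cast h1
    have h3 : j = 0 := by omega
    have h4 : d * t = 0 := by omega
    have h5 : t = 0 := by
      rcases Nat.mul_eq_zero.1 h4 with h | h
      · exact absurd h H.dpos.ne'
      · exact h
    subst h3 h5
    exact ⟨X ^ s, by simp⟩

lemma ker_Dx (H : Dan d p x y z) {D : Derivation ℂ B B} (hx : D x = 0) (hz : D z = x) {b : B} (hb : D b = 0) :
    ∃ F : Polynomial ℂ, b = aeval x F := by
  apply H.of_Le01
  have h := H.der_ext (D := D) (E := DR 0 (mo (d - 1) (-1))) (by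
      rw [hx, H.io_x, DR_mo]; simp) (by
      rw [hz, H.io_z, H.io_x, DR_mo]; simp [mo_mul]) b
  rw [hb, map_zero, DR_apply, zero_mul, zero_add] at h
  have h2 := (mul_eq_zero.1 h.symm).resolve_left (mo_ne_zero _ _)
  intro m hm
  have h3 : (Eu χ2 (H.io b)).coeff m = 0 := by rw [h2]; rfl
  rw [Eu_apply, EuLin_coeff] at h3
  have h4 := (mul_eq_zero.1 h3).resolve_right hm
  have h5 : (m.2 : ℂ) = 0 := h4
  have h6 : m.2 = 0 := by exact_mod_cast h5
  simp [wt, h6]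

def _root_.RF.SL (g : B ≃+* B) : Prop := ∃ θ : ℂ ≃+* ℂ, ∀ c, g (algebraMap ℂ B c) = algebraMap ℂ B (θ c)

lemma _root_.RF.SL.symm {g : B ≃+* B} (hg : SL g) : SL g.symm := by
  obtain ⟨θ, h⟩ := hg
  refine ⟨θ.symm, fun c => ?_⟩
  rw [RingEquiv.symm_apply_eq, h]; simp

lemma _root_.RF.SL.trans {g g' : B ≃+* B} (hg : SL g) (hg' : SL g') : SL (g.trans g') := by
  obtain ⟨θ, h⟩ := hg
  obtain ⟨θ', h'⟩ := hg'
  refine ⟨θ.trans θ', fun c => ?_⟩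
  simp [h, h']

lemma exists_DX (H : Dan d p x y z) {g : B ≃+* B} (hg : SL g) :
    ∃ D : Derivation ℂ B B, D (g x) = 0 ∧ (∀ b, NN D b) ∧ (∃ b, D b ≠ 0) ∧
      ∀ b, D b = 0 → ∃ F : Polynomial ℂ, g.symm b = aeval x F := by
  obtain ⟨D, hx, hz, hy⟩ := H.exists_Dx
  obtain ⟨θ, hθ⟩ := hg.symm
  have key : ∀ (c : ℂ) (b : B), g (D (g.symm (c • b))) = c • g (D (g.symm b)) := by
    intro c b
    rw [Algebra.smul_def, map_mul, hθ, ← Algebra.smul_def, D.map_smul, Algebra.smul_def, map_mul, ← hθ,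
      RingEquiv.apply_symm_apply, ← Algebra.smul_def]
  let D' : Derivation ℂ B B := Derivation.mk'
    { toFun := fun b => g (D (g.symm b))
      map_add' := by intro a b; simp
      map_smul' := key } (by
    intro a b
    simp)
  have hD' : ∀ b, D' b = g (D (g.symm b)) := fun b => rfl
  have hit : ∀ (k : ℕ) b, D'^[k] b = g (D^[k] (g.symm b)) := by
    intro k
    induction k with
    | zero => intro b; simp
    | succ k ih => intro b; rw [Function.iterate_succ_apply, ih, hD', Function.iterate_succ_apply]; simp
  refine ⟨D', by rw [hD']; simp [hx], ?_, ⟨g z, ?_⟩, ?_⟩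
  · intro b
    have hNx : NN D x := NN_of_ker hx
    have hNz : NN D z := NN_of_D (by rw [hz]; exact hNx)
    have hN : NN D (g.symm b) := by
      refine H.ind (P := NN D) hNx ?_ hNz NN_algebraMap (fun _ _ => NN.add) (fun _ _ => NN.mul) _
      refine NN_of_D ?_
      rw [hy, aeval_eq_sum_range]
      refine Finset.sum_induction _ (NN D) (fun _ _ => NN.add) ⟨0, rfl⟩ ?_
      intro i _
      exact (hNz.pow i).smul _
    obtain ⟨k, hk⟩ := hN
    exact ⟨k, by rw [hit, hk, map_zero]⟩
  · rw [hD']; simp [hz, H.x_ne]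
  · intro b hb
    rw [hD', map_eq_zero_iff _ g.injective] at hb
    exact H.ker_Dx hx hz hb

lemma top_main (H : Dan d p x y z) {D : Derivation ℂ B B} (hN : ∀ b, NN D b) (hne : ∃ b, D b ≠ 0)
    {f : B} (hf : D f = 0) {a b : ℕ} (ha : 0 < a) (hb : 0 < b) (hab : Nat.Coprime a b) {n : ℤ} (hn : 0 < n)
    (hd : HD a b n (H.io f)) :
    (∃ (c : ℂ) (k : ℕ), c ≠ 0 ∧ 0 < k ∧ comp a b n (H.io f) = c • mo (d * k : ℕ) 0) ∨
    (∃ (c : ℂ) (k : ℕ), c ≠ 0 ∧ 0 < k ∧ comp a b n (H.io f) = c • mo 0 (d * k : ℕ)) ∨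
    (∃ (c ρ : ℂ) (M : ℕ), c ≠ 0 ∧ ρ ≠ 0 ∧ 0 < M ∧ d ∣ a + b ∧ (a = 1 ∨ b = 1) ∧
      comp a b n (H.io f) = c • (mo 0 a - ρ • mo b 0) ^ M) := by
  have hd0 : (d : ℂ) ≠ 0 := by exact_mod_cast H.dpos.ne'
  have hab' : (0 : ℤ) < (a : ℤ) + b := by positivity
  obtain ⟨P, Q, hPQ⟩ : ∃ P Q : LR, ∀ b, H.io (D b) = DR P Q (H.io b) := by
    refine ⟨(d : ℂ)⁻¹ • (H.io (D x) * mo (-d) 0), H.io (D z) * mo (-1) (-1) - (d : ℂ)⁻¹ • (H.io (D x) * mo (-d) 0),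
      H.der_ext ?_ ?_⟩
    · rw [H.io_x, DR_mo]
      simp only [Int.cast_natCast, Int.cast_zero, zero_smul, add_zero]
      rw [smul_smul, mul_inv_cancel₀ hd0, one_smul, mul_assoc, mo_mul]
      simp [mo_zero]
    · rw [H.io_z, DR_mo]
      simp only [Int.cast_one, one_smul, add_sub_cancel]
      rw [mul_assoc, mo_mul]
      simp [mo_zero]
  have hne' : ¬ (P = 0 ∧ Q = 0) := by
    rintro ⟨rfl, rfl⟩
    obtain ⟨b, hb⟩ := hne
    apply hb
    apply H.io_inj
    rw [hPQ, DR_apply]; simp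
  obtain ⟨N, hNP, hNQ, hNne⟩ : ∃ N, Le a b N P ∧ Le a b N Q ∧ ¬ (comp a b N P = 0 ∧ comp a b N Q = 0) := by
    by_cases hP : P = 0
    · have hQ : Q ≠ 0 := fun h => hne' ⟨hP, h⟩
      obtain ⟨N, h1, h2⟩ := HD_exists a b hQ
      exact ⟨N, by rw [hP]; exact Le_zero _ _ _, h1, fun h => h2 h.2⟩
    · obtain ⟨N, h1, h2⟩ := HD_exists a b hP
      by_cases hQ : Q = 0
      · exact ⟨N, h1, by rw [hQ]; exact Le_zero _ _ _, fun h => h2 h.1⟩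
      · obtain ⟨N', h1', h2'⟩ := HD_exists a b hQ
        rcases le_total N N' with h | h
        · exact ⟨N', h1.mono h, h1', fun h => h2' h.2⟩
        · exact ⟨N, h1, h1'.mono h, fun h => h2 h.1⟩
  have hitr : ∀ (k : ℕ) b, H.io (D^[k] b) = (DR P Q)^[k] (H.io b) := by
    intro k
    induction k with
    | zero => intro b; rfl
    | succ k ih => intro b; rw [Function.iterate_succ_apply, ih, hPQ, Function.iterate_succ_apply]
  have T : TF d (comp a b N P) (comp a b N Q) := by
    refine ⟨H.dpos, ?_, ?_, hNne⟩
    · intro f hf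
      refine SS.induction (P := NN _) hf ⟨0, rfl⟩ (fun _ _ => NN.add) ?_
      intro i j hi hj hij c
      apply NN.smul
      obtain ⟨e, he1, he2⟩ := H.exists_be hab' hi hj (by simpa using hij)
      obtain ⟨k, hk⟩ := hN e
      refine ⟨k, ?_⟩
      rw [← he2, ← DR_iter hNP hNQ k he1, ← hitr, hk, map_zero, map_zero]
    · intro f hf
      refine SS.induction (P := fun f => SS d 0 (DR (comp a b N P) (comp a b N Q) f)) hf (by rw [map_zero]; exact SS_zero _ _)
        (fun f g h1 h2 => by rw [map_add]; exact h1.add h2) ?_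
      intro i j hi hj hij c
      rw [Derivation.map_smul]
      apply SS.smul
      obtain ⟨e, he1, he2⟩ := H.exists_be hab' hi hj (by simpa using hij)
      have h := DR_comp hNP hNQ he1
      rw [← hPQ] at h
      rw [← he2, ← h.2]
      exact H.comp_SS hab' h.1
  have hD := (DR_comp hNP hNQ hd.1).2
  rw [← hPQ, hf, map_zero, map_zero] at hD
  refine T.main ha hb hab hn (H.comp_SS hab' hd.1) ?_ hd.2 hD.symm
  intro m hm
  rw [comp_coeff] at hm
  by_contra h
  rw [if_neg h] at hm
  exact hm rfl

end Dan
end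
end RF

namespace RF
open Polynomial

noncomputable section

variable {d : ℕ} {p : Polynomial ℂ} {B : Type} [CommRing B] [Algebra ℂ B] {x y z : B}

namespace Dan

lemma inj_C (H : Dan d p x y z) : Function.Injective (algebraMap ℂ B) :=
  haveI := H.isDomain; (algebraMap ℂ B).injective

lemma ext_alg (H : Dan d p x y z) {f g : B →ₐ[ℂ] B} (hx : f x = g x) (hz : f z = g z) (h0 : f x ≠ 0) : f = g := by
  have := H.isDomain
  have := H.hom_ext (f := (f : B →+* B)) (g := (g : B →+* B)) (by intro c; simp) hx hz h0
  ext b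
  exact congrArg (fun k : B →+* B => k b) this

lemma lift_alg (H : Dan d p x y z) {C : Type} [CommRing C] [Algebra ℂ C] {X Y Z : C} (h : X * Y = aeval Z p) :
    ∃ f : B →ₐ[ℂ] C, f x = X ∧ f y = Y ∧ f z = Z := by
  obtain ⟨f, h1, h2⟩ := H.lift (algebraMap ℂ C) X Y Z h
  exact ⟨{ f with commutes' := h1 }, h2⟩

lemma tauHom_ex (H : Dan d p x y z) (h : Polynomial ℂ) :
    ∃ f : B →ₐ[ℂ] B, f x = x ∧ f z = z + x * aeval x h := by
  have h1 : (z + x * aeval x h) - z ∣ aeval (z + x * aeval x h) p - aeval z p := by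
    have := Polynomial.sub_dvd_eval_sub (z + x * aeval x h) z (p.map (algebraMap ℂ B))
    simpa [Polynomial.eval_map_algebraMap] using this
  obtain ⟨r, hr⟩ := h1
  obtain ⟨f, h2, _, h3⟩ := H.lift_alg (X := x) (Y := y + aeval x h * r) (Z := z + x * aeval x h) (by
    rw [sub_eq_iff_eq_add.1 hr, ← H.rel]; ring)
  exact ⟨f, h2, h3⟩

def tauHom (H : Dan d p x y z) (h : Polynomial ℂ) : B →ₐ[ℂ] B := (H.tauHom_ex h).choose
lemma tauHom_x (H : Dan d p x y z) (h : Polynomial ℂ) : H.tauHom h x = x := (H.tauHom_ex h).choose_spec.1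
lemma tauHom_z (H : Dan d p x y z) (h : Polynomial ℂ) : H.tauHom h z = z + x * aeval x h :=
  (H.tauHom_ex h).choose_spec.2

lemma tauHom_comp (H : Dan d p x y z) (h h' : Polynomial ℂ) :
    (H.tauHom h).comp (H.tauHom h') = H.tauHom (h + h') := by
  apply H.ext_alg
  · simp [tauHom_x]
  · simp only [AlgHom.comp_apply, tauHom_z, map_add, map_mul, tauHom_x]
    rw [← Polynomial.aeval_algHom_apply, tauHom_x]
    ring
  · simp [tauHom_x, H.x_ne]

lemma tauHom_zero (H : Dan d p x y z) : H.tauHom 0 = AlgHom.id ℂ B := by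
  apply H.ext_alg
  · simp [tauHom_x]
  · simp [tauHom_z]
  · simp [tauHom_x, H.x_ne]

def tau (H : Dan d p x y z) (h : Polynomial ℂ) : B ≃ₐ[ℂ] B :=
  AlgEquiv.ofAlgHom (H.tauHom h) (H.tauHom (-h))
    (by rw [tauHom_comp, add_neg_cancel, tauHom_zero]) (by rw [tauHom_comp, neg_add_cancel, tauHom_zero])

lemma tau_x (H : Dan d p x y z) (h : Polynomial ℂ) : H.tau h x = x := H.tauHom_x h
lemma tau_z (H : Dan d p x y z) (h : Polynomial ℂ) : H.tau h z = z + x * aeval x h := H.tauHom_z h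
lemma tau_tau (H : Dan d p x y z) (h h' : Polynomial ℂ) (b : B) : H.tau h (H.tau h' b) = H.tau (h + h') b :=
  congrArg (fun k : B →ₐ[ℂ] B => k b) (H.tauHom_comp h h')
lemma tau_zero (H : Dan d p x y z) (b : B) : H.tau 0 b = b :=
  congrArg (fun k : B →ₐ[ℂ] B => k b) H.tauHom_zero
lemma tau_unique (H : Dan d p x y z) (f : B ≃ₐ[ℂ] B) (h : Polynomial ℂ) (hx : f x = x)
    (hz : f z = z + x * aeval x h) (b : B) : f b = H.tau h b := by
  have : (f : B →ₐ[ℂ] B) = H.tauHom h := by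
    apply H.ext_alg
    · rw [H.tauHom_x]; exact hx
    · rw [H.tauHom_z]; exact hz
    · change f x ≠ 0; rw [hx]; exact H.x_ne
  exact congrArg (fun k : B →ₐ[ℂ] B => k b) this

/-- the elementary tau -/
abbrev te (H : Dan d p x y z) (e : ℕ) (δ : ℂ) : B ≃ₐ[ℂ] B := H.tau (Polynomial.monomial e δ)

lemma te_z (H : Dan d p x y z) (e : ℕ) (δ : ℂ) : H.te e δ z = z + δ • x ^ (e + 1) := by
  rw [te, tau_z, Polynomial.aeval_monomial, Algebra.smul_def]; ring

lemma te_y (H : Dan d p x y z) (e : ℕ) {b : ℕ} (hb : b + 1 = d * (e + 1)) (δ : ℂ) :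
    Le 1 b (b * d) (H.io (H.te e δ y)) ∧
    comp 1 b (b * d) (H.io (H.te e δ y)) = (mo 0 1 + δ • mo b 0) ^ d := by
  have hb' : (b : ℤ) + 1 = d * (e + 1) := by exact_mod_cast hb
  have h1 : mo d 0 * H.io (H.te e δ y) = aeval (mo 1 1 + δ • mo (d * (e + 1)) 0) p := by
    have h0 := congrArg (fun b => H.io (H.te e δ b)) H.rel
    simp only [map_mul, tau_x, io_x] at h0
    rw [h0, ← Polynomial.aeval_algHom_apply, ← Polynomial.aeval_algHom_apply, te_z, map_add, map_smul, map_pow, H.io_z,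
      H.io_x, mo_pow]
    congr 3
    push_cast
    ring_nf
  have hZ : Le 1 b (1 + b) (mo 1 1 + δ • mo (d * (e + 1)) 0) :=
    (Le_mo (by linarith)).add ((Le_mo (by linarith)).smul δ)
  have h2 := Le_aeval (by positivity) hZ H.monic
  rw [← h1, H.deg] at h2
  have h3 : Le 1 b (-d) (mo (-d) 0) := Le_mo (by linarith)
  have e1 : H.io (H.te e δ y) = (mo d 0 * H.io (H.te e δ y)) * mo (-d) 0 := by
    rw [mul_comm, ← mul_assoc, mo_mul]; simp [mo_zero]
  have e2 : (b : ℤ) * d = (d * (1 + b) + -d) := by ring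
  rw [e1, e2]
  refine ⟨h2.1.mul h3, ?_⟩
  rw [comp_mul h2.1 h3, h2.2, map_add, map_smul, comp_mo, comp_mo, comp_mo, if_pos (by ring), if_pos (by linarith),
    if_pos (by ring)]
  have e3 : mo 1 1 + δ • mo (d * (e + 1)) 0 = mo 1 0 * (mo 0 1 + δ • mo b 0) := by
    rw [mul_add (mo 1 0), mul_smul_comm, mo_mul, mo_mul]
    congr 3 <;> linarith
  rw [e3, mul_pow, mo_pow, mul_comm, ← mul_assoc, mo_mul]
  simp [mo_zero]

lemma te_Le (H : Dan d p x y z) (e : ℕ) {b : ℕ} (hb : b + 1 = d * (e + 1)) (δ : ℂ) {n : ℤ} {f : B}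
    (hf : Le 1 b n (H.io f)) : Le 1 b n (H.io (H.te e δ f)) := by
  have hb' : (b : ℤ) + 1 = d * (e + 1) := by exact_mod_cast hb
  refine H.induct (by positivity) hf (P := fun f => Le 1 b n (H.io (H.te e δ f))) ?_ ?_ ?_ ?_
  · rw [map_zero, map_zero]; exact Le_zero _ _ _
  · intro f g h1 h2; rw [map_add, map_add]; exact h1.add h2
  · intro c f h; rw [map_smul, map_smul]; exact h.smul c
  · intro s t j _ h
    have hx : Le 1 b d (H.io (H.te e δ x)) := by rw [tau_x, H.io_x]; exact Le_mo (by linarith)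
    have hy := (H.te_y e hb δ).1
    have hz : Le 1 b (1 + b) (H.io (H.te e δ z)) := by
      rw [te_z, map_add, map_smul, map_pow, H.io_z, H.io_x, mo_pow]
      exact (Le_mo (by linarith)).add ((Le_mo (by push_cast; linarith)).smul δ)
    simp only [map_mul, map_pow]
    exact (((hx.pow_comp s).1.mul (hy.pow_comp t).1).mul (hz.pow_comp j).1).mono (by linarith)

def TX (H : Dan d p x y z) (k : ℕ) (f : B) : Prop :=
  ∃ c : ℂ, c ≠ 0 ∧ Le 1 1 (d * k - 1) (H.io (f - c • x ^ k))

lemma io_xk (H : Dan d p x y z) (k : ℕ) : H.io (x ^ k) = mo (d * k) 0 := by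
  rw [map_pow, H.io_x, mo_pow, mul_comm, mul_zero]

lemma TX.top {H : Dan d p x y z} {k : ℕ} {f : B} (h : H.TX k f) : ∃ c : ℂ, c ≠ 0 ∧ Le 1 1 (d * k) (H.io f) ∧
    comp 1 1 (d * k) (H.io f) = c • mo (d * k) 0 := by
  obtain ⟨c, hc, h⟩ := h
  refine ⟨c, hc, ?_⟩
  have e : f = (f - c • x ^ k) + c • x ^ k := by ring
  rw [e, map_add, map_smul, io_xk]
  refine ⟨(h.mono (by omega)).add (Le.smul (Le_mo (by linarith)) c), ?_⟩
  rw [map_add, comp_of_lt h (by omega), zero_add, comp_smul_mo, if_pos (by ring)]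

lemma TX.HD {H : Dan d p x y z} {k : ℕ} {f : B} (h : H.TX k f) : RF.HD 1 1 (d * k) (H.io f) := by
  obtain ⟨c, hc, h1, h2⟩ := h.top
  refine ⟨h1, ?_⟩
  rw [h2]; exact smul_ne_zero hc (mo_ne_zero _ _)

lemma TX_of_top (H : Dan d p x y z) {k : ℕ} {f : B} {c : ℂ} (hc : c ≠ 0) (h1 : Le 1 1 (d * k) (H.io f))
    (h2 : comp 1 1 (d * k) (H.io f) = c • mo (d * k) 0) : H.TX k f := by
  refine ⟨c, hc, Le.pred ?_ ?_⟩
  · rw [sub_eq_add_neg, map_add, map_neg, map_smul, io_xk]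
    exact h1.add (Le.smul (Le_mo (by linarith)) c).neg
  · rw [map_sub, map_smul, io_xk, map_sub, h2, comp_smul_mo, if_pos (by ring), sub_self]

lemma Le_swap (H : Dan d p x y z) {n : ℤ} {f : B} (h : Le 1 1 n (H.io f)) : Le 1 1 n (H.swap.io f) := by
  refine H.induct (by norm_num) h (P := fun f => Le 1 1 n (H.swap.io f)) ?_ ?_ ?_ ?_
  · rw [map_zero]; exact Le_zero _ _ _
  · intro f g h1 h2; rw [map_add]; exact h1.add h2
  · intro c f h; rw [map_smul]; exact h.smul c
  · intro s t j _ h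
    have := (H.swap.be_top (a := 1) (b := 1) (by norm_num) t s j).1
    rw [mul_comm (x ^ s)]
    exact this.mono (by linarith)

lemma Le_swap_iff (H : Dan d p x y z) {n : ℤ} {f : B} : Le 1 1 n (H.swap.io f) ↔ Le 1 1 n (H.io f) :=
  ⟨fun h => H.swap.Le_swap h, fun h => H.Le_swap h⟩

lemma HD_iff (H : Dan d p x y z) {n : ℤ} {f : B} : HD 1 1 n (H.io f) ↔
    Le 1 1 n (H.io f) ∧ ¬ Le 1 1 (n - 1) (H.io f) := by
  constructor
  · intro h; exact ⟨h.1, fun h' => by have := h.le h'; omega⟩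
  · rintro ⟨h1, h2⟩; exact ⟨h1, fun h => h2 (h1.pred h)⟩

lemma HD_swap_iff (H : Dan d p x y z) {n : ℤ} {f : B} : HD 1 1 n (H.swap.io f) ↔ HD 1 1 n (H.io f) := by
  rw [H.swap.HD_iff, H.HD_iff, H.Le_swap_iff, H.Le_swap_iff]

lemma of_Le0 (H : Dan d p x y z) {n : ℤ} (hn : n < 2) {f : B} (h : Le 1 1 n (H.io f)) :
    ∃ c, f = algebraMap ℂ B c := by
  refine H.induct (by norm_num) h (P := fun f => ∃ c, f = algebraMap ℂ B c) ?_ ?_ ?_ ?_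
  · exact ⟨0, by simp⟩
  · rintro _ _ ⟨a, rfl⟩ ⟨b, rfl⟩; exact ⟨a + b, by simp⟩
  · rintro c _ ⟨a, rfl⟩; exact ⟨c * a, by simp [Algebra.smul_def]⟩
  · intro s t j _ h
    have h1 : d * s + d * t + 2 * j < 2 := by zify; linarith
    have h2 := H.hd
    have h3 : s = 0 := by by_contra h; have : 1 ≤ s := by omega
                          nlinarith
    have h4 : t = 0 := by by_contra h; have : 1 ≤ t := by omega
                          nlinarith
    have h5 : j = 0 := by omega
    subst h3 h4 h5
    exact ⟨1, by simp⟩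

lemma SL_const {g : B ≃+* B} (hg : SL g) {b : B} {c : ℂ} (h : g b = algebraMap ℂ B c) :
    ∃ c', b = algebraMap ℂ B c' := by
  obtain ⟨θ, hθ⟩ := hg.symm
  exact ⟨θ c, by rw [← hθ, ← h]; simp⟩

lemma top11 (H : Dan d p x y z) {g : B ≃+* B} (hg : SL g) :
    ∃ k : ℕ, 0 < k ∧ (H.TX k (g x) ∨ H.swap.TX k (g x)) := by
  obtain ⟨D, h1, h2, h3, -⟩ := H.exists_DX hg
  have hgx : g x ≠ 0 := by simp [H.x_ne]
  obtain ⟨n, hn⟩ := HD_exists 1 1 (H.io_ne hgx)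
  have hn0 : 0 < n := by
    by_contra h
    obtain ⟨c, hc⟩ := H.of_Le0 (by omega) hn.1
    obtain ⟨c', hc'⟩ := SL_const hg hc
    have h5 : H.io x = algebraMap ℂ LR c' := (congrArg H.io hc').trans (AlgHom.commutes _ _)
    rw [H.io_x, Algebra.algebraMap_eq_smul_one] at h5
    have h6 : HD 1 1 (d : ℤ) (mo d 0) := by have := HD_mo 1 1 d 0; simpa using this
    rw [h5] at h6
    have := h6.le ((Le_one 1 1).smul c')
    have := H.dpos
    omega
  rcases H.top_main h2 h3 h1 (a := 1) (b := 1) one_pos one_pos (Nat.coprime_one_left 1) hn0 (by exact_mod_cast hn)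
    with ⟨c, k, hc, hk, h⟩ | ⟨c, k, hc, hk, h⟩ | ⟨c, ρ, M, _, _, _, h, _⟩
  · refine ⟨k, hk, Or.inl ?_⟩
    simp only [Nat.cast_one, Nat.cast_mul] at h
    have hh : comp 1 1 n (H.io (g x)) ≠ 0 := hn.2
    have : n = d * k := by
      have h7 : comp 1 1 n (comp 1 1 n (H.io (g x))) = comp 1 1 n (H.io (g x)) := by
        ext m; rw [comp_coeff, comp_coeff]; split_ifs <;> rfl
      rw [h, comp_smul_mo] at h7
      split_ifs at h7 with h8
      · linarith
      · exact absurd h7.symm (smul_ne_zero hc (mo_ne_zero _ _))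
    subst this
    exact H.TX_of_top hc hn.1 h
  · refine ⟨k, hk, Or.inr ?_⟩
    simp only [Nat.cast_one, Nat.cast_mul] at h
    have : n = d * k := by
      have h7 : comp 1 1 n (comp 1 1 n (H.io (g x))) = comp 1 1 n (H.io (g x)) := by
        ext m; rw [comp_coeff, comp_coeff]; split_ifs <;> rfl
      rw [h, comp_smul_mo] at h7
      split_ifs at h7 with h8
      · linarith
      · exact absurd h7.symm (smul_ne_zero hc (mo_ne_zero _ _))
    subst this
    refine ⟨c, hc, ?_⟩
    rw [Le_swap_iff]
    have hy := H.be_top (a := 1) (b := 1) (by norm_num) 0 k 0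
    simp only [pow_zero, one_mul, mul_one, Nat.cast_zero, mul_zero, add_zero, zero_add] at hy
    apply Le.pred
    · rw [map_sub, sub_eq_add_neg, map_smul]
      exact hn.1.add (hy.1.smul c).neg
    · rw [map_sub, map_smul, map_sub, map_smul, h, hy.2, sub_self]
  · have := Nat.le_of_dvd (by norm_num) h
    have := H.hd
    omega

end Dan
end
end RF

namespace RF
open Polynomial

noncomputable section

variable {d : ℕ} {p : Polynomial ℂ} {B : Type} [CommRing B] [Algebra ℂ B] {x y z : B}

lemma comp_idem (a b n : ℤ) (f : LR) : comp a b n (comp a b n f) = comp a b n f := by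
  ext m; rw [comp_coeff, comp_coeff]; split_ifs <;> rfl

lemma HD_binom (b : ℕ) (ρ : ℂ) : HD 1 b b (mo 0 1 + ρ • mo b 0) := by
  refine ⟨(Le_mo (by linarith)).add (Le.smul (Le_mo (by linarith)) ρ), ?_⟩
  rw [map_add, map_smul, comp_mo, comp_mo, if_pos (by ring), if_pos (by ring)]
  intro h
  have := congrArg (fun f : LR => f.coeff (0, 1)) h
  simp [mo_coeff] at this

lemma binom_coeff (b M : ℕ) (hb : 0 < b) (ρ : ℂ) :
    ((mo 0 1 + ρ • mo b 0) ^ M).coeff ((M * b : ℤ), (0 : ℤ)) = ρ ^ M := by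
  have h : Le 1 0 b (mo 0 1 + ρ • mo b 0) :=
    (Le_mo (by simp)).add (Le.smul (Le_mo (by linarith)) ρ)
  have h1 := (h.pow_comp M).2
  have h2 : comp 1 0 b (mo 0 1 + ρ • mo b 0) = ρ • mo b 0 := by
    rw [map_add, map_smul, comp_mo, comp_mo, if_neg (by simp; omega), if_pos (by ring), zero_add]
  have h3 := congrArg (fun f : LR => f.coeff ((M * b : ℤ), (0 : ℤ))) h1
  simp only [comp_coeff] at h3
  rw [if_pos (by simp [wt]), h2, _root_.smul_pow, mo_pow] at h3
  rw [h3]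
  simp [mo_coeff]

namespace Dan

lemma reduce (H : Dan d p x y z) {g : B ≃+* B} (hg : SL g) {k : ℕ} (hk : 0 < k) (hT : H.TX k (g x))
    (hn : ¬ Le 0 1 0 (H.io (g x))) :
    ∃ (e : ℕ) (ρ : ℂ), ∀ ρ', Le 1 1 (d * k - 1) (H.io (H.te e ρ' (g x))) ↔ ρ' = ρ := by
  have hdp := H.dpos
  have hd3 := H.hd
  obtain ⟨D, hD1, hD2, hD3, -⟩ := H.exists_DX hg
  obtain ⟨c0, hc0, hT1, hT2⟩ := hT.top
  set X := g x with hX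
  have hv := H.v_nonneg X
  have hdk : (H.io X).coeff ((d * k : ℤ), (0 : ℤ)) = c0 := by
    have := congrArg (fun f : LR => f.coeff ((d * k : ℤ), (0 : ℤ))) hT2
    simp only [comp_coeff] at this
    rw [if_pos (by simp [wt])] at this
    rw [this]; simp [mo_coeff]
  -- points
  have hpt : ∀ m, (H.io X).coeff m ≠ 0 → 0 ≤ m.2 ∧ m.1 + m.2 ≤ d * k ∧ (m.1 + m.2 = d * k → m.2 = 0) := by
    intro m hm
    have h1 := hv m hm
    have h2 := hT1 m hm
    simp only [wt] at h1 h2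
    refine ⟨by linarith, by linarith, fun h => ?_⟩
    have := congrArg (fun f : LR => f.coeff m) hT2
    simp only [comp_coeff] at this
    rw [if_pos (by simp only [wt]; linarith)] at this
    rw [this] at hm
    by_contra h3
    apply hm
    simp only [AddMonoidAlgebra.coeff_smul, Finsupp.smul_apply, mo_coeff]
    rw [if_neg, smul_zero]
    intro h4
    rw [← h4] at h3
    exact h3 rfl
  obtain ⟨ms, hms, hmax⟩ : ∃ m ∈ (H.io X).coeff.support.filter (fun m : ℤ × ℤ => 0 < m.2),
      ∀ m' ∈ (H.io X).coeff.support.filter (fun m : ℤ × ℤ => 0 < m.2),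
        (m'.2 : ℚ) / (d * k - m'.1) ≤ (m.2 : ℚ) / (d * k - m.1) := by
    apply Finset.exists_max_image
    simp only [Le, not_forall] at hn
    obtain ⟨m, hm, hm2⟩ := hn
    refine ⟨m, ?_⟩
    simp only [wt] at hm2
    rw [Finset.mem_filter, Finsupp.mem_support_iff]
    exact ⟨hm, by linarith⟩
  rw [Finset.mem_filter, Finsupp.mem_support_iff] at hms
  obtain ⟨hms1, hms2⟩ := hms
  have hlt : ∀ m, (H.io X).coeff m ≠ 0 → 0 < m.2 → m.2 < d * k - m.1 := by
    intro m hm h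
    obtain ⟨_, h2, h3⟩ := hpt m hm
    have : m.1 + m.2 ≠ d * k := fun h' => by have := h3 h'; omega
    omega
  obtain ⟨a, b, ha, hb, hab, hco, hrat⟩ : ∃ a b : ℕ, 0 < a ∧ 0 < b ∧ a < b ∧ a.Coprime b ∧
      (a : ℤ) * (d * k - ms.1) = b * ms.2 := by
    have h1 := hlt ms hms1 hms2
    obtain ⟨J, hJ⟩ := Int.eq_ofNat_of_zero_le hms2.le
    obtain ⟨I, hI⟩ := Int.eq_ofNat_of_zero_le (show 0 ≤ (d : ℤ) * k - ms.1 by omega)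
    rw [hJ] at hms2 h1 ⊢
    rw [hI] at h1 ⊢
    have hJ0 : 0 < J := by exact_mod_cast hms2
    have hJI : J < I := by exact_mod_cast h1
    have hg0 := Nat.gcd_pos_of_pos_left I hJ0
    obtain ⟨g', a, b, hg1, hco, ha, hb⟩ := Nat.exists_coprime' hg0
    refine ⟨a, b, ?_, ?_, ?_, hco, ?_⟩
    · rcases Nat.eq_zero_or_pos a with h | h
      · subst h; omega
      · exact h
    · rcases Nat.eq_zero_or_pos b with h | h
      · subst h; omega
      · exact h
    · rw [ha, hb] at hJI
      exact Nat.lt_of_mul_lt_mul_right hJI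
    · rw [ha, hb]; push_cast; ring
  have haq : (0 : ℚ) < a := by exact_mod_cast ha
  have hbq : (0 : ℚ) < b := by exact_mod_cast hb
  have hLe : Le a b (a * (d * k)) (H.io X) := by
    intro m hm
    obtain ⟨h1, h2, h3⟩ := hpt m hm
    simp only [wt]
    rcases h1.lt_or_eq with h | h
    · have h4 := hmax m (by rw [Finset.mem_filter, Finsupp.mem_support_iff]; exact ⟨hm, h⟩)
      have h5 := hlt m hm h
      have h6 := hlt ms hms1 hms2
      have h5' : (0 : ℚ) < d * k - m.1 := by
        have : (0 : ℤ) < d * k - m.1 := by omega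
        exact_mod_cast this
      have h6' : (0 : ℚ) < d * k - ms.1 := by
        have : (0 : ℤ) < d * k - ms.1 := by omega
        exact_mod_cast this
      rw [div_le_div_iff₀ h5' h6'] at h4
      have h7 : (a : ℚ) * (d * k - ms.1) = b * ms.2 := by exact_mod_cast hrat
      have h8 : (b : ℚ) * m.2 * (d * k - ms.1) ≤ a * (d * k - m.1) * (d * k - ms.1) := by
        have : (b : ℚ) * (m.2 * (d * k - ms.1)) ≤ b * (ms.2 * (d * k - m.1)) := by gcongr
        nlinarith
      have h9 := le_of_mul_le_mul_right h8 h6'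
      have h10 : (b : ℤ) * m.2 ≤ a * (d * k - m.1) := by exact_mod_cast h9
      linarith
    · rw [← h] at h2 ⊢
      have : (a : ℤ) * m.1 ≤ a * (d * k) := by
        apply mul_le_mul_of_nonneg_left (by linarith) (by positivity)
      linarith
  have hcoe : ∀ m, wt a b m = a * (d * k) → (comp a b (a * (d * k)) (H.io X)).coeff m = (H.io X).coeff m := by
    intro m hm; rw [comp_coeff, if_pos hm]
  have hc1 := hcoe ((d * k : ℤ), (0 : ℤ)) (by simp [wt])
  have hc2 := hcoe ms (by simp only [wt]; linarith)
  have hdk0 : (0 : ℤ) < d * k := by positivity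
  have hHD : HD a b (a * (d * k)) (H.io X) := ⟨hLe, fun h => by rw [h] at hc2; exact hms1 hc2.symm⟩
  rcases H.top_main hD2 hD3 hD1 ha hb hco (by positivity) hHD with
    ⟨c, k', hc, hk', h⟩ | ⟨c, k', hc, hk', h⟩ | ⟨c, ρ, M, hc, hρ, hM, hdvd, h1, h⟩
  · exfalso
    rw [h] at hc2
    apply hms1
    rw [← hc2]
    simp only [AddMonoidAlgebra.coeff_smul, Finsupp.smul_apply, mo_coeff]
    rw [if_neg, smul_zero]
    intro h4; rw [← h4] at hms2; simp at hms2
  · exfalso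
    rw [h, hdk] at hc1
    apply hc0
    rw [← hc1]
    simp only [AddMonoidAlgebra.coeff_smul, Finsupp.smul_apply, mo_coeff]
    rw [if_neg, smul_zero]
    intro h4; rw [Prod.mk.injEq] at h4; omega
  obtain rfl : a = 1 := by omega
  obtain ⟨e', he'⟩ := hdvd
  obtain ⟨e, rfl⟩ : ∃ e, e' = e + 1 := by
    cases e' with
    | zero => omega
    | succ e => exact ⟨e, rfl⟩
  have hbe : b + 1 = d * (e + 1) := by omega
  have hb2 : 2 ≤ b := by
    have : d * 1 ≤ d * (e + 1) := Nat.mul_le_mul_left d (by omega)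
    omega
  simp only [Nat.cast_one, one_mul] at h hLe hHD
  have hMb : (M : ℤ) * b = d * k := by
    have h2 := ((HD_binom b (-ρ)).pow M).smul hc
    have e1 : mo 0 1 + (-ρ) • mo b 0 = mo 0 1 - ρ • mo b 0 := by rw [neg_smul]; ring
    rw [e1, ← h] at h2
    have h3 : HD 1 b (d * k) (comp 1 b (d * k) (H.io X)) :=
      ⟨Le_comp _ _ _ _, by rw [comp_idem]; exact hHD.2⟩
    exact h2.unique h3
  have hdM : d ∣ M := by
    have h2 : d ∣ M * b := ⟨k, by exact_mod_cast hMb⟩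
    have h3 : Nat.Coprime d b := by
      have h4 : Nat.Coprime (d * (e + 1)) b := by
        rw [← hbe]
        simp
      exact h4.coprime_mul_right
    exact h3.dvd_of_dvd_mul_right h2
  obtain ⟨L, rfl⟩ := hdM
  refine ⟨e, ρ, fun ρ' => ?_⟩
  -- key
  have hpy : ∀ δ : ℂ, Le 1 b (d * k) (H.io (H.te e δ y ^ L)) ∧
      comp 1 b (d * k) (H.io (H.te e δ y ^ L)) = (mo 0 1 + δ • mo b 0) ^ (d * L) := by
    intro δ
    obtain ⟨h2, h3⟩ := H.te_y e hbe δ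
    have h4 := h2.pow_comp L
    have e2 : (L : ℤ) * (b * d) = d * k := by rw [← hMb]; push_cast; ring
    rw [e2, h3, ← pow_mul] at h4
    rw [map_pow]; exact h4
  have hX' : Le 1 b (d * k - 1) (H.io (X - c • H.te e (-ρ) y ^ L)) := by
    apply Le.pred
    · rw [map_sub, map_smul, sub_eq_add_neg]
      exact hLe.add ((hpy _).1.smul c).neg
    · rw [map_sub, map_smul, map_sub, map_smul, (hpy _).2, h, neg_smul, ← sub_eq_add_neg]
      simp
  have hX'' := H.te_Le e hbe ρ' hX'
  have e3 : H.te e ρ' X = H.te e ρ' (X - c • H.te e (-ρ) y ^ L) + c • H.te e (ρ' - ρ) y ^ L := by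
    rw [map_sub, map_smul, map_pow, H.tau_tau, ← map_add, ← sub_eq_add_neg]
    ring
  have hfin : Le 1 b (d * k) (H.io (H.te e ρ' X)) ∧ comp 1 b (d * k) (H.io (H.te e ρ' X)) =
      c • (mo 0 1 + (ρ' - ρ) • mo b 0) ^ (d * L) := by
    rw [e3, map_add, map_smul]
    refine ⟨(hX''.mono (by omega)).add ((hpy _).1.smul c), ?_⟩
    rw [map_add, comp_of_lt hX'' (by omega), map_smul, (hpy _).2, zero_add]
  have hco2 : (H.io (H.te e ρ' X)).coeff ((d * k : ℤ), (0 : ℤ)) = c * (ρ' - ρ) ^ (d * L) := by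
    have h5 := congrArg (fun f : LR => f.coeff ((d * k : ℤ), (0 : ℤ))) hfin.2
    simp only [comp_coeff] at h5
    rw [if_pos (by simp [wt])] at h5
    rw [h5, AddMonoidAlgebra.coeff_smul, Finsupp.smul_apply, ← hMb, binom_coeff b _ hb, smul_eq_mul]
  constructor
  · intro hle
    by_contra hne
    have h6 : (H.io (H.te e ρ' X)).coeff ((d * k : ℤ), (0 : ℤ)) ≠ 0 := by
      rw [hco2]; exact mul_ne_zero hc (pow_ne_zero _ (sub_ne_zero.2 hne))
    have := hle _ h6
    simp only [wt] at this
    linarith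
  · rintro rfl m hm
    have h7 := hfin.1 m hm
    have h8 := H.v_nonneg (H.te e ρ' X) m hm
    simp only [wt] at h7 h8 ⊢
    have h8' : 0 ≤ m.2 := by linarith
    have hb2' : (2 : ℤ) ≤ b := by exact_mod_cast hb2
    rcases h8'.lt_or_eq with h9 | h9
    · nlinarith
    · by_contra h10
      have h11 : m = ((d * k : ℤ), (0 : ℤ)) := by
        rw [← h9] at h7 h10
        ext
        · simp only; linarith
        · exact h9.symm
      rw [h11, hco2, sub_self, zero_pow hM.ne', mul_zero] at hm
      exact hm rfl

end Dan
end
end RF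

namespace RF
open Polynomial

noncomputable section

variable {d : ℕ} {p : Polynomial ℂ} {B : Type} [CommRing B] [Algebra ℂ B] {x y z : B}

lemma HD_aeval {a b w : ℤ} (hw : 0 < w) {Z : LR} (hZ : HD a b w Z) {F : Polynomial ℂ} (hF : F ≠ 0) :
    HD a b (F.natDegree * w) (aeval Z F) := by
  have hl : F.leadingCoeff ≠ 0 := leadingCoeff_ne_zero.2 hF
  have hm : (C F.leadingCoeff⁻¹ * F).Monic := by
    rw [Monic, leadingCoeff_mul, leadingCoeff_C, inv_mul_cancel₀ hl]
  have hdeg : (C F.leadingCoeff⁻¹ * F).natDegree = F.natDegree := natDegree_C_mul (inv_ne_zero hl)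
  have h := Le_aeval hw hZ.1 hm
  rw [hdeg] at h
  have e : aeval Z F = F.leadingCoeff • aeval Z (C F.leadingCoeff⁻¹ * F) := by
    rw [map_mul, aeval_C, ← Algebra.smul_def, smul_smul, mul_inv_cancel₀ hl, one_smul]
  rw [e]
  exact HD.smul ⟨h.1, by rw [h.2]; exact pow_ne_zero _ hZ.2⟩ hl

lemma nextCoeff_comp {d : ℕ} (hd : 2 ≤ d) {p : Polynomial ℂ} (hm : p.Monic) (hdeg : p.natDegree = d)
    (hred : p.coeff (d - 1) = 0) {a b : ℂ} (ha : a ≠ 0) (h : p ∣ p.comp (C a * X + C b)) :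
    b = 0 ∧ p.comp (C a * X) = C (a ^ d) * p := by
  have hLd : (C a * X + C b).natDegree = 1 := natDegree_linear ha
  have hLl : (C a * X + C b).leadingCoeff = a := leadingCoeff_linear ha
  have hcd : (p.comp (C a * X + C b)).natDegree = d := by rw [natDegree_comp, hLd, hdeg, mul_one]
  have hcl : (p.comp (C a * X + C b)).leadingCoeff = a ^ d := by
    rw [leadingCoeff_comp (by rw [hLd]; norm_num), hm.leadingCoeff, hLl, hdeg, one_mul]
  obtain ⟨r, hr⟩ := h
  have hr0 : r.natDegree = 0 := by
    have h1 : p.comp (C a * X + C b) ≠ 0 := by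
      intro h; rw [h] at hcl; simp at hcl; exact pow_ne_zero d ha hcl.symm
    have hr' : r ≠ 0 := by rintro rfl; rw [mul_zero] at hr; exact h1 hr
    rw [hr, natDegree_mul hm.ne_zero hr', hdeg] at hcd
    omega
  obtain ⟨r0, rfl⟩ := natDegree_eq_zero.1 hr0
  have hr1 : r0 = a ^ d := by
    rw [hr, leadingCoeff_mul, hm.leadingCoeff, leadingCoeff_C, one_mul] at hcl; exact hcl
  subst hr1
  have hs : (p - X ^ d).natDegree ≤ d - 2 := by
    rw [natDegree_le_iff_coeff_eq_zero]
    intro N hN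
    rw [coeff_sub, coeff_X_pow]
    rcases lt_trichotomy N d with h | h | h
    · have : N = d - 1 := by omega
      subst this; rw [hred, if_neg (by omega), sub_zero]
    · subst h; rw [if_pos rfl]; have := hm.coeff_natDegree; rw [hdeg] at this; rw [this, sub_self]
    · rw [if_neg (by omega), coeff_eq_zero_of_natDegree_lt (by omega), sub_zero]
  have hb : b = 0 := by
    have h1 := congrArg (fun q : Polynomial ℂ => q.coeff (d - 1)) hr
    simp only [coeff_mul_C, hred, zero_mul] at h1
    have e : p.comp (C a * X + C b) = C (a ^ d) * (X + C (b / a)) ^ d + (p - X ^ d).comp (C a * X + C b) := by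
      rw [sub_comp, X_pow_comp]
      have : C a * X + C b = C a * (X + C (b / a)) := by
        rw [mul_add, ← C_mul, mul_div_cancel₀ _ ha]
      rw [this, mul_pow, ← C_pow]; ring
    have hz0 : ((p - X ^ d).comp (C a * X + C b)).coeff (d - 1) = 0 :=
      coeff_eq_zero_of_natDegree_lt (by rw [natDegree_comp, hLd, mul_one]; omega)
    rw [e, coeff_add, coeff_C_mul, coeff_X_add_C_pow, hz0, add_zero] at h1
    · rw [show d - (d - 1) = 1 by omega, pow_one, mul_eq_zero, mul_eq_zero, div_eq_zero_iff] at h1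
      have hch : ((d.choose (d - 1) : ℕ) : ℂ) ≠ 0 := by
        have := Nat.choose_pos (show d - 1 ≤ d by omega)
        exact_mod_cast this.ne'
      have hp := pow_ne_zero d ha
      tauto
  refine ⟨hb, ?_⟩
  subst hb
  rw [C_0, add_zero] at hr
  rw [hr, mul_comm]

namespace Dan

lemma SL_aeval {g : B ≃+* B} {θ : ℂ ≃+* ℂ} (hθ : ∀ c, g (algebraMap ℂ B c) = algebraMap ℂ B (θ c))
    (b : B) (F : Polynomial ℂ) : g (aeval b F) = aeval (g b) (F.map (θ : ℂ →+* ℂ)) := by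
  rw [aeval_def, aeval_def, eval₂_map, ← RingEquiv.coe_toRingHom, hom_eval₂]
  congr 1
  ext c
  simp [hθ]

lemma HD_x (H : Dan d p x y z) : HD 1 1 d (H.io x) := by
  rw [H.io_x]; have := HD_mo 1 1 d 0; simpa using this

lemma HD_Fx (H : Dan d p x y z) {F : Polynomial ℂ} (hF : F ≠ 0) : HD 1 1 (F.natDegree * d) (H.io (aeval x F)) := by
  rw [← aeval_algHom_apply]
  exact HD_aeval (by exact_mod_cast H.dpos) H.HD_x hF

lemma aeval_x_inj (H : Dan d p x y z) {F : Polynomial ℂ} (h : aeval x F = 0) : F = 0 := by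
  by_contra hF
  have := (H.HD_Fx hF).ne_zero
  rw [h, map_zero] at this
  exact this rfl

lemma z_ne_const (H : Dan d p x y z) (c : ℂ) : z ≠ algebraMap ℂ B c := by
  intro h
  have h1 : H.io z = algebraMap ℂ LR c := (congrArg H.io h).trans (AlgHom.commutes _ _)
  rw [H.io_z, Algebra.algebraMap_eq_smul_one] at h1
  have h2 := HD_mo 1 1 1 1
  rw [h1] at h2
  have := h2.le ((Le_one 1 1).smul c)
  omega

lemma lin_x (H : Dan d p x y z) {g : B ≃+* B} (hg : SL g) (hX : Le 0 1 0 (H.io (g x))) :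
    ∃ c c0 : ℂ, c ≠ 0 ∧ g x = c • x + algebraMap ℂ B c0 := by
  have := H.isDomain
  obtain ⟨F, hF⟩ := H.of_Le01 hX
  obtain ⟨D, hD1, hD2, hD3, hD4⟩ := H.exists_DX hg
  obtain ⟨k, hk, hT⟩ := H.top11 hg
  have hHD : HD 1 1 (d * k) (H.io (g x)) := by
    rcases hT with h | h
    · exact h.HD
    · exact H.HD_swap_iff.1 h.HD
  have hF0 : F ≠ 0 := by
    rintro rfl
    apply H.x_ne
    rw [map_zero] at hF
    exact (map_eq_zero_iff g g.injective).1 hF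
  have hFk : F.natDegree = k := by
    have h1 := H.HD_Fx hF0
    rw [← hF] at h1
    have h2 := h1.unique hHD
    have hd0 : (d : ℤ) ≠ 0 := by exact_mod_cast H.dpos.ne'
    have : (F.natDegree : ℤ) = k := by
      apply mul_left_cancel₀ hd0; linarith
    exact_mod_cast this
  have hF' : derivative F ≠ 0 := by
    intro h
    have := derivative_eq_zero.1 h
    omega
  have hDx : D x = 0 := by
    rw [hF, Derivation.map_aeval, smul_eq_mul] at hD1
    exact (mul_eq_zero.1 hD1).resolve_left (fun h => hF' (H.aeval_x_inj h))
  obtain ⟨G, hG⟩ := hD4 x hDx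
  obtain ⟨θ, hθ⟩ := hg
  have hx : x = aeval (g x) (G.map (θ : ℂ →+* ℂ)) := by
    rw [← SL_aeval hθ, ← hG]; simp
  have hG0 : G.map (θ : ℂ →+* ℂ) ≠ 0 := by
    intro h; rw [h, map_zero] at hx; exact H.x_ne hx
  have h5 : HD 1 1 (d * (((G.map (θ : ℂ →+* ℂ)).natDegree * k : ℕ) : ℤ)) (H.io x) := by
    have h := HD_aeval (by have := H.dpos; positivity) hHD hG0
    rw [aeval_algHom_apply, ← hx] at h
    convert h using 1
    push_cast; ring
  have h6 := h5.unique H.HD_x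
  have h7 : d * ((G.map (θ : ℂ →+* ℂ)).natDegree * k) = d * 1 := by rw [mul_one]; exact_mod_cast h6
  have h8 := Nat.eq_of_mul_eq_mul_left H.dpos h7
  have hk1 : k = 1 := Nat.eq_one_of_mul_eq_one_left h8
  rw [hk1] at hFk
  obtain ⟨c, hc, c0, rfl⟩ := natDegree_eq_one.1 hFk
  refine ⟨c, c0, hc, ?_⟩
  rw [hF]
  simp [Algebra.smul_def]

lemma vdeg_z (H : Dan d p x y z) {g : B ≃+* B} (hg : SL g) (hX : Le 0 1 0 (H.io (g x))) :
    Le 0 1 1 (H.io (g z)) := by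
  have := H.isDomain
  obtain ⟨c, c0, hc, hgx⟩ := H.lin_x hg hX
  obtain ⟨D, hx, hz, hy⟩ := H.exists_Dx
  obtain ⟨θ, hθ⟩ := hg.symm
  have key : ∀ (c : ℂ) (b : B), g (D (g.symm (c • b))) = c • g (D (g.symm b)) := by
    intro c b
    rw [Algebra.smul_def, map_mul, hθ, ← Algebra.smul_def, D.map_smul, Algebra.smul_def, map_mul, ← hθ,
      RingEquiv.apply_symm_apply, ← Algebra.smul_def]
  let D' : Derivation ℂ B B := Derivation.mk'
    { toFun := fun b => g (D (g.symm b))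
      map_add' := by intro a b; simp
      map_smul' := key } (by
    intro a b
    simp)
  have hD' : ∀ b, D' b = g (D (g.symm b)) := fun b => rfl
  have h1 : D' x = 0 := by
    have h2 : D' (g x) = 0 := by rw [hD']; simp [hx]
    rw [hgx, map_add, Derivation.map_algebraMap, add_zero, Derivation.map_smul] at h2
    exact (smul_eq_zero.1 h2).resolve_left hc
  have h2 : D' (g z) = g x := by rw [hD']; simp [hz]
  have h3 := H.der_ext (D := D') (E := DR 0 (H.io (D' z) * mo (-1) (-1)))
    (by rw [h1, H.io_x, DR_mo]; simp) (by
      rw [H.io_z, DR_mo]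
      simp only [Int.cast_one, one_smul, zero_add, mul_assoc, mo_mul]
      simp [mo_zero]) (g z)
  rw [h2, DR_apply, zero_mul, zero_add] at h3
  have hgx0 : H.io (g x) ≠ 0 := H.io_ne (by simp [H.x_ne])
  rw [h3] at hgx0
  have hE := right_ne_zero_of_mul hgx0
  have hDz := left_ne_zero_of_mul (left_ne_zero_of_mul hgx0)
  obtain ⟨w, hw⟩ := HD_exists 0 1 hE
  obtain ⟨w', hw'⟩ := HD_exists 0 1 hDz
  have h4 := (hw'.mul (HD_mo 0 1 (-1) (-1))).mul hw
  rw [← h3] at h4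
  have h5 := h4.le hX
  have h6 : 0 ≤ w' := by
    by_contra h
    apply hDz
    ext m
    by_contra hm
    have h7 := hw'.1 m hm
    have h8 := H.v_nonneg _ m hm
    simp only [wt] at h7 h8
    omega
  intro m hm
  simp only [wt]
  by_contra hlt
  have h7 : (Eu χ2 (H.io (g z))).coeff m ≠ 0 := by
    rw [Eu_apply, EuLin_coeff]
    refine mul_ne_zero ?_ hm
    change (m.2 : ℂ) ≠ 0
    have : m.2 ≠ 0 := by omega
    exact_mod_cast this
  have h8 := hw.1 m h7
  simp only [wt] at h8
  omega

lemma of_Le011 (H : Dan d p x y z) {f : B} (hf : Le 0 1 1 (H.io f)) :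
    ∃ F G : Polynomial ℂ, f = aeval x F * z + aeval x G := by
  refine H.induct (by norm_num) hf (P := fun f => ∃ F G : Polynomial ℂ, f = aeval x F * z + aeval x G)
    ⟨0, 0, by simp⟩ ?_ ?_ ?_
  · rintro _ _ ⟨F, G, rfl⟩ ⟨F', G', rfl⟩; exact ⟨F + F', G + G', by simp; ring⟩
  · rintro c _ ⟨F, G, rfl⟩; exact ⟨c • F, c • G, by simp⟩
  · intro s t j _ h
    have h1 : (d : ℤ) * t + j ≤ 1 := by linarith
    have h2 : d * t + j ≤ 1 := by exact_mod_cast h1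
    have hd := H.hd
    have h5 : t = 0 := by
      by_contra h
      have : 1 ≤ t := by omega
      nlinarith
    subst h5
    have h3 : j = 0 ∨ j = 1 := by omega
    rcases h3 with rfl | rfl
    · exact ⟨0, X ^ s, by simp⟩
    · exact ⟨X ^ s, 0, by simp⟩

lemma base (H : Dan d p x y z) {g : B ≃+* B} {θ : ℂ ≃+* ℂ}
    (hθ : ∀ c, g (algebraMap ℂ B c) = algebraMap ℂ B (θ c)) (hpθ : p.map (θ : ℂ →+* ℂ) = p)
    (hX : Le 0 1 0 (H.io (g x))) :
    ∃ (c a : ℂ) (h : Polynomial ℂ), c ≠ 0 ∧ a ≠ 0 ∧ g x = c • x ∧ g z = a • z + x * aeval x h ∧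
      p.comp (C a * X) = C (a ^ d) * p := by
  have := H.isDomain
  have hg : SL g := ⟨θ, hθ⟩
  obtain ⟨c, c0, hc, hgx⟩ := H.lin_x hg hX
  obtain ⟨F, G, hgz⟩ := H.of_Le011 (H.vdeg_z hg hX)
  -- inverse
  obtain ⟨θ', hθ'⟩ := hg.symm
  have hX' : Le 0 1 0 (H.io (g.symm x)) := by
    have : g.symm x = (θ' c)⁻¹ • (x - algebraMap ℂ B (θ' c0)) := by
      have h1 := congrArg g.symm hgx
      rw [Algebra.smul_def, map_add, map_mul, hθ', hθ'] at h1
      simp only [RingEquiv.symm_apply_apply] at h1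
      have h1' : x - algebraMap ℂ B (θ' c0) = θ' c • g.symm x := by
        rw [Algebra.smul_def]; linear_combination h1
      rw [h1', smul_smul, inv_mul_cancel₀ (by simpa using hc), one_smul]
    rw [this, map_smul, map_sub, H.io_x, sub_eq_add_neg, AlgHom.commutes, Algebra.algebraMap_eq_smul_one]
    exact (((Le_mo (by simp)).add ((Le_one 0 1).smul _).neg)).smul _
  obtain ⟨F', G', hgz'⟩ := H.of_Le011 (H.vdeg_z hg.symm hX')
  obtain ⟨D, hx, hz, hy⟩ := H.exists_Dx
  have hDp : ∀ Q : Polynomial ℂ, D (aeval x Q) = 0 := by intro Q; rw [Derivation.map_aeval, hx, smul_zero]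
  have hgx' : g x = aeval x (C c * X + C c0) := by rw [hgx]; simp [Algebra.smul_def]
  have h1 : aeval x ((F'.map (θ : ℂ →+* ℂ)).comp (C c * X + C c0) * F) = 1 := by
    have h2 := congrArg g hgz'
    rw [RingEquiv.apply_symm_apply, map_add, map_mul, SL_aeval hθ, SL_aeval hθ, hgz, hgx', ← aeval_comp, ← aeval_comp] at h2
    have h3 := congrArg D h2
    simp only [map_add, Derivation.leibniz, hDp, hz, smul_eq_mul, mul_zero, add_zero] at h3
    apply mul_right_cancel₀ H.x_ne
    rw [map_mul, one_mul]
    rw [mul_assoc]; exact h3.symm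
  have h2 : (F'.map (θ : ℂ →+* ℂ)).comp (C c * X + C c0) * F = 1 := by
    rw [← sub_eq_zero]; apply H.aeval_x_inj; rw [map_sub, h1, map_one, sub_self]
  have hFu : IsUnit F := IsUnit.of_mul_eq_one_right _ h2
  obtain ⟨a, hau, rfl⟩ := Polynomial.isUnit_iff.1 hFu
  have ha : a ≠ 0 := hau.ne_zero
  rw [aeval_C, ← Algebra.smul_def] at hgz
  have hrel : (c • x + algebraMap ℂ B c0) * g y = aeval (a • z + aeval x G) p := by
    rw [← hgx, ← hgz, ← map_mul, H.rel, SL_aeval hθ, hpθ]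
  have hc0 : c0 = 0 := by
    by_contra hc0
    set x0 := - c0 / c with hx0
    have hx00 : x0 ≠ 0 := div_ne_zero (neg_ne_zero.2 hc0) hc
    obtain ⟨f, hf1, hf2, hf3⟩ := H.lift_alg (X := C x0) (Y := C x0⁻¹ * p) (Z := (X : Polynomial ℂ)) (by
      rw [← mul_assoc, ← C_mul, mul_inv_cancel₀ hx00]; simp)
    have h3 := congrArg f hrel
    rw [map_mul, map_add, map_smul, hf1, AlgHom.commutes, ← aeval_algHom_apply, map_add, map_smul, hf3,
      ← aeval_algHom_apply, hf1] at h3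
    have h4 : c • C x0 + algebraMap ℂ (Polynomial ℂ) c0 = 0 := by
      rw [← C_eq_algebraMap, smul_C, ← C_add, hx0, smul_eq_mul, mul_div_cancel₀ _ hc]; simp
    rw [h4, zero_mul] at h3
    have h5 : aeval (C x0) G = C (G.eval x0) := by
      rw [C_eq_algebraMap, aeval_algebraMap_apply]; simp
    rw [h5] at h3
    have h6 : aeval (a • X + C (G.eval x0)) p = p.comp (C a * X + C (G.eval x0)) := by
      rw [smul_eq_C_mul]; rfl
    rw [h6] at h3
    have h7 := congrArg natDegree h3
    rw [natDegree_comp, natDegree_linear ha, natDegree_zero, H.deg] at h7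
    have := H.dpos
    omega
  subst hc0
  rw [map_zero, add_zero] at hgx hrel
  have hroot : aeval (AdjoinRoot.root p) p = 0 := by rw [aeval_def]; exact AdjoinRoot.eval₂_root p
  obtain ⟨f, hf1, hf2, hf3⟩ := H.lift_alg (X := 0) (Y := 0) (Z := AdjoinRoot.root p) (by rw [hroot, zero_mul])
  have h3 := congrArg f hrel
  rw [map_mul, map_smul, hf1, smul_zero, zero_mul, ← aeval_algHom_apply, map_add, map_smul, hf3,
    ← aeval_algHom_apply, hf1] at h3
  have h4 : aeval (0 : AdjoinRoot p) G = algebraMap ℂ _ (G.coeff 0) := by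
    rw [← map_zero (algebraMap ℂ (AdjoinRoot p)), aeval_algebraMap_apply, coeff_zero_eq_eval_zero]; simp
  rw [h4] at h3
  have h5 : AdjoinRoot.mk p (p.comp (C a * X + C (G.coeff 0))) = 0 := by
    have e1 : p.comp (C a * X + C (G.coeff 0)) = aeval (C a * X + C (G.coeff 0)) p := rfl
    have e2 : AdjoinRoot.mk p (p.comp (C a * X + C (G.coeff 0))) =
      AdjoinRoot.mkₐ p (aeval (C a * X + C (G.coeff 0)) p) := by rw [e1]; rfl
    rw [e2, ← aeval_algHom_apply, h3]
    congr 1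
    simp [Algebra.smul_def]
  obtain ⟨h6, h7⟩ := nextCoeff_comp (by have := H.hd; omega) H.monic H.deg H.red ha (AdjoinRoot.mk_eq_zero.1 h5)
  refine ⟨c, a, G.divX, hc, ha, hgx, ?_, h7⟩
  have h8 := Polynomial.divX_mul_X_add G
  rw [hgz]
  conv_lhs => rw [← h8, h6]
  simp [mul_comm]

end Dan
end
end RF

namespace RF
open Polynomial

noncomputable section

variable {d : ℕ} {p : Polynomial ℂ} {B : Type} [CommRing B] [Algebra ℂ B] {x y z : B}

/-- semilinear, fixing p -/
def SP (p : Polynomial ℂ) (g : B ≃+* B) : Prop :=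
  ∃ θ : ℂ ≃+* ℂ, (∀ c, g (algebraMap ℂ B c) = algebraMap ℂ B (θ c)) ∧ p.map (θ : ℂ →+* ℂ) = p

lemma SP.SL {g : B ≃+* B} (h : SP p g) : SL g := ⟨_, h.choose_spec.1⟩

lemma SP.trans {g g' : B ≃+* B} (hg : SP p g) (hg' : SP p g') : SP p (g.trans g') := by
  obtain ⟨θ, h, hp⟩ := hg
  obtain ⟨θ', h', hp'⟩ := hg'
  refine ⟨θ.trans θ', fun c => ?_, ?_⟩
  · simp [h, h']
  · have : ((θ.trans θ' : ℂ ≃+* ℂ) : ℂ →+* ℂ) = (θ' : ℂ →+* ℂ).comp (θ : ℂ →+* ℂ) := rfl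
    rw [this, ← Polynomial.map_map, hp, hp']

lemma SP_alg (p : Polynomial ℂ) (f : B ≃ₐ[ℂ] B) : SP p (f : B ≃+* B) :=
  ⟨RingEquiv.refl ℂ, fun c => by simp, by
    have : ((RingEquiv.refl ℂ : ℂ ≃+* ℂ) : ℂ →+* ℂ) = RingHom.id ℂ := rfl
    rw [this, Polynomial.map_id]⟩

namespace Dan

lemma map (H : Dan d p x y z) (f : B ≃ₐ[ℂ] B) : Dan d p (f x) (f y) (f z) where
  hd := H.hd
  monic := H.monic
  deg := H.deg
  red := H.red
  real := H.real
  rel := by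
    rw [← map_mul, H.rel]
    exact (aeval_algHom_apply (f : B →ₐ[ℂ] B) z p).symm
  gen := by
    have h := congrArg (Subalgebra.map (f : B →ₐ[ℂ] B)) H.gen
    rw [AlgHom.map_adjoin] at h
    rw [Algebra.map_top] at h
    have h2 : (f : B →ₐ[ℂ] B).range = ⊤ := by
      rw [AlgHom.range_eq_top]; exact f.surjective
    rw [h2] at h
    rw [← h, Set.image_insert_eq, Set.image_insert_eq, Set.image_singleton]
    rfl
  lift k X Y Z h := by
    obtain ⟨g, h1, h2, h3, h4⟩ := H.lift k X Y Z h
    refine ⟨g.comp (f.symm : B ≃+* B).toRingHom, fun c => ?_, ?_, ?_, ?_⟩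
    · simpa using h1 c
    · simpa using h2
    · simpa using h3
    · simpa using h4

lemma io_map (H : Dan d p x y z) (f : B ≃ₐ[ℂ] B) (b : B) : (H.map f).io (f b) = H.io b := by
  have h := H.hom_ext (C := LR) (f := ((H.map f).io : B →+* LR).comp (f : B →+* B)) (g := (H.io : B →+* LR))
    (by intro c; simp) (by
      change (H.map f).io (f x) = H.io x
      rw [io_x, io_x]) (by
      change (H.map f).io (f z) = H.io z
      rw [io_z, io_z]) (by
      change (H.map f).io (f x) ≠ 0
      rw [io_x]; exact mo_ne_zero _ _)
  exact congrArg (fun k : B →+* LR => k b) h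

lemma equiv (H : Dan d p x y z) {x' y' z' : B} (H' : Dan d p x' y' z') :
    ∃ f : B ≃ₐ[ℂ] B, f x = x' ∧ f y = y' ∧ f z = z' := by
  obtain ⟨f, hx, hy, hz⟩ := H.lift_alg H'.rel
  obtain ⟨g, hx', hy', hz'⟩ := H'.lift_alg H.rel
  refine ⟨AlgEquiv.ofAlgHom f g ?_ ?_, hx, hy, hz⟩
  · apply H'.ext_alg
    · simp [hx', hx]
    · simp [hz', hz]
    · simp [hx', hx, H'.x_ne]
  · apply H.ext_alg
    · simp [hx', hx]
    · simp [hz', hz]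
    · simp [hx', hx, H.x_ne]

lemma deg_ex (H : Dan d p x y z) {g : B ≃+* B} (hg : SL g) : ∃ k : ℕ, 0 < k ∧ HD 1 1 (d * k) (H.io (g x)) := by
  obtain ⟨k, hk, h | h⟩ := H.top11 hg
  · exact ⟨k, hk, h.HD⟩
  · exact ⟨k, hk, H.HD_swap_iff.1 h.HD⟩

lemma deg_ey (H : Dan d p x y z) {g : B ≃+* B} (hg : SL g) : ∃ k : ℕ, 0 < k ∧ HD 1 1 (d * k) (H.io (g y)) := by
  obtain ⟨k, hk, h⟩ := H.swap.deg_ex hg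
  exact ⟨k, hk, H.HD_swap_iff.1 h⟩

lemma SP_rel (H : Dan d p x y z) {g : B ≃+* B} (hg : SP p g) : g x * g y = aeval (g z) p := by
  obtain ⟨θ, hθ, hp⟩ := hg
  rw [← map_mul, H.rel, SL_aeval hθ, hp]

lemma deg_z (H : Dan d p x y z) {g : B ≃+* B} (hg : SP p g) {k l : ℕ} (hk : HD 1 1 (d * k) (H.io (g x)))
    (hl : HD 1 1 (d * l) (H.io (g y))) : HD 1 1 (k + l) (H.io (g z)) := by
  have := H.isDomain
  have hz0 : g z ≠ 0 := by
    intro h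
    have : z = 0 := (map_eq_zero_iff g g.injective).1 h
    apply H.z_ne_const 0; rw [this, map_zero]
  obtain ⟨w, hw⟩ := HD_exists 1 1 (H.io_ne hz0)
  have hw0 : 0 < w := by
    by_contra h
    obtain ⟨c, hc⟩ := H.of_Le0 (by omega) hw.1
    obtain ⟨c', hc'⟩ := SL_const hg.SL hc
    exact H.z_ne_const c' hc'
  have h1 := HD_aeval hw0 hw H.monic.ne_zero
  rw [aeval_algHom_apply, ← H.SP_rel hg, map_mul, H.deg] at h1
  have h2 := h1.unique (hk.mul hl)
  have hd0 : (d : ℤ) ≠ 0 := by exact_mod_cast H.dpos.ne'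
  have h3 : w = k + l := by apply mul_left_cancel₀ hd0; rw [h2]; ring
  rw [← h3]; exact hw

lemma Le_g (H : Dan d p x y z) {g : B ≃+* B} (hg : SP p g) {k l : ℕ} (hk : HD 1 1 (d * k) (H.io (g x)))
    (hl : HD 1 1 (d * l) (H.io (g y))) (hkl : k ≤ l) {N : ℤ} {f : B} (hf : Le 1 1 N (H.io f)) :
    Le 1 1 (l * N) (H.io (g f)) := by
  have hz := H.deg_z hg hk hl
  obtain ⟨θ, hθ, hp⟩ := hg
  refine H.induct (by norm_num) hf (P := fun f => Le 1 1 (l * N) (H.io (g f))) ?_ ?_ ?_ ?_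
  · rw [map_zero, map_zero]; exact Le_zero _ _ _
  · intro f g h1 h2; rw [map_add, map_add]; exact h1.add h2
  · intro c f h
    rw [Algebra.smul_def, map_mul, hθ, ← Algebra.smul_def, map_smul]; exact h.smul _
  · intro s t j _ h
    simp only [map_mul, map_pow]
    refine (((hk.pow s).1.mul (hl.pow t).1).mul (hz.pow j).1).mono ?_
    have h1 : (l : ℤ) * (1 * (d * s + j) + 1 * (d * t + j)) ≤ l * N := mul_le_mul_of_nonneg_left h (by positivity)
    refine le_trans ?_ h1
    have h2 : (k : ℤ) ≤ l := by exact_mod_cast hkl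
    have h3 : (0 : ℤ) ≤ s * d := by positivity
    have h4 : (0 : ℤ) ≤ j := by positivity
    nlinarith [mul_le_mul_of_nonneg_left h2 h3, mul_le_mul_of_nonneg_left h2 h4]

lemma degcomp (H : Dan d p x y z) {g : B ≃+* B} (hg : SP p g) {k l : ℕ} (hk : HD 1 1 (d * k) (H.io (g x)))
    (hl : HD 1 1 (d * l) (H.io (g y))) (hkl : k ≤ l) (hl0 : 0 < l) {r : ℕ} {f : B} (hf : H.swap.TX r f) :
    HD 1 1 (d * (l * r)) (H.io (g f)) := by
  obtain ⟨c, hc, hf⟩ := hf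
  rw [H.Le_swap_iff] at hf
  have h1 := H.Le_g hg hk hl hkl hf
  obtain ⟨θ, hθ, hp⟩ := hg
  have e : g f = θ c • g y ^ r + g (f - c • y ^ r) := by
    have : f = c • y ^ r + (f - c • y ^ r) := by ring
    conv_lhs => rw [this, map_add]
    rw [Algebra.smul_def, map_mul, hθ, ← Algebra.smul_def, map_pow]
  rw [e, map_add, map_smul, map_pow]
  have h2 := (hl.pow r).smul (c := θ c) (by simpa using hc)
  have e2 : (r * (d * l) : ℤ) = d * (l * r) := by ring
  rw [e2] at h2
  refine h2.add_lt h1 ?_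
  have : (0 : ℤ) < l := by exact_mod_cast hl0
  nlinarith

/-- combined version with degree equal to that of x -/
lemma degcomp1 (H : Dan d p x y z) {g : B ≃+* B} (hg : SP p g) {k l : ℕ} (hk : HD 1 1 (d * k) (H.io (g x)))
    (hl : HD 1 1 (d * l) (H.io (g y))) (hkl : k ≤ l) (hl0 : 0 < l) {r : ℕ} {f : B} (hf : H.swap.TX r f)
    (h : g f = x) : l = 1 ∧ r = 1 := by
  have h1 := H.degcomp hg hk hl hkl hl0 hf
  rw [h] at h1
  have h2 := h1.unique H.HD_x
  have h3 : d * (l * r) = d * 1 := by rw [mul_one]; exact_mod_cast h2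
  have h4 := Nat.eq_of_mul_eq_mul_left H.dpos h3
  exact ⟨Nat.eq_one_of_mul_eq_one_right h4, Nat.eq_one_of_mul_eq_one_left h4⟩

lemma TX_Le01 (H : Dan d p x y z) {g : B ≃+* B} (hg : SL g) (hT : H.TX 1 (g x)) : Le 0 1 0 (H.io (g x)) := by
  by_contra hn
  obtain ⟨e, ρ, h⟩ := H.reduce hg one_pos hT hn
  have h1 := (h ρ).2 rfl
  obtain ⟨k, hk, h2⟩ := H.deg_ex (g := g.trans (H.te e ρ : B ≃+* B)) (hg.trans (SP_alg p _).SL)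
  have h3 := h2.le h1
  have : (1 : ℤ) ≤ k := by exact_mod_cast hk
  have hd : (0 : ℤ) < d := by exact_mod_cast H.dpos
  push_cast at h3
  nlinarith

lemma diag (H : Dan d p x y z) {g : B ≃+* B} (hg : SP p g) (hT : H.TX 1 (g x))
    (hl : HD 1 1 (d * (1 : ℕ)) (H.io (g y))) :
    ∃ c a : ℂ, c ≠ 0 ∧ a ≠ 0 ∧ g x = c • x ∧ g y = (a ^ d / c) • y ∧ g z = a • z ∧
      p.comp (C a * X) = C (a ^ d) * p := by
  have := H.isDomain
  have hz := H.deg_z hg hT.HD hl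
  have hrel := H.SP_rel hg
  have h01 := H.TX_Le01 hg.SL hT
  obtain ⟨θ, hθ, hp⟩ := hg
  obtain ⟨c, a, h, hc, ha, hgx, hgz, hpa⟩ := H.base hθ hp h01
  have hh : h = 0 := by
    by_contra hh
    have h1 := H.HD_x.mul (H.HD_Fx hh)
    have h2 : HD 1 1 (d + h.natDegree * d) (H.io (x * aeval x h + a • z)) := by
      rw [map_add, map_mul]
      refine h1.add_lt (n' := 2) ?_ ?_
      · rw [map_smul, H.io_z]; exact (Le_mo (by norm_num)).smul _
      · have : (3 : ℤ) ≤ d := by exact_mod_cast H.hd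
        have : (0 : ℤ) ≤ h.natDegree * d := by positivity
        linarith
    rw [add_comm (x * _), ← hgz] at h2
    have h3 := h2.unique hz
    have : (3 : ℤ) ≤ d := by exact_mod_cast H.hd
    have : (0 : ℤ) ≤ h.natDegree * d := by positivity
    push_cast at h3
    linarith
  subst hh
  rw [map_zero, mul_zero, add_zero] at hgz
  refine ⟨c, a, hc, ha, hgx, ?_, hgz, hpa⟩
  have h1 : aeval (a • z) p = (a ^ d) • (x * y) := by
    have h2 := congrArg (aeval z) hpa
    rw [aeval_comp, map_mul, map_mul, aeval_C, aeval_C, aeval_X, ← Algebra.smul_def, ← Algebra.smul_def, ← H.rel] at h2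
    exact h2
  rw [hgz, h1, hgx] at hrel
  apply mul_left_cancel₀ H.x_ne
  have h2 : c • (x * g y) = c • (x * ((a ^ d / c) • y)) := by
    rw [← smul_mul_assoc, hrel, mul_smul_comm, smul_smul, mul_div_cancel₀ _ hc]
  exact smul_right_injective B hc h2

end Dan
end
end RF

namespace RF
open Polynomial

noncomputable section

variable {d : ℕ} {p : Polynomial ℂ} {B : Type} [CommRing B] [Algebra ℂ B] {x y z : B}

def CJ (g : B ≃+* B) : Prop := ∀ c, g (algebraMap ℂ B c) = algebraMap ℂ B (starRingEnd ℂ c)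

lemma CJ.smul {g : B ≃+* B} (h : CJ g) (c : ℂ) (b : B) : g (c • b) = starRingEnd ℂ c • g b := by
  rw [Algebra.smul_def, map_mul, h, ← Algebra.smul_def]

namespace Dan

lemma CJ_SP (H : Dan d p x y z) {g : B ≃+* B} (h : CJ g) : SP p g := by
  refine ⟨(starRingAut : ℂ ≃+* ℂ), h, H.real⟩

lemma swapE (H : Dan d p x y z) : ∃ s : B ≃ₐ[ℂ] B, s x = y ∧ s y = x ∧ s z = z ∧ (∀ b, s (s b) = b) ∧
    (∀ b, H.swap.io (s b) = H.io b) := by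
  obtain ⟨s, h1, h2, h3⟩ := H.equiv H.swap
  refine ⟨s, h1, h2, h3, ?_, ?_⟩
  · intro b
    have : ((s : B →ₐ[ℂ] B).comp (s : B →ₐ[ℂ] B)) = AlgHom.id ℂ B := by
      apply H.ext_alg
      · simp [h1, h2]
      · simp [h3]
      · simp [h1, h2, H.x_ne]
    exact congrArg (fun k : B →ₐ[ℂ] B => k b) this
  · intro b
    have h := H.io_map s b
    have key : ∀ {x' y' z' : B} (hx : x' = y) (hy : y' = x) (hz : z' = z) (H' : Dan d p x' y' z') (b : B),
        H'.io b = H.swap.io b := by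
      rintro _ _ _ rfl rfl rfl H' b; rfl
    rw [← h, key h1 h2 h3]

lemma rel_a (H : Dan d p x y z) {a : ℂ} (hpa : p.comp (C a * X) = C (a ^ d) * p) :
    aeval (a • z) p = (a ^ d) • (x * y) := by
  have h2 := congrArg (aeval z) hpa
  rw [aeval_comp, map_mul, map_mul, aeval_C, aeval_C, aeval_X, ← Algebra.smul_def, ← Algebra.smul_def, ← H.rel] at h2
  exact h2

/-- nonswap -/
lemma gy_of (H : Dan d p x y z) {g : B ≃+* B} (hg : SP p g) {a c : ℂ} (hc : c ≠ 0) (hx : g x = c • x)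
    (hz : g z = a • z) (hpa : p.comp (C a * X) = C (a ^ d) * p) : g y = (a ^ d / c) • y := by
  have := H.isDomain
  have hrel := H.SP_rel hg
  rw [hz, H.rel_a hpa, hx] at hrel
  apply mul_left_cancel₀ H.x_ne
  have h2 : c • (x * g y) = c • (x * ((a ^ d / c) • y)) := by
    rw [← smul_mul_assoc, hrel, mul_smul_comm, smul_smul, mul_div_cancel₀ _ hc]
  exact smul_right_injective B hc h2

/-- swap version of `diag`. -/
lemma diag_swap (H : Dan d p x y z) {g : B ≃+* B} (hg : SP p g) (hT : H.swap.TX 1 (g x))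
    (hl : HD 1 1 (d * (1 : ℕ)) (H.io (g y))) :
    ∃ c a : ℂ, c ≠ 0 ∧ a ≠ 0 ∧ g x = c • y ∧ g y = (a ^ d / c) • x ∧ g z = a • z ∧
      p.comp (C a * X) = C (a ^ d) * p := by
  obtain ⟨s, h1, h2, h3, hss, hio⟩ := H.swapE
  have hT' : H.TX 1 (s (g x)) := by
    obtain ⟨c, hc, h⟩ := hT
    refine ⟨c, hc, ?_⟩
    rw [← hio, map_sub, hss, map_smul, map_pow, h1]
    exact h
  obtain ⟨c, a, hc, ha, e1, e2, e3, e4⟩ := H.diag (g := g.trans (s : B ≃+* B)) (hg.trans (SP_alg p s)) hT' (by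
    rw [← H.HD_swap_iff] at hl
    have := hio (s (g y))
    rw [hss] at this
    change HD 1 1 _ (H.io (s (g y)))
    rw [← this]; exact hl)
  refine ⟨c, a, hc, ha, ?_, ?_, ?_, e4⟩
  · have := congrArg s e1
    change s (s (g x)) = _ at this
    rw [hss, map_smul, h1] at this; exact this
  · have := congrArg s e2
    change s (s (g y)) = _ at this
    rw [hss, map_smul, h2] at this; exact this
  · have := congrArg s e3
    change s (s (g z)) = _ at this
    rw [hss, map_smul, h3] at this; exact this

/-- comparing z-coefficients -/
lemma z_coeff (H : Dan d p x y z) {a b : ℂ} {F G : Polynomial ℂ} (h : a • z + aeval x F = b • z + aeval x G) :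
    a = b ∧ F = G := by
  have := H.isDomain
  obtain ⟨D, hx, hz, hy⟩ := H.exists_Dx
  have hDp : ∀ Q : Polynomial ℂ, D (aeval x Q) = 0 := by intro Q; rw [Derivation.map_aeval, hx, smul_zero]
  have h1 := congrArg D h
  simp only [map_add, Derivation.map_smul, hDp, hz, add_zero] at h1
  have hab : a = b := smul_left_injective ℂ H.x_ne h1
  refine ⟨hab, ?_⟩
  subst hab
  rw [← sub_eq_zero]
  apply H.aeval_x_inj
  rw [map_sub, sub_eq_zero]
  exact add_left_cancel h

def NS (σ : B ≃+* B) (x y z : B) (ω : ℂ) : Prop :=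
  (∃ c : ℂ, c ≠ 0 ∧ σ x = c • x) ∧ (∃ c : ℂ, c ≠ 0 ∧ σ y = c • y) ∧ σ z = ω • z

def SW (σ : B ≃+* B) (x y z : B) (c1 c2 ω : ℂ) : Prop :=
  c1 ≠ 0 ∧ c2 ≠ 0 ∧ σ x = c1 • y ∧ σ y = c2 • x ∧ σ z = ω • z

lemma exh_tri (H : Dan d p x y z) {σ : B ≃+* B} (hσ : CJ σ) (hinv : ∀ b, σ (σ b) = b)
    (hX : Le 0 1 0 (H.io (σ x))) :
    ∃ (x' y' z' : B) (ω : ℂ), Dan d p x' y' z' ∧ NS σ x' y' z' ω ∧ ω ≠ 0 ∧ p.comp (C ω * X) = C (ω ^ d) * p := by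
  have hSP := H.CJ_SP hσ
  obtain ⟨θ, hθ, hp⟩ := H.CJ_SP hσ
  have hθ' : ∀ c, θ c = starRingEnd ℂ c := by
    intro c; apply H.inj_C; rw [← hθ, hσ]
  obtain ⟨c, a, h, hc, ha, hx, hz, hpa⟩ := H.base hθ hp hX
  have hu : σ (x * aeval x h) = aeval x ((C c * X) * (h.map (θ : ℂ →+* ℂ)).comp (C c * X)) := by
    rw [map_mul, SL_aeval hθ, hx, map_mul, aeval_comp]
    simp [Algebra.smul_def]
  have h1 := hinv z
  rw [hz, map_add, hσ.smul, hz, smul_add, smul_smul, hu] at h1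
  have e1 : x * aeval x h = aeval x (X * h) := by simp
  set Q := (C c * X) * (h.map (θ : ℂ →+* ℂ)).comp (C c * X) with hQ
  set ca := starRingEnd ℂ a
  have h2 : (ca * a) • z + aeval x (ca • (X * h) + Q) = (1 : ℂ) • z + aeval x (0 : Polynomial ℂ) := by
    rw [map_zero, add_zero, one_smul, map_add, map_smul, ← e1, ← add_assoc]; exact h1
  obtain ⟨h3, h4⟩ := H.z_coeff h2
  have h5 : Q = - (ca • (X * h)) := by linear_combination h4
  let t := H.tau (C (1 / (2 * a)) * h)
  have htx : t x = x := H.tau_x _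
  have htz : t z = z + (1 / (2 * a)) • (x * aeval x h) := by
    rw [H.tau_z, map_mul, aeval_C, Algebra.smul_def]; ring
  have hσx : σ (t x) = c • t x := by rw [htx, hx]
  have hσz : σ (t z) = a • t z := by
    have e3 : starRingEnd ℂ (1 / (2 * a)) * ca = 1 / 2 := by
      have : ca ≠ 0 := by simpa [ca] using ha
      simp only [map_div₀, map_one, map_mul, map_ofNat]
      field_simp
      simp [ca, ha]
    rw [htz, map_add, hσ.smul, hu, h5, hz, map_neg, map_smul, ← e1, smul_neg, smul_smul, e3, smul_add, smul_smul,
      show a * (1 / (2 * a)) = 1 / 2 by field_simp]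
    module
  have H' := H.map t
  refine ⟨t x, t y, t z, a, H', ⟨⟨c, hc, hσx⟩, ⟨a ^ d / c, div_ne_zero (pow_ne_zero _ ha) hc, ?_⟩, hσz⟩, ha, hpa⟩
  exact H'.gy_of hSP hc hσx hσz hpa

theorem exh (H0 : Dan d p x y z) {σ : B ≃+* B} (hσ : CJ σ) (hinv : ∀ b, σ (σ b) = b) :
    ∃ (x' y' z' : B) (ω : ℂ), Dan d p x' y' z' ∧ ω ≠ 0 ∧ p.comp (C ω * X) = C (ω ^ d) * p ∧
      (NS σ x' y' z' ω ∨ ∃ c1 c2, SW σ x' y' z' c1 c2 ω) := by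
  classical
  have hSP := H0.CJ_SP hσ
  let P : ℕ → Prop := fun k => 0 < k ∧ ∃ (x y z : B) (H : Dan d p x y z), HD 1 1 (d * k) (H.io (σ x))
  have hP : ∃ k, P k := by
    obtain ⟨k, hk, h⟩ := H0.deg_ex hSP.SL
    exact ⟨k, hk, x, y, z, H0, h⟩
  obtain ⟨hk, x, y, z, H, hH⟩ := Nat.find_spec hP
  set k := Nat.find hP with hkdef
  have hmin : ∀ j, P j → k ≤ j := fun j hj => Nat.find_min' hP hj
  obtain ⟨k', hk', hT⟩ := H.top11 hSP.SL
  have hd0 : (d : ℤ) ≠ 0 := by exact_mod_cast H0.dpos.ne'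
  have hkk : k' = k := by
    have h1 : HD 1 1 (d * k') (H.io (σ x)) := by
      rcases hT with h | h
      · exact h.HD
      · exact H.HD_swap_iff.1 h.HD
    have := mul_left_cancel₀ hd0 (h1.unique hH)
    exact_mod_cast this
  subst hkk
  rcases hT with hT | hT
  · have h01 : Le 0 1 0 (H.io (σ x)) := by
      by_contra hn
      obtain ⟨e, ρ, hr⟩ := H.reduce hSP.SL hk hT hn
      have h1 := (hr ρ).2 rfl
      let t := (H.te e ρ).symm
      have htx : t x = x := by
        rw [AlgEquiv.symm_apply_eq]; exact (H.tau_x _).symm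
      obtain ⟨j, hj, h2⟩ := (H.map t).deg_ex hSP.SL
      have h3 : (H.map t).io (σ (t x)) = H.io (H.te e ρ (σ x)) := by
        have e5 : σ (t x) = t (H.te e ρ (σ x)) := by rw [htx]; simp [t]
        exact (congrArg (H.map t).io e5).trans (H.io_map t _)
      have h4 := hmin j ⟨hj, _, _, _, H.map t, h2⟩
      rw [h3] at h2
      have h5 := h2.le h1
      have h6 : (k : ℤ) ≤ j := by exact_mod_cast h4
      have h7 : (0 : ℤ) ≤ d := by positivity
      nlinarith
    obtain ⟨x', y', z', ω, h1, h2, h3, h4⟩ := H.exh_tri hσ hinv h01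
    exact ⟨x', y', z', ω, h1, h3, h4, Or.inl h2⟩
  · obtain ⟨l, hl, hHl⟩ := H.deg_ey hSP.SL
    have hkl : k ≤ l := hmin l ⟨hl, y, x, z, H.swap, H.HD_swap_iff.2 hHl⟩
    obtain ⟨h1, h2⟩ := H.degcomp1 hSP hH hHl hkl hl hT (hinv x)
    rw [h1] at hHl
    rw [h2] at hT
    obtain ⟨c, a, hc, ha, e1, e2, e3, e4⟩ := H.diag_swap hSP hT hHl
    exact ⟨x, y, z, a, H, ha, e4, Or.inr ⟨c, a ^ d / c, hc, div_ne_zero (pow_ne_zero _ ha) hc, e1, e2, e3⟩⟩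

end Dan
end
end RF

namespace RF
open Polynomial

noncomputable section

variable {d : ℕ} {p : Polynomial ℂ} {B : Type} [CommRing B] [Algebra ℂ B] {x y z : B}

namespace Dan

lemma HD_y (H : Dan d p x y z) : HD 1 1 d (H.io y) := H.HD_swap_iff.1 H.swap.HD_x

lemma NS_Le (H : Dan d p x y z) {σ : B ≃+* B} (hσ : CJ σ) {ω : ℂ} (h : NS σ x y z ω) {N : ℤ} {f : B}
    (hf : Le 1 1 N (H.io f)) : Le 1 1 N (H.io (σ f)) := by
  obtain ⟨⟨c, hc, hx⟩, ⟨c', hc', hy⟩, -⟩ := h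
  have := H.Le_g (k := 1) (l := 1) (H.CJ_SP hσ) (by rw [hx, map_smul]; simpa using H.HD_x.smul hc)
    (by rw [hy, map_smul]; simpa using H.HD_y.smul hc') le_rfl hf
  simpa using this

lemma SW_Le (H : Dan d p x y z) {σ : B ≃+* B} (hσ : CJ σ) {c1 c2 ω : ℂ} (h : SW σ x y z c1 c2 ω) {N : ℤ} {f : B}
    (hf : Le 1 1 N (H.io f)) : Le 1 1 N (H.io (σ f)) := by
  obtain ⟨hc, hc', hx, hy, -⟩ := h
  have := H.Le_g (k := 1) (l := 1) (H.CJ_SP hσ) (by rw [hx, map_smul]; simpa using H.HD_y.smul hc)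
    (by rw [hy, map_smul]; simpa using H.HD_x.smul hc') le_rfl hf
  simpa using this

lemma SW_TX (H : Dan d p x y z) {σ : B ≃+* B} (hσ : CJ σ) {c1 c2 ω : ℂ} (h : SW σ x y z c1 c2 ω) {k : ℕ} {f : B}
    (hf : H.TX k f) : H.swap.TX k (σ f) := by
  obtain ⟨c, hc, hf⟩ := hf
  refine ⟨starRingEnd ℂ c * c1 ^ k, mul_ne_zero (by simpa using hc) (pow_ne_zero _ h.1), ?_⟩
  have h1 := H.SW_Le hσ h hf
  rw [map_sub, hσ.smul, map_pow, h.2.2.1, _root_.smul_pow, smul_smul] at h1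
  exact H.Le_swap_iff.2 h1

lemma SW_swap {σ : B ≃+* B} {c1 c2 ω : ℂ} (h : SW σ x y z c1 c2 ω) : SW σ y x z c2 c1 ω :=
  ⟨h.2.1, h.1, h.2.2.2.1, h.2.2.1, h.2.2.2.2⟩

lemma TX_not_both (H : Dan d p x y z) {k : ℕ} (hk : 0 < k) {f : B} (h1 : H.TX k f) (h2 : H.swap.TX k f) : False := by
  obtain ⟨a, ha, h1⟩ := h1
  obtain ⟨b, hb, h2⟩ := h2
  rw [H.Le_swap_iff] at h2
  have h3 := h1.add h2.neg
  rw [← map_neg, ← map_add] at h3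
  have e : f - a • x ^ k + -(f - b • y ^ k) = b • (x ^ 0 * y ^ k * z ^ 0) - a • (x ^ k * y ^ 0 * z ^ 0) := by
    simp
  rw [e] at h3
  have h4 := comp_of_lt h3 (show (d * k - 1 : ℤ) < d * k by linarith)
  have hx := (H.be_top (a := 1) (b := 1) (by norm_num) k 0 0).2
  have hy := (H.be_top (a := 1) (b := 1) (by norm_num) 0 k 0).2
  simp only [Nat.cast_zero, mul_zero, add_zero, zero_add, one_mul] at hx hy
  rw [map_sub, map_sub, map_smul, map_smul, map_smul, map_smul, hx, hy] at h4
  have h5 := congrArg (fun f : LR => f.coeff ((d * k : ℤ), (0 : ℤ))) h4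
  have hdk : (d * k : ℤ) ≠ 0 := by
    have := H.dpos
    positivity
  simp [mo_coeff, hdk.symm, H.dpos.ne', hk.ne'] at h5
  exact ha h5

/-- swap and nonswap triples cannot coexist. -/
theorem not_mixed (H : Dan d p x y z) {σ : B ≃+* B} (hσ : CJ σ) {c1 c2 ω : ℂ} (h : SW σ x y z c1 c2 ω)
    {x' y' z' : B} (H' : Dan d p x' y' z') {ω' : ℂ} (h' : NS σ x' y' z' ω') : False := by
  obtain ⟨g, hgx, hgy, hgz⟩ := H.equiv H'
  obtain ⟨⟨c, hc, hx⟩, -, -⟩ := h'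
  have key : ∀ {x y : B} (H : Dan d p x y z) {c1 c2 : ℂ} (h : SW σ x y z c1 c2 ω) {k : ℕ} (hk : 0 < k),
      ¬ H.TX k x' := by
    intro x y H c1 c2 h k hk hT
    have h2 := H.SW_TX hσ h hT
    rw [hx] at h2
    refine H.TX_not_both hk hT ?_
    obtain ⟨b, hb, h2⟩ := h2
    refine ⟨c⁻¹ * b, mul_ne_zero (inv_ne_zero hc) hb, ?_⟩
    have := h2.smul c⁻¹
    rw [← map_smul, smul_sub, smul_smul, smul_smul, inv_mul_cancel₀ hc, one_smul] at this
    exact this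
  obtain ⟨k, hk, hT⟩ := H.top11 (SP_alg p g).SL
  change H.TX k (g x) ∨ H.swap.TX k (g x) at hT
  rw [hgx] at hT
  rcases hT with hT | hT
  · exact key H h hk hT
  · exact key H.swap (SW_swap h) hk hT

theorem both_swap (H : Dan d p x y z) {σ : B ≃+* B} (hσ : CJ σ) {c1 c2 ω : ℂ} (h : SW σ x y z c1 c2 ω)
    {x' y' z' : B} (H' : Dan d p x' y' z') {c1' c2' ω' : ℂ} (h' : SW σ x' y' z' c1' c2' ω') :
    ∃ a u : ℂ, a ≠ 0 ∧ u ≠ 0 ∧ p.comp (C a * X) = C (a ^ d) * p ∧ starRingEnd ℂ a * ω = ω' * a ∧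
      (starRingEnd ℂ u * u * c1 = c1' * a ^ d ∨ starRingEnd ℂ u * u * c2 = c1' * a ^ d) := by
  have key : ∀ {x y : B} (H : Dan d p x y z) {c1 c2 : ℂ} (h : SW σ x y z c1 c2 ω) {k : ℕ} (hk : 0 < k),
      H.TX k x' → ∃ a u : ℂ, a ≠ 0 ∧ u ≠ 0 ∧ p.comp (C a * X) = C (a ^ d) * p ∧ starRingEnd ℂ a * ω = ω' * a ∧
      starRingEnd ℂ u * u * c1 = c1' * a ^ d := by
    intro x y H c1 c2 h k hk hT
    have := H.isDomain
    obtain ⟨g, hgx, hgy, hgz⟩ := H.equiv H'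
    have hgP := SP_alg p g
    have hTy : H.swap.TX k y' := by
      have h2 := H.SW_TX hσ h hT
      rw [h'.2.2.1] at h2
      obtain ⟨b, hb, h2⟩ := h2
      have hc := h'.1
      refine ⟨c1'⁻¹ * b, mul_ne_zero (inv_ne_zero hc) hb, ?_⟩
      have := h2.smul c1'⁻¹
      rw [← map_smul, smul_sub, smul_smul, smul_smul, inv_mul_cancel₀ hc, one_smul] at this
      exact this
    have hHx : HD 1 1 (d * k) (H.io (g x)) := by rw [hgx]; exact hT.HD
    have hHy : HD 1 1 (d * k) (H.io (g y)) := by rw [hgy]; exact H.HD_swap_iff.1 hTy.HD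
    have hk1 : k = 1 := by
      obtain ⟨r, hr, hTr⟩ := H.top11 (SP_alg p g.symm).SL
      change H.TX r (g.symm x) ∨ H.swap.TX r (g.symm x) at hTr
      rcases hTr with hTr | hTr
      · have h1 := H.swap.degcomp hgP (H.HD_swap_iff.2 hHy) (H.HD_swap_iff.2 hHx) le_rfl hk (r := r)
          (f := g.symm x) hTr
        rw [H.HD_swap_iff] at h1
        have e : (g : B ≃+* B) (g.symm x) = x := g.apply_symm_apply x
        rw [e] at h1
        have h2 := h1.unique H.HD_x
        have h3 : d * (k * r) = d * 1 := by rw [mul_one]; exact_mod_cast h2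
        exact Nat.eq_one_of_mul_eq_one_right (Nat.eq_of_mul_eq_mul_left H.dpos h3)
      · exact (H.degcomp1 hgP hHx hHy le_rfl hk hTr (g.apply_symm_apply x)).1
    subst hk1
    obtain ⟨u, a, hu, ha, e1, e2, e3, e4⟩ := H.diag hgP (by change H.TX 1 (g x); rw [hgx]; exact hT) hHy
    change g x = _ at e1
    change g y = _ at e2
    change g z = _ at e3
    rw [hgx] at e1
    rw [hgy] at e2
    rw [hgz] at e3
    refine ⟨a, u, ha, hu, e4, ?_, ?_⟩
    · have h5 := h'.2.2.2.2
      rw [e3, hσ.smul, h.2.2.2.2, smul_smul, smul_smul] at h5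
      refine smul_left_injective ℂ (m := z) ?_ h5
      intro h0; apply H.z_ne_const 0; rw [h0, map_zero]
    · have h5 := h'.2.2.1
      rw [e1, e2, hσ.smul, h.2.2.1, smul_smul, smul_smul] at h5
      have h6 : starRingEnd ℂ u * c1 = c1' * (a ^ d / u) := smul_left_injective ℂ H.swap.x_ne h5
      rw [mul_right_comm, h6]
      field_simp
  obtain ⟨g, hgx, hgy, hgz⟩ := H.equiv H'
  obtain ⟨k, hk, hT⟩ := H.top11 (SP_alg p g).SL
  change H.TX k (g x) ∨ H.swap.TX k (g x) at hT
  rw [hgx] at hT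
  rcases hT with hT | hT
  · obtain ⟨a, u, h1, h2, h3, h4, h5⟩ := key H h hk hT
    exact ⟨a, u, h1, h2, h3, h4, Or.inl h5⟩
  · obtain ⟨a, u, h1, h2, h3, h4, h5⟩ := key H.swap (SW_swap h) hk hT
    exact ⟨a, u, h1, h2, h3, h4, Or.inr h5⟩

lemma NS_swap {σ : B ≃+* B} {ω : ℂ} (h : NS σ x y z ω) : NS σ y x z ω := ⟨h.2.1, h.1, h.2.2⟩

theorem both_ns (H0 : Dan d p x y z) {σ : B ≃+* B} (hσ : CJ σ) {ω : ℂ} (hω : ω ≠ 0) (h0 : NS σ x y z ω)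
    {x' y' z' : B} (H' : Dan d p x' y' z') {ω' : ℂ} (h' : NS σ x' y' z' ω') :
    ∃ a : ℂ, a ≠ 0 ∧ p.comp (C a * X) = C (a ^ d) * p ∧ starRingEnd ℂ a * ω = ω' * a := by
  classical
  let P : ℕ → Prop := fun k => 0 < k ∧ ∃ (x y z : B) (H : Dan d p x y z), NS σ x y z ω ∧ HD 1 1 (d * k) (H.io x')
  have hP : ∃ k, P k := by
    obtain ⟨g, hgx, hgy, hgz⟩ := H0.equiv H'
    obtain ⟨k, hk, h⟩ := H0.deg_ex (SP_alg p g).SL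
    change HD _ _ _ (H0.io (g x)) at h
    rw [hgx] at h
    exact ⟨k, hk, x, y, z, H0, h0, h⟩
  have hk := (Nat.find_spec hP).1
  have hH := (Nat.find_spec hP).2
  set k := Nat.find hP with hkdef
  have hmin : ∀ j, P j → k ≤ j := fun j hj => Nat.find_min' hP hj
  clear_value k
  have hd0 : (d : ℤ) ≠ 0 := by exact_mod_cast H0.dpos.ne'
  have hex : ∃ (x y z : B) (H : Dan d p x y z), NS σ x y z ω ∧ H.TX k x' := by
    obtain ⟨x, y, z, H, h1, h2⟩ := hH
    obtain ⟨g, hgx, hgy, hgz⟩ := H.equiv H'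
    obtain ⟨k', hk', hT⟩ := H.top11 (SP_alg p g).SL
    change H.TX k' (g x) ∨ H.swap.TX k' (g x) at hT
    rw [hgx] at hT
    have hkk : k' = k := by
      have h1 : HD 1 1 (d * k') (H.io x') := by
        rcases hT with h | h
        · exact h.HD
        · exact H.HD_swap_iff.1 h.HD
      have := mul_left_cancel₀ hd0 (h1.unique h2)
      exact_mod_cast this
    rw [hkk] at hT
    rcases hT with hT | hT
    · exact ⟨x, y, z, H, h1, hT⟩
    · exact ⟨y, x, z, H.swap, NS_swap h1, hT⟩
  clear hH
  obtain ⟨x, y, z, H, hNS, hT⟩ := hex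
  have := H.isDomain
  obtain ⟨g, hgx, hgy, hgz⟩ := H.equiv H'
  have hgP := SP_alg p g
  obtain ⟨⟨c, hc, hx⟩, -, hz⟩ := id hNS
  by_cases h01 : Le 0 1 0 (H.io x')
  · have h01' : Le 0 1 0 (H.io ((g : B ≃+* B) x)) := by change Le 0 1 0 (H.io (g x)); rw [hgx]; exact h01
    obtain ⟨θ, hθ, hp⟩ := hgP
    obtain ⟨u, a, h, hu, ha, e1, e2, e3⟩ := H.base hθ hp h01'
    change g z = _ at e2
    rw [hgz] at e2
    refine ⟨a, ha, e3, ?_⟩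
    have h5 := h'.2.2
    have e6 : x * aeval x h = aeval x (X * h) := by simp
    rw [e6] at e2
    obtain ⟨θ', hθ', hp'⟩ := H.CJ_SP hσ
    rw [e2, map_add, SL_aeval hθ', hσ.smul, hz, smul_smul, smul_add, smul_smul] at h5
    have e7 : aeval (σ x) ((X * h).map (θ' : ℂ →+* ℂ)) = aeval x (((X * h).map (θ' : ℂ →+* ℂ)).comp (C c * X)) := by
      rw [aeval_comp, hx]; simp [Algebra.smul_def]
    rw [e7, ← map_smul] at h5
    exact (H.z_coeff h5).1
  · exfalso
    obtain ⟨e, ρ, hr⟩ := H.reduce (g := (g : B ≃+* B)) hgP.SL hk (by change H.TX k (g x); rw [hgx]; exact hT)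
      (by change ¬ Le 0 1 0 (H.io (g x)); rw [hgx]; exact h01)
    have hr' : ∀ ρ', Le 1 1 (d * k - 1) (H.io (H.te e ρ' x')) ↔ ρ' = ρ := by
      intro ρ'; rw [← hr ρ', ← hgx]; rfl
    have h1 := (hr' ρ).2 rfl
    obtain ⟨⟨c', hc', hx'⟩, -, -⟩ := id h'
    -- conjugate by σ
    set ρ' := starRingEnd ℂ ρ * c ^ (e + 1) * ω⁻¹ with hρ'
    have hcomm : ∀ b, σ (H.te e ρ b) = H.te e ρ' (σ b) := by
      have hh := H.hom_ext (C := B) (f := (σ : B →+* B).comp (H.te e ρ : B →+* B))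
        (g := ((H.te e ρ' : B ≃ₐ[ℂ] B) : B →+* B).comp (σ : B →+* B)) (by
          intro c; simp [hσ c]) (by
          change σ (H.te e ρ x) = H.te e ρ' (σ x)
          rw [te, te, H.tau_x, hx, map_smul, H.tau_x]) (by
          change σ (H.te e ρ z) = H.te e ρ' (σ z)
          rw [H.te_z, hz, map_smul, H.te_z, map_add, hz, hσ.smul, map_pow, hx, smul_add, _root_.smul_pow, smul_smul, smul_smul,
            hρ']
          congr 2
          field_simp) (by
          change σ (H.te e ρ x) ≠ 0
          simp [H.x_ne])
      intro b
      exact congrArg (fun k : B →+* B => k b) hh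
    have h2 := H.NS_Le hσ hNS h1
    rw [hcomm, hx', map_smul] at h2
    have h3 : Le 1 1 (d * k - 1) (H.io (H.te e ρ' x')) := by
      have := h2.smul c'⁻¹
      rw [← map_smul, smul_smul, inv_mul_cancel₀ hc', one_smul] at this
      exact this
    have hρρ := (hr' ρ').1 h3
    let t := (H.te e ρ).symm
    have htx : t x = x := by
      rw [AlgEquiv.symm_apply_eq]; exact (H.tau_x _).symm
    have hcomm' : ∀ b, σ (t b) = t (σ b) := by
      intro b
      rw [AlgEquiv.eq_symm_apply]
      have := hcomm (t b)
      rw [hρρ] at this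
      rw [← this]
      simp [t]
    have hNS' : NS σ (t x) (t y) (t z) ω := by
      obtain ⟨⟨a1, h11, h12⟩, ⟨a2, h21, h22⟩, h3⟩ := hNS
      exact ⟨⟨a1, h11, by rw [hcomm', h12, map_smul]⟩, ⟨a2, h21, by rw [hcomm', h22, map_smul]⟩,
        by rw [hcomm', h3, map_smul]⟩
    obtain ⟨g', hgx', hgy', hgz'⟩ := (H.map t).equiv H'
    obtain ⟨j, hj, h4⟩ := (H.map t).deg_ex (SP_alg p g').SL
    change HD _ _ _ ((H.map t).io (g' (t x))) at h4
    rw [hgx'] at h4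
    have h5 := hmin j ⟨hj, _, _, _, H.map t, hNS', h4⟩
    have h6 : (H.map t).io x' = H.io (H.te e ρ x') := by
      have e5 : x' = t (H.te e ρ x') := by simp [t]
      exact (congrArg (H.map t).io e5).trans (H.io_map t _)
    rw [h6] at h4
    have h7 := h4.le h1
    have h8 : (k : ℤ) ≤ j := by exact_mod_cast h5
    have h9 : (0 : ℤ) ≤ d := by positivity
    nlinarith

end Dan
end
end RF

namespace RF
open Polynomial

noncomputable section

variable {d : ℕ} {p : Polynomial ℂ} {B : Type} [CommRing B] [Algebra ℂ B] {x y z : B}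
  {B' : Type} [CommRing B'] [Algebra ℂ B']

namespace Dan

lemma mapE (H : Dan d p x y z) (f : B ≃ₐ[ℂ] B') : Dan d p (f x) (f y) (f z) where
  hd := H.hd
  monic := H.monic
  deg := H.deg
  red := H.red
  real := H.real
  rel := by
    rw [← map_mul, H.rel]
    exact (aeval_algHom_apply (f : B →ₐ[ℂ] B') z p).symm
  gen := by
    have h := congrArg (Subalgebra.map (f : B →ₐ[ℂ] B')) H.gen
    rw [AlgHom.map_adjoin] at h
    rw [Algebra.map_top] at h
    have h2 : (f : B →ₐ[ℂ] B').range = ⊤ := by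
      rw [AlgHom.range_eq_top]; exact f.surjective
    rw [h2] at h
    rw [← h, Set.image_insert_eq, Set.image_insert_eq, Set.image_singleton]
    rfl
  lift k X Y Z h := by
    obtain ⟨g, h1, h2, h3, h4⟩ := H.lift k X Y Z h
    refine ⟨g.comp (f.symm : B' ≃+* B).toRingHom, fun c => ?_, ?_, ?_, ?_⟩
    · simpa using h1 c
    · simpa using h2
    · simpa using h3
    · simpa using h4

lemma ext_alg' (H : Dan d p x y z) [IsDomain B'] {f g : B →ₐ[ℂ] B'} (hx : f x = g x) (hz : f z = g z)
    (h0 : f x ≠ 0) : f = g := by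
  have := H.hom_ext (f := (f : B →+* B')) (g := (g : B →+* B')) (by intro c; simp) hx hz h0
  ext b
  exact congrArg (fun k : B →+* B' => k b) this

lemma equivE (H : Dan d p x y z) {x' y' z' : B'} (H' : Dan d p x' y' z') :
    ∃ f : B ≃ₐ[ℂ] B', f x = x' ∧ f y = y' ∧ f z = z' := by
  have := H.isDomain
  have := H'.isDomain
  obtain ⟨f, hx, hy, hz⟩ := H.lift_alg H'.rel
  obtain ⟨g, hx', hy', hz'⟩ := H'.lift_alg H.rel
  refine ⟨AlgEquiv.ofAlgHom f g ?_ ?_, hx, hy, hz⟩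
  · apply H'.ext_alg
    · simp [hx', hx]
    · simp [hz', hz]
    · simp [hx', hx, H'.x_ne]
  · apply H.ext_alg
    · simp [hx', hx]
    · simp [hz', hz]
    · simp [hx', hx, H.x_ne]

/-- rescaling x and y -/
lemma scale (H : Dan d p x y z) {γ : ℂ} (hγ : γ ≠ 0) : Dan d p (γ • x) (γ⁻¹ • y) z := by
  obtain ⟨f, h1, h2, h3⟩ := H.lift_alg (X := γ • x) (Y := γ⁻¹ • y) (Z := z) (by
    rw [smul_mul_smul_comm, mul_inv_cancel₀ hγ, one_smul, H.rel])
  obtain ⟨g, h1', h2', h3'⟩ := H.lift_alg (X := γ⁻¹ • x) (Y := γ • y) (Z := z) (by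
    rw [smul_mul_smul_comm, inv_mul_cancel₀ hγ, one_smul, H.rel])
  let e : B ≃ₐ[ℂ] B := AlgEquiv.ofAlgHom f g (by
    apply H.ext_alg
    · simp [h1, h1', smul_smul, hγ]
    · simp [h3, h3']
    · simp [h1, h1', smul_smul, hγ, H.x_ne]) (by
    apply H.ext_alg
    · simp [h1, h1', smul_smul, hγ]
    · simp [h3, h3']
    · simp [h1, h1', smul_smul, hγ, H.x_ne])
  have := H.map e
  rw [show e x = γ • x from h1, show e y = γ⁻¹ • y from h2, show e z = z from h3] at this
  exact this

/-- an equivalence of triples compatible with conjugations -/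
lemma equiv_comm (H : Dan d p x y z) {x' y' z' : B'} (H' : Dan d p x' y' z') {σ : B ≃+* B} {σ' : B' ≃+* B'}
    (hσ : CJ σ) (hσ' : CJ σ') {f : B ≃ₐ[ℂ] B'} 
    (hx : f (σ x) = σ' (f x)) (hz : f (σ z) = σ' (f z)) (b : B) : f (σ b) = σ' (f b) := by
  have := H.isDomain
  have := H'.isDomain
  have h := H.hom_ext (C := B') (f := (f : B →+* B').comp (σ : B →+* B))
    (g := (σ' : B' →+* B').comp (f : B →+* B')) (by intro c; simp [hσ c, hσ' c]) hx hz (by simp [H.x_ne])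
  exact congrArg (fun k : B →+* B' => k b) h

end Dan

/-- symmetry group -/
lemma sym_pow {p : Polynomial ℝ} {d m n : ℕ} {q : Polynomial ℝ} (hdeg : p.natDegree = d) (hn : 1 ≤ n)
    (hqmonic : q.Monic) (hqdeg : 1 ≤ q.natDegree) (hq0 : q.eval 0 ≠ 0)
    (hpq : p = X ^ m * q.comp (X ^ n))
    (hmax : ∀ (m' n' : ℕ) (q' : Polynomial ℝ), 1 ≤ n' → q'.eval 0 ≠ 0 →
      p = X ^ m' * q'.comp (X ^ n') → n' ≤ n) {ω : ℂ} (hω : ω ≠ 0)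
    (h : (p.map (algebraMap ℝ ℂ)).comp (C ω * X) = C (ω ^ d) * p.map (algebraMap ℝ ℂ)) : ω ^ n = 1 := by
  have hc : ∀ i, p.coeff i ≠ 0 → ω ^ i = ω ^ d := by
    intro i hi
    have h1 := congrArg (fun r : Polynomial ℂ => r.coeff i) h
    simp only [comp_C_mul_X_coeff, coeff_C_mul, coeff_map] at h1
    have h2 : (algebraMap ℝ ℂ) (p.coeff i) ≠ 0 := by simpa using hi
    rw [mul_comm] at h1
    exact mul_right_cancel₀ h2 h1
  have hpc : ∀ j, p.coeff (n * j + m) = q.coeff j := by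
    intro j
    rw [hpq, mul_comm, coeff_mul_X_pow, ← expand_eq_comp_X_pow, mul_comm, coeff_expand_mul (by omega)]
  have hm : ω ^ m = ω ^ d := by
    apply hc
    have := hpc 0
    rw [mul_zero, zero_add] at this
    rw [this, coeff_zero_eq_eval_zero]; exact hq0
  have hj : ∀ j, q.coeff j ≠ 0 → (ω ^ n) ^ j = 1 := by
    intro j hj
    have h1 := hc (n * j + m) (by rw [hpc]; exact hj)
    rw [pow_add, ← hm, pow_mul] at h1
    exact mul_right_cancel₀ (pow_ne_zero m hω) (by rw [h1, one_mul])
  set k := orderOf (ω ^ n) with hk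
  have hkj : ∀ j, q.coeff j ≠ 0 → k ∣ j := fun j h => orderOf_dvd_of_pow_eq_one (hj j h)
  have hk0 : k ≠ 0 := by
    intro h0
    have := hkj q.natDegree (by rw [hqmonic.coeff_natDegree]; exact one_ne_zero)
    rw [h0, zero_dvd_iff] at this
    omega
  have hq : q = (contract k q).comp (X ^ k) := by
    rw [← expand_eq_comp_X_pow]
    ext j
    rw [coeff_expand (Nat.pos_of_ne_zero hk0)]
    split_ifs with hd
    · rw [coeff_contract hk0, Nat.div_mul_cancel hd]
    · by_contra h; exact hd (hkj j h)
  have h2 := hmax m (k * n) (contract k q) (Nat.mul_pos (Nat.pos_of_ne_zero hk0) (by omega)) (by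
    rw [← coeff_zero_eq_eval_zero, coeff_contract hk0, zero_mul, coeff_zero_eq_eval_zero]; exact hq0) (by
    rw [hpq]
    congr 1
    conv_lhs => rw [hq]
    rw [comp_assoc, X_pow_comp, ← pow_mul, mul_comm n k])
  have h3 : k = 1 := by
    have : k * n ≤ 1 * n := by omega
    have := Nat.le_of_mul_le_mul_right this (by omega)
    omega
  exact orderOf_eq_one_iff.1 h3

end
end RF

namespace RF
open scoped TensorProduct

noncomputable section

lemma Dan_BpC {p : Polynomial ℝ} {d : ℕ} (hd : 3 ≤ d)
    (hdeg : p.natDegree = d) (hmonic : p.Monic) (hred : p.coeff (d - 1) = 0) :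
    ∃ x y z : BpC p, Dan d (p.map (algebraMap ℝ ℂ)) x y z := by
  let mk := Ideal.Quotient.mkₐ ℂ (Ideal.span {(MvPolynomial.X 0 * MvPolynomial.X 1 : MvPolynomial (Fin 3) ℂ) -
      Polynomial.aeval (MvPolynomial.X 2) (p.map (algebraMap ℝ ℂ))})
  refine ⟨mk (MvPolynomial.X 0), mk (MvPolynomial.X 1), mk (MvPolynomial.X 2), ?_⟩
  refine ⟨hd, hmonic.map _, ?_, ?_, ?_, ?_, ?_, ?_⟩
  · rw [Polynomial.natDegree_map]; exact hdeg
  · rw [Polynomial.coeff_map, hred, map_zero]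
  · rw [Polynomial.map_map]
    congr 1
    ext r; simp
  · rw [← map_mul, Polynomial.aeval_algHom_apply]
    rw [← sub_eq_zero, ← map_sub]
    exact Ideal.Quotient.eq_zero_iff_mem.2 (Ideal.subset_span rfl)
  · rw [eq_top_iff]
    rintro b -
    obtain ⟨P, rfl⟩ := Ideal.Quotient.mk_surjective b
    change mk P ∈ _
    induction P using MvPolynomial.induction_on with
    | C a =>
      have : mk (MvPolynomial.C a) = algebraMap ℂ _ a := mk.commutes a
      rw [this]; exact Subalgebra.algebraMap_mem _ _
    | add P Q h1 h2 => rw [map_add]; exact add_mem h1 h2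
    | mul_X P i h =>
      rw [map_mul]
      refine mul_mem h (Algebra.subset_adjoin ?_)
      fin_cases i <;> simp
  · intro C _ k X Y Z h
    refine ⟨Ideal.Quotient.lift _ (MvPolynomial.eval₂Hom k ![X, Y, Z]) ?_, ?_, ?_, ?_, ?_⟩
    · intro a ha
      rw [Ideal.mem_span_singleton] at ha
      obtain ⟨r, rfl⟩ := ha
      rw [map_mul, map_sub, map_mul]
      have e : (MvPolynomial.eval₂Hom k ![X, Y, Z]) (Polynomial.aeval (MvPolynomial.X 2) (p.map (algebraMap ℝ ℂ))) =
          (p.map (algebraMap ℝ ℂ)).eval₂ k Z := by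
        rw [Polynomial.aeval_def, Polynomial.hom_eval₂]
        congr 1
        · ext c; simp [MvPolynomial.algebraMap_eq]
        · simp
      rw [e, ← h]
      simp
    · intro c
      have : algebraMap ℂ (BpC p) c = Ideal.Quotient.mk _ (MvPolynomial.C c) := rfl
      rw [this, Ideal.Quotient.lift_mk]; simp
    · change Ideal.Quotient.lift _ _ _ (Ideal.Quotient.mk _ _) = _
      rw [Ideal.Quotient.lift_mk]; simp
    · change Ideal.Quotient.lift _ _ _ (Ideal.Quotient.mk _ _) = _
      rw [Ideal.Quotient.lift_mk]; simp
    · change Ideal.Quotient.lift _ _ _ (Ideal.Quotient.mk _ _) = _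
      rw [Ideal.Quotient.lift_mk]; simp

/-- the square root of minus (-1)^a -/
def iot (a : Fin 2) : ℂ := if a = 0 then Complex.I else 1
def kap (b : Fin 2) : ℂ := if b = 0 then -1 else 1

lemma iot_sq (a : Fin 2) : iot a ^ 2 = - (-1) ^ (a : ℕ) := by fin_cases a <;> simp [iot]
lemma iot_ne (a : Fin 2) : iot a ≠ 0 := by fin_cases a <;> simp [iot]
lemma kap_eq (b : Fin 2) : kap b = - (-1) ^ (b : ℕ) := by fin_cases b <;> simp [kap]
lemma kap_sq (b : Fin 2) : kap b * kap b = 1 := by fin_cases b <;> simp [kap]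
lemma kap_ne (b : Fin 2) : kap b ≠ 0 := by fin_cases b <;> simp [kap]

/-- complex conjugation on the complexification -/
def cj (A : Type) [CommRing A] [Algebra ℝ A] : (ℂ ⊗[ℝ] A) ≃+* (ℂ ⊗[ℝ] A) :=
  (Algebra.TensorProduct.congr Complex.conjAe (AlgEquiv.refl (R := ℝ) (A₁ := A)) : (ℂ ⊗[ℝ] A) ≃ₐ[ℝ] (ℂ ⊗[ℝ] A))

lemma cj_tmul {A : Type} [CommRing A] [Algebra ℝ A] (c : ℂ) (a : A) : cj A (c ⊗ₜ a) = (starRingEnd ℂ c) ⊗ₜ a := rfl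

lemma cj_CJ (A : Type) [CommRing A] [Algebra ℝ A] : CJ (cj A) := by
  intro c
  rw [Algebra.TensorProduct.algebraMap_apply, Algebra.TensorProduct.algebraMap_apply]
  exact cj_tmul _ _

lemma cj_cj {A : Type} [CommRing A] [Algebra ℝ A] (t : ℂ ⊗[ℝ] A) : cj A (cj A t) = t := by
  induction t with
  | zero => simp
  | tmul c a => rw [cj_tmul, cj_tmul]; simp
  | add s t h1 h2 => rw [map_add, map_add, h1, h2]

lemma rep {A : Type} [CommRing A] [Algebra ℝ A] (t : ℂ ⊗[ℝ] A) :
    ∃ a b : A, t = 1 ⊗ₜ a + Complex.I ⊗ₜ b := by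
  induction t with
  | zero => exact ⟨0, 0, by simp⟩
  | tmul c a =>
    refine ⟨c.re • a, c.im • a, ?_⟩
    rw [TensorProduct.tmul_smul, TensorProduct.tmul_smul, TensorProduct.smul_tmul', TensorProduct.smul_tmul',
      ← TensorProduct.add_tmul]
    congr 1
    apply Complex.ext <;> simp
  | add s t h1 h2 =>
    obtain ⟨a, b, rfl⟩ := h1
    obtain ⟨a', b', rfl⟩ := h2
    exact ⟨a + a', b + b', by rw [TensorProduct.tmul_add, TensorProduct.tmul_add]; abel⟩

lemma inj_A {A : Type} [CommRing A] [Algebra ℝ A] {a b : A} (h : (1 : ℂ) ⊗ₜ[ℝ] a = 1 ⊗ₜ b) : a = b :=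
  Algebra.TensorProduct.includeRight_injective (A := ℂ) (R := ℝ) (B := A)
    (algebraMap ℝ ℂ).injective h

lemma fixed {A : Type} [CommRing A] [Algebra ℝ A] {t : ℂ ⊗[ℝ] A} (h : cj A t = t) :
    ∃ a : A, t = 1 ⊗ₜ a := by
  obtain ⟨a, b, rfl⟩ := rep t
  rw [map_add, cj_tmul, cj_tmul, map_one, Complex.conj_I] at h
  refine ⟨a, ?_⟩
  have h1 := add_left_cancel h
  rw [TensorProduct.neg_tmul] at h1
  have h2 : (2 : ℂ) • (Complex.I ⊗ₜ[ℝ] b) = 0 := by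
    rw [two_smul]; nth_rewrite 1 [← h1]; simp
  have h3 : Complex.I ⊗ₜ[ℝ] b = 0 := by
    have := congrArg (fun t : ℂ ⊗[ℝ] A => (2⁻¹ : ℂ) • t) h2
    simpa [smul_smul] using this
  rw [h3, add_zero]

lemma descent {A S : Type} [CommRing A] [Algebra ℝ A] [CommRing S] [Algebra ℝ S] (E : (ℂ ⊗[ℝ] A) ≃ₐ[ℂ] (ℂ ⊗[ℝ] S))
    (h : ∀ b, E (cj A b) = cj S (E b)) : Nonempty (A ≃ₐ[ℝ] S) := by
  have h1 : ∀ a : A, ∃ s : S, E (1 ⊗ₜ a) = 1 ⊗ₜ s := by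
    intro a
    apply fixed
    rw [← h, cj_tmul, map_one]
  have h2 : ∀ s : S, ∃ a : A, E.symm (1 ⊗ₜ s) = 1 ⊗ₜ a := by
    intro s
    apply fixed
    rw [AlgEquiv.eq_symm_apply, h, AlgEquiv.apply_symm_apply, cj_tmul, map_one]
  choose f hf using h1
  choose g hg using h2
  let F : A →ₐ[ℝ] S :=
    { toFun := f
      map_one' := by
        apply inj_A; rw [← hf]
        rw [← Algebra.TensorProduct.one_def, map_one, Algebra.TensorProduct.one_def]
      map_mul' := by
        intro a b; apply inj_A; rw [← hf]
        have e : (1 : ℂ) ⊗ₜ[ℝ] (a * b) = (1 ⊗ₜ a) * (1 ⊗ₜ b) := by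
          rw [Algebra.TensorProduct.tmul_mul_tmul, mul_one]
        rw [e, map_mul, hf, hf, Algebra.TensorProduct.tmul_mul_tmul, mul_one]
      map_zero' := by
        apply inj_A; rw [← hf]
        rw [TensorProduct.tmul_zero, map_zero, TensorProduct.tmul_zero]
      map_add' := by
        intro a b; apply inj_A; rw [← hf]
        rw [TensorProduct.tmul_add, map_add, hf, hf, TensorProduct.tmul_add]
      commutes' := by
        intro r; apply inj_A; rw [← hf]
        have e1 : (1 : ℂ) ⊗ₜ[ℝ] algebraMap ℝ A r = algebraMap ℂ _ (r : ℂ) := by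
          rw [Algebra.TensorProduct.algebraMap_apply, Algebra.algebraMap_eq_smul_one (A := A),
            TensorProduct.tmul_smul, TensorProduct.smul_tmul']
          simp
        have e2 : (1 : ℂ) ⊗ₜ[ℝ] algebraMap ℝ S r = algebraMap ℂ _ (r : ℂ) := by
          rw [Algebra.TensorProduct.algebraMap_apply, Algebra.algebraMap_eq_smul_one (A := S),
            TensorProduct.tmul_smul, TensorProduct.smul_tmul']
          simp
        rw [e1, e2, AlgEquiv.commutes] }
  refine ⟨AlgEquiv.ofBijective F ⟨?_, ?_⟩⟩
  · intro a b hab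
    change f a = f b at hab
    apply inj_A
    apply E.injective
    rw [hf, hf, hab]
  · intro s
    refine ⟨g s, ?_⟩
    change f (g s) = s
    apply inj_A
    rw [← hf, ← hg, AlgEquiv.apply_symm_apply]

lemma ascent {A S : Type} [CommRing A] [Algebra ℝ A] [CommRing S] [Algebra ℝ S] (ψ : A ≃ₐ[ℝ] S) :
    ∃ E : (ℂ ⊗[ℝ] A) ≃ₐ[ℂ] (ℂ ⊗[ℝ] S), ∀ b, E (cj A b) = cj S (E b) := by
  refine ⟨Algebra.TensorProduct.congr AlgEquiv.refl ψ, ?_⟩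
  intro b
  induction b with
  | zero => simp
  | tmul c a => rw [cj_tmul]; simp [cj_tmul]
  | add s t h1 h2 => simp only [map_add, h1, h2]

end
end RF

namespace RF
open scoped TensorProduct

noncomputable section

lemma aeval_pq {p q : Polynomial ℝ} {m n : ℕ} (hpq : p = Polynomial.X ^ m * q.comp (Polynomial.X ^ n))
    {T : Type} [CommRing T] [Algebra ℝ T] (z : T) :
    Polynomial.aeval z p = z ^ m * Polynomial.aeval (z ^ n) q := by
  rw [hpq, map_mul, Polynomial.aeval_comp]; simp

lemma aeval_sPoly {q : Polynomial ℝ} {m n : ℕ} (a b c : Fin 2)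
    {T : Type} [CommRing T] [Algebra ℝ T] (v : Fin 3 → T) :
    MvPolynomial.aeval v (sPoly m n q a b c) = v 0 ^ 2 + (-1) ^ (a : ℕ) * v 1 ^ 2
      + (-1) ^ (b : ℕ) * (v 2 ^ m * Polynomial.aeval ((-1) ^ (c : ℕ) * v 2 ^ n) q) := by
  unfold sPoly
  simp only [map_add, map_mul, map_pow, map_neg, map_one, MvPolynomial.aeval_X, ← Polynomial.aeval_algHom_apply]

lemma sg_smul {T : Type} [CommRing T] [Algebra ℂ T] (k : ℕ) (t : T) : ((-1 : ℂ) ^ k) • t = (-1) ^ k * t := by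
  rcases Nat.even_or_odd k with h | h <;> simp [h.neg_one_pow]

/-- presentation -/
structure Pres (m n : ℕ) (q : Polynomial ℝ) (i : Fin 2 × Fin 2 × Fin 2) {S : Type} [CommRing S] [Algebra ℝ S]
    (v : Fin 3 → S) : Prop where
  rel : MvPolynomial.aeval v (sPoly m n q i.1 i.2.1 i.2.2) = 0
  surj : ∀ s, ∃ P : MvPolynomial (Fin 3) ℝ, MvPolynomial.aeval v P = s
  lift : ∀ {C : Type} [CommRing C] [Algebra ℝ C] (w : Fin 3 → C),
    MvPolynomial.aeval w (sPoly m n q i.1 i.2.1 i.2.2) = 0 → ∃ g : S →ₐ[ℝ] C, ∀ j, g (v j) = w j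

lemma Pres_S (m n : ℕ) (q : Polynomial ℝ) (i : Fin 2 × Fin 2 × Fin 2) :
    ∃ v : Fin 3 → SAlg m n q i, Pres m n q i v := by
  refine ⟨fun j => Ideal.Quotient.mkₐ ℝ _ (MvPolynomial.X j), ?_⟩
  have key : MvPolynomial.aeval (fun j => Ideal.Quotient.mkₐ ℝ (Ideal.span {sPoly m n q i.1 i.2.1 i.2.2}) (MvPolynomial.X j)) =
    Ideal.Quotient.mkₐ ℝ (Ideal.span {sPoly m n q i.1 i.2.1 i.2.2}) := by
    apply MvPolynomial.algHom_ext
    intro j; simp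
  refine ⟨?_, ?_, ?_⟩
  · rw [key]
    exact Ideal.Quotient.eq_zero_iff_mem.2 (Ideal.subset_span rfl)
  · intro s
    rw [key]
    exact Ideal.Quotient.mk_surjective s
  · intro C _ _ w h'
    refine ⟨Ideal.Quotient.liftₐ _ (MvPolynomial.aeval w) ?_, ?_⟩
    · intro a ha
      rw [Ideal.mem_span_singleton] at ha
      obtain ⟨r, rfl⟩ := ha
      rw [map_mul, h', zero_mul]
    · intro j
      change MvPolynomial.aeval w (MvPolynomial.X j) = _
      simp

variable {S : Type} [CommRing S] [Algebra ℝ S] {v : Fin 3 → S} {m n : ℕ} {q : Polynomial ℝ}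
  {i : Fin 2 × Fin 2 × Fin 2}

/-- the generators -/
def gn (v : Fin 3 → S) (j : Fin 3) : ℂ ⊗[ℝ] S := 1 ⊗ₜ v j

lemma gn_rel (hv : Pres m n q i v) :
    gn v 0 ^ 2 + (-1) ^ (i.1 : ℕ) * gn v 1 ^ 2
      + (-1) ^ (i.2.1 : ℕ) * (gn v 2 ^ m * Polynomial.aeval ((-1) ^ (i.2.2 : ℕ) * gn v 2 ^ n) q) = 0 := by
  rw [← aeval_sPoly]
  let F : S →ₐ[ℝ] ℂ ⊗[ℝ] S := Algebra.TensorProduct.includeRight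
  have hF : gn v = fun j => F (v j) := rfl
  rw [hF, ← MvPolynomial.comp_aeval_apply, hv.rel, map_zero]

lemma gn_gen (hv : Pres m n q i v) (V : Subalgebra ℂ (ℂ ⊗[ℝ] S))
    (h : ∀ j, gn v j ∈ V) : V = ⊤ := by
  rw [eq_top_iff]
  rintro t -
  induction t with
  | zero => exact zero_mem _
  | add s t h1 h2 => exact add_mem h1 h2
  | tmul c s =>
    have e : c ⊗ₜ[ℝ] s = c • ((1 : ℂ) ⊗ₜ[ℝ] s) := by rw [TensorProduct.smul_tmul']; simp
    rw [e]
    refine V.smul_mem ?_ c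
    obtain ⟨P, rfl⟩ := hv.surj s
    clear e
    let F : S →ₐ[ℝ] ℂ ⊗[ℝ] S := Algebra.TensorProduct.includeRight
    change F (MvPolynomial.aeval v P) ∈ V
    induction P using MvPolynomial.induction_on with
    | C a =>
      have : F (MvPolynomial.aeval v (MvPolynomial.C a)) = algebraMap ℂ (ℂ ⊗[ℝ] S) (a : ℂ) := by
        rw [← MvPolynomial.algebraMap_eq, AlgHom.commutes, AlgHom.commutes]
        rw [IsScalarTower.algebraMap_apply ℝ ℂ (ℂ ⊗[ℝ] S)]; rfl
      rw [this]; exact V.algebraMap_mem _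
    | add P Q h1 h2 => rw [map_add, map_add]; exact add_mem h1 h2
    | mul_X P j hh =>
      rw [map_mul, map_mul, MvPolynomial.aeval_X]
      exact mul_mem hh (h j)

lemma gn_lift (hv : Pres m n q i v)
    {C : Type} [CommRing C] (k : ℂ →+* C) (w : Fin 3 → C)
    (h : w 0 ^ 2 + (-1) ^ (i.1 : ℕ) * w 1 ^ 2
      + (-1) ^ (i.2.1 : ℕ) * (w 2 ^ m *
        Polynomial.eval₂ (k.comp (algebraMap ℝ ℂ)) ((-1) ^ (i.2.2 : ℕ) * w 2 ^ n) q) = 0) :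
    ∃ f : (ℂ ⊗[ℝ] S) →+* C, (∀ c, f (algebraMap ℂ (ℂ ⊗[ℝ] S) c) = k c) ∧ ∀ j, f (gn v j) = w j := by
  let _ : Algebra ℂ C := k.toAlgebra
  let _ : Algebra ℝ C := (k.comp (algebraMap ℝ ℂ)).toAlgebra
  have : IsScalarTower ℝ ℂ C := .of_algebraMap_eq (fun _ => rfl)
  have h' : MvPolynomial.aeval w (sPoly m n q i.1 i.2.1 i.2.2) = 0 := by
    rw [aeval_sPoly]; exact h
  obtain ⟨g, hg⟩ := hv.lift w h'
  let f := Algebra.TensorProduct.lift (Algebra.ofId ℂ C) g (fun _ _ => Commute.all _ _)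
  refine ⟨f, ?_, ?_⟩
  · intro c; exact f.commutes c
  · intro j
    change f (1 ⊗ₜ _) = _
    rw [Algebra.TensorProduct.lift_tmul, map_one, one_mul, hg]

/-- the standard triple -/
def tx (v : Fin 3 → S) (i : Fin 2 × Fin 2 × Fin 2) : ℂ ⊗[ℝ] S :=
  gn v 0 + iot i.1 • gn v 1
def ty (m : ℕ) (v : Fin 3 → S) (i : Fin 2 × Fin 2 × Fin 2) (ν : ℂ) : ℂ ⊗[ℝ] S :=
  (kap i.2.1 * ν⁻¹ ^ m) • (gn v 0 - iot i.1 • gn v 1)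
def tz (v : Fin 3 → S) (ν : ℂ) : ℂ ⊗[ℝ] S :=
  ν⁻¹ • gn v 2

lemma Dan_S {p : Polynomial ℝ} {d : ℕ} (hd : 3 ≤ d)
    (hdeg : p.natDegree = d) (hmonic : p.Monic) (hred : p.coeff (d - 1) = 0) 
    (hpq : p = Polynomial.X ^ m * q.comp (Polynomial.X ^ n))
    (hv : Pres m n q i v) {ν : ℂ} (hν : ν ≠ 0) (hνn : ν ^ n = (-1) ^ (i.2.2 : ℕ)) :
    Dan d (p.map (algebraMap ℝ ℂ)) (tx v i) (ty m v i ν) (tz v ν) := by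
  have hκ := kap_sq i.2.1
  have hκ2 := kap_eq i.2.1
  have hι := iot_sq i.1
  have hι0 := iot_ne i.1
  have hc2 : ((-1 : ℂ) ^ (i.2.2 : ℕ)) * (-1) ^ (i.2.2 : ℕ) = 1 := by
    rw [← mul_pow]; simp
  refine ⟨hd, hmonic.map _, ?_, ?_, ?_, ?_, ?_, ?_⟩
  · rw [Polynomial.natDegree_map]; exact hdeg
  · rw [Polynomial.coeff_map, hred, map_zero]
  · rw [Polynomial.map_map]
    congr 1
    ext r; simp
  · rw [Polynomial.aeval_map_algebraMap, aeval_pq hpq]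
    have hr := gn_rel hv
    have sg : ∀ (k : ℕ) (t : ℂ ⊗[ℝ] S), ((-1 : ℂ) ^ k) • t = (-1) ^ k * t := fun k t => sg_smul k t
    unfold tx ty tz
    set X := gn v 0
    set Y := gn v 1
    set Z := gn v 2
    have e1 : (ν⁻¹ • Z) ^ n = (-1) ^ (i.2.2 : ℕ) * Z ^ n := by
      rw [_root_.smul_pow, inv_pow, hνn]
      rw [← inv_pow, inv_neg, inv_one, sg]
    rw [e1, _root_.smul_pow]
    set W := Polynomial.aeval ((-1) ^ (i.2.2 : ℕ) * Z ^ n) q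
    have e2 : (X + iot i.1 • Y) * (X - iot i.1 • Y) = X ^ 2 + (-1) ^ (i.1 : ℕ) * Y ^ 2 := by
      have : (X + iot i.1 • Y) * (X - iot i.1 • Y) = X ^ 2 - (iot i.1 • Y) ^ 2 := by ring
      rw [this, _root_.smul_pow, hι]
      rw [neg_smul, sg, sub_neg_eq_add]
    have e3 : X ^ 2 + (-1) ^ (i.1 : ℕ) * Y ^ 2 = kap i.2.1 • (Z ^ m * W) := by
      rw [hκ2]
      have : X ^ 2 + (-1) ^ (i.1 : ℕ) * Y ^ 2 = - ((-1) ^ (i.2.1 : ℕ) * (Z ^ m * W)) := by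
        linear_combination hr
      rw [this]
      rw [neg_smul, sg]
    rw [mul_smul_comm, e2, e3, smul_smul, smul_mul_assoc]
    congr 1
    rw [mul_right_comm, hκ, one_mul]
  · apply gn_gen hv
    have hx : tx v i ∈ Algebra.adjoin ℂ {tx v i, ty m v i ν, tz v ν} :=
      Algebra.subset_adjoin (by simp)
    have hy : ty m v i ν ∈ Algebra.adjoin ℂ {tx v i, ty m v i ν, tz v ν} :=
      Algebra.subset_adjoin (by simp)
    have hz : tz v ν ∈ Algebra.adjoin ℂ {tx v i, ty m v i ν, tz v ν} :=
      Algebra.subset_adjoin (by simp)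
    have ky : (kap i.2.1 * ν ^ m) • ty m v i ν = gn v 0 - iot i.1 • gn v 1 := by
      rw [ty, smul_smul]
      have : kap i.2.1 * ν ^ m * (kap i.2.1 * ν⁻¹ ^ m) = 1 := by
        rw [inv_pow]; field_simp; rw [pow_two]; exact hκ
      rw [this, one_smul]
    have hy' := Subalgebra.smul_mem _ hy (kap i.2.1 * ν ^ m)
    rw [ky] at hy'
    intro j
    fin_cases j
    · change gn v 0 ∈ _
      have : gn v 0 = (2⁻¹ : ℂ) • (tx v i + (gn v 0 - iot i.1 • gn v 1)) := by
        unfold tx; module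
      rw [this]
      exact Subalgebra.smul_mem _ (add_mem hx hy') _
    · change gn v 1 ∈ _
      have : gn v 1 = ((2 * iot i.1)⁻¹ : ℂ) • (tx v i - (gn v 0 - iot i.1 • gn v 1)) := by
        have e : tx v i - (gn v 0 - iot i.1 • gn v 1) = (2 * iot i.1) • gn v 1 := by
          unfold tx; module
        rw [e, smul_smul, inv_mul_cancel₀ (by simp [hι0]), one_smul]
      rw [this]
      exact Subalgebra.smul_mem _ (Subalgebra.sub_mem _ hx hy') _
    · change gn v 2 ∈ _
      have : gn v 2 = ν • tz v ν := by
        rw [tz, smul_smul, mul_inv_cancel₀ hν, one_smul]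
      rw [this]
      exact Subalgebra.smul_mem _ hz _
  · intro C _ k X Y Z h
    have h2 : k 2⁻¹ * 2 = 1 := by
      rw [← map_ofNat k 2, ← map_mul]; simp
    have hki : k (iot i.1) ^ 2 = - (-1) ^ (i.1 : ℕ) := by rw [← map_pow, hι]; simp
    have hkii : k (iot i.1) * k (iot i.1)⁻¹ = 1 := by rw [← map_mul, mul_inv_cancel₀ hι0, map_one]
    have hkk : k (kap i.2.1) = - (-1) ^ (i.2.1 : ℕ) := by rw [hκ2]; simp
    have hkk2 : k (kap i.2.1) * k (kap i.2.1) = 1 := by rw [← map_mul, hκ, map_one]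
    have hkn : k ν ^ n = (-1) ^ (i.2.2 : ℕ) := by rw [← map_pow, hνn]; simp
    have hkm : k ν⁻¹ ^ m * k ν ^ m = 1 := by rw [← mul_pow, ← map_mul, inv_mul_cancel₀ hν, map_one, one_pow]
    have hkz : k ν⁻¹ * k ν = 1 := by rw [← map_mul, inv_mul_cancel₀ hν, map_one]
    have hcc : ((-1 : C) ^ (i.2.2 : ℕ)) * (-1) ^ (i.2.2 : ℕ) = 1 := by
      rw [← mul_pow]; simp
    have hii : ((-1 : C) ^ (i.1 : ℕ)) * (-1) ^ (i.1 : ℕ) = 1 := by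
      rw [← mul_pow]; simp
    set K := k (kap i.2.1) * k ν ^ m with hK
    rw [Polynomial.eval₂_map, hpq, Polynomial.eval₂_mul, Polynomial.eval₂_comp, Polynomial.eval₂_pow,
      Polynomial.eval₂_X, Polynomial.eval₂_pow, Polynomial.eval₂_X] at h
    obtain ⟨f, hf1, hf2⟩ := gn_lift hv k
      ![k 2⁻¹ * (X + K * Y), k 2⁻¹ * k (iot i.1)⁻¹ * (X - K * Y), k ν * Z] (by
        simp only [Matrix.cons_val_zero, Matrix.cons_val_one, Matrix.cons_val]
        rw [mul_pow (k ν) Z n, hkn, ← mul_assoc ((-1) ^ (i.2.2 : ℕ)), hcc, one_mul, mul_pow (k ν) Z m,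
          mul_assoc (k ν ^ m), ← h]
        have e1 : (-1) ^ (i.1 : ℕ) * (k 2⁻¹ * k (iot i.1)⁻¹ * (X - K * Y)) ^ 2 = - (k 2⁻¹ * (X - K * Y)) ^ 2 := by
          have : (-1) ^ (i.1 : ℕ) = - k (iot i.1) ^ 2 := by rw [hki]; ring
          rw [this]
          linear_combination (- (k 2⁻¹ * (X - K * Y)) ^ 2 * (k (iot i.1) * k (iot i.1)⁻¹ + 1)) * hkii
        rw [e1]
        have e3 : (-1) ^ (i.2.1 : ℕ) = - k (kap i.2.1) := by rw [hkk]; ring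
        rw [e3, hK]
        linear_combination (k (kap i.2.1) * k ν ^ m * X * Y) * (k 2⁻¹ * 2 + 1) * h2)
    have f0 := hf2 0
    have f1 := hf2 1
    have f2 := hf2 2
    simp only [Matrix.cons_val_zero, Matrix.cons_val_one, Matrix.cons_val] at f0 f1 f2
    have hfs : ∀ (c : ℂ) (t : ℂ ⊗[ℝ] S), f (c • t) = k c * f t := by
      intro c t
      have e : c • t = algebraMap ℂ (ℂ ⊗[ℝ] S) c * t := Algebra.smul_def c t
      rw [e, map_mul, hf1]
    refine ⟨f, hf1, ?_, ?_, ?_⟩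
    · unfold tx
      rw [map_add, hfs, f0, f1]
      linear_combination X * h2 + k 2⁻¹ * (X - K * Y) * hkii
    · unfold ty
      rw [hfs, map_sub, hfs, f0, f1, map_mul k, map_pow]
      have e : k (kap i.2.1) * k ν⁻¹ ^ m * K = 1 := by
        rw [hK]; linear_combination (k ν⁻¹ ^ m * k ν ^ m) * hkk2 + hkm
      linear_combination (k (kap i.2.1) * k ν⁻¹ ^ m * K * Y) * h2 - k (kap i.2.1) * k ν⁻¹ ^ m * k 2⁻¹ * (X - K * Y) * hkii + Y * e
    · unfold tz
      rw [hfs, f2]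
      linear_combination Z * hkz

end
end RF

namespace RF
open scoped TensorProduct

noncomputable section

section abs
variable {d : ℕ} {p : Polynomial ℂ} {B : Type} [CommRing B] [Algebra ℂ B] {x y z : B}

lemma Dan.smul_cancel (H : Dan d p x y z) {b : B} (hb : b ≠ 0) {c c' : ℂ} (h : c • b = c' • b) : c = c' := by
  have := H.isDomain
  rw [Algebra.smul_def, Algebra.smul_def] at h
  exact H.inj_C (mul_right_cancel₀ hb h)

lemma sqrt_unit {ω : ℂ} (h : starRingEnd ℂ ω * ω = 1) :
    ∃ ν : ℂ, ν ^ 2 = ω ∧ starRingEnd ℂ ν * ν = 1 := by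
  obtain ⟨ν, hν⟩ := IsAlgClosed.exists_pow_nat_eq ω (n := 2) (by norm_num)
  refine ⟨ν, hν, ?_⟩
  rw [mul_comm, Complex.mul_conj, Complex.normSq_eq_norm_sq] at h ⊢
  rw [← hν, norm_pow] at h
  norm_cast at h ⊢
  have h0 : 0 ≤ ‖ν‖ ^ 2 := by positivity
  nlinarith

lemma deg_pq {p q : Polynomial ℝ} {m n : ℕ} (hqmonic : q.Monic) (hn : 1 ≤ n)
    (hpq : p = Polynomial.X ^ m * q.comp (Polynomial.X ^ n)) : p.natDegree = m + n * q.natDegree := by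
  have h1 : (q.comp (Polynomial.X ^ n)).Monic :=
    hqmonic.comp (Polynomial.monic_X_pow n) (by rw [Polynomial.natDegree_X_pow]; omega)
  rw [hpq, (Polynomial.monic_X_pow m).natDegree_mul h1, Polynomial.natDegree_X_pow, Polynomial.natDegree_comp,
    Polynomial.natDegree_X_pow, mul_comm n]

lemma pm_one {ν : ℂ} {n : ℕ} (h : (ν ^ 2) ^ n = 1) : ∃ c : Fin 2, ν ^ n = (-1) ^ (c : ℕ) := by
  have h' : ν ^ n * ν ^ n = 1 := by rw [← h]; ring
  rcases mul_self_eq_one_iff.1 h' with h | h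
  · exact ⟨0, by simpa using h⟩
  · exact ⟨1, by simpa using h⟩

lemma nu_ex {ω : ℂ} {n : ℕ} (h : starRingEnd ℂ ω * ω = 1) (hn : ω ^ n = 1) :
    ∃ (ν : ℂ) (c : Fin 2), ν ^ 2 = ω ∧ starRingEnd ℂ ν * ν = 1 ∧ ν ^ n = (-1) ^ (c : ℕ) ∧ (Odd n → c = 0) := by
  obtain ⟨ν, h1, h2⟩ := sqrt_unit h
  rw [← h1] at hn
  obtain ⟨c, hc⟩ := pm_one hn
  rcases Nat.even_or_odd n with ho | ho
  · exact ⟨ν, c, h1, h2, hc, fun h => absurd ho (Nat.not_even_iff_odd.2 h)⟩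
  · obtain rfl | rfl : c = 0 ∨ c = 1 := by fin_cases c <;> simp
    · exact ⟨ν, 0, h1, h2, hc, fun _ => rfl⟩
    · refine ⟨-ν, 0, by rw [neg_sq, h1], by simpa using h2, ?_, fun _ => rfl⟩
      rw [ho.neg_pow, hc]; simp

lemma Dan.om_unit (H : Dan d p x y z) {σ : B ≃+* B} (hσ : CJ σ) (hinv : ∀ b, σ (σ b) = b)
    {b : B} (hb : b ≠ 0) {ω : ℂ} (hz : σ b = ω • b) : starRingEnd ℂ ω * ω = 1 := by
  have h := hinv b
  rw [hz, hσ.smul, hz, smul_smul] at h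
  exact H.smul_cancel hb (by rw [h, one_smul])

lemma Dan.sw_real (H : Dan d p x y z) {σ : B ≃+* B} (hσ : CJ σ) (hinv : ∀ b, σ (σ b) = b)
    {c1 c2 ω ν : ℂ} {m n k : ℕ} (hsw : Dan.SW σ x y z c1 c2 ω)
    (hp : p.comp (Polynomial.C ω * Polynomial.X) = Polynomial.C (ω ^ d) * p)
    (hd : d = m + n * k) (hn : ω ^ n = 1) (hν : ν ^ 2 = ω) (hu : starRingEnd ℂ ν * ν = 1) :
    ∃ r : ℝ, r ≠ 0 ∧ c1 = r * ν ^ m := by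
  have hdom := H.isDomain
  obtain ⟨h1, h2, hx, hy, hz⟩ := hsw
  have e1 : starRingEnd ℂ c1 * c2 = 1 := by
    have h := hinv x
    rw [hx, hσ.smul, hy, smul_smul] at h
    exact H.smul_cancel H.x_ne (by rw [h, one_smul])
  have e2 : c1 * c2 = ω ^ m := by
    have h := H.SP_rel (H.CJ_SP hσ)
    rw [hz, H.rel_a hp, hx, hy, smul_mul_smul_comm, mul_comm y x] at h
    have := H.smul_cancel (mul_ne_zero H.x_ne H.swap.x_ne) h
    rw [this, hd, pow_add, pow_mul, hn, one_pow, mul_one]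
  have hν0 : ν ≠ 0 := right_ne_zero_of_mul_eq_one hu
  have hcν : starRingEnd ℂ ν = ν⁻¹ := eq_inv_of_mul_eq_one_left hu
  have hc1 : starRingEnd ℂ c1 = c2⁻¹ := eq_inv_of_mul_eq_one_left e1
  have hreal : starRingEnd ℂ (c1 * ν⁻¹ ^ m) = c1 * ν⁻¹ ^ m := by
    rw [map_mul, map_pow, map_inv₀, hcν, hc1, inv_inv]
    have e3 : ν ^ m * ν ^ m = c1 * c2 := by rw [e2, ← hν]; ring
    have hm0 : ν ^ m ≠ 0 := pow_ne_zero _ hν0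
    rw [inv_pow]
    generalize ν ^ m = w at e3 hm0
    rw [inv_mul_eq_iff_eq_mul₀ h2]
    field_simp
    linear_combination e3
  obtain ⟨r, hr⟩ := Complex.conj_eq_iff_real.1 hreal
  refine ⟨r, ?_, ?_⟩
  · rintro rfl
    have : c1 * ν⁻¹ ^ m ≠ 0 := mul_ne_zero h1 (pow_ne_zero _ (inv_ne_zero hν0))
    exact this (by rw [hr]; simp)
  · rw [← hr, mul_assoc, ← mul_pow, inv_mul_cancel₀ hν0, one_pow, mul_one]

lemma sgn_ex (r : ℝ) (hr : r ≠ 0) : ∃ (b : Fin 2) (γ : ℝ), γ ≠ 0 ∧ ((γ : ℂ) ^ 2 * r = kap b) ∧ (0 < r → b = 1) := by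
  have h0 : 0 < |r| := abs_pos.2 hr
  have hs : Real.sqrt |r| ≠ 0 := (Real.sqrt_pos.2 h0).ne'
  have e : ((Real.sqrt |r|)⁻¹) ^ 2 = |r|⁻¹ := by rw [inv_pow, Real.sq_sqrt h0.le]
  rcases lt_or_gt_of_ne hr with h | h
  · refine ⟨0, (Real.sqrt |r|)⁻¹, inv_ne_zero hs, ?_, fun h' => by linarith⟩
    have : ((Real.sqrt |r|)⁻¹) ^ 2 * r = -1 := by
      rw [e, abs_of_neg h]; field_simp
    simp only [kap, if_true]
    exact_mod_cast this
  · refine ⟨1, (Real.sqrt |r|)⁻¹, inv_ne_zero hs, ?_, fun h' => rfl⟩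
    have : ((Real.sqrt |r|)⁻¹) ^ 2 * r = 1 := by
      rw [e, abs_of_pos h]; field_simp
    have h2 : kap 1 = 1 := by simp [kap]
    rw [h2]
    exact_mod_cast this

/-- Normal form. -/
lemma Dan.normal {p : Polynomial ℂ} (H : Dan d p x y z) {m n k : ℕ} (hdk : d = m + n * k)
    (hsym : ∀ ω : ℂ, ω ≠ 0 → p.comp (Polynomial.C ω * Polynomial.X) = Polynomial.C (ω ^ d) * p → ω ^ n = 1)
    {σ : B ≃+* B} (hσ : CJ σ) (hinv : ∀ b, σ (σ b) = b) :
    ∃ (a b c : Fin 2) (ν : ℂ) (x y z : B), Dan d p x y z ∧ starRingEnd ℂ ν * ν = 1 ∧ ν ^ n = (-1) ^ (c : ℕ) ∧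
      σ z = ν ^ 2 • z ∧ ((a = 1 ∧ b = 1 ∧ σ x = x) ∨ (a = 0 ∧ σ x = (kap b * ν ^ m) • y)) ∧
      (Odd n → c = 0) ∧ (Even n → Odd d → b = 1) := by
  obtain ⟨x, y, z, ω, H, hω, hp, h⟩ := H.exh hσ hinv
  have hdom := H.isDomain
  have hn := hsym ω hω hp
  have hz : σ z = ω • z := by
    rcases h with h | ⟨c1, c2, h⟩
    · exact h.2.2
    · exact h.2.2.2.2
  have hz0 : z ≠ 0 := by
    have := H.z_ne_const 0
    simpa using this
  have hu := H.om_unit hσ hinv hz0 hz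
  obtain ⟨ν, c, hν, hνu, hνn, hc⟩ := nu_ex hu hn
  rcases h with h | ⟨c1, c2, h⟩
  · obtain ⟨⟨e, he, hx⟩, -, -⟩ := h
    have heu := H.om_unit hσ hinv H.x_ne hx
    obtain ⟨γ, hγ, hγu⟩ := sqrt_unit heu
    have hγ0 : γ ≠ 0 := right_ne_zero_of_mul_eq_one hγu
    refine ⟨1, 1, c, ν, γ • x, γ⁻¹ • y, z, H.scale hγ0, hνu, hνn, by rw [hz, hν], Or.inl ⟨rfl, rfl, ?_⟩, hc,
      fun _ _ => rfl⟩
    rw [hσ.smul, hx, smul_smul, ← hγ, pow_two, ← mul_assoc, hγu, one_mul]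
  · have key : ∃ ν' : ℂ, ν' ^ 2 = ω ∧ starRingEnd ℂ ν' * ν' = 1 ∧ ν' ^ n = (-1) ^ (c : ℕ) ∧
        ∃ r : ℝ, r ≠ 0 ∧ c1 = r * ν' ^ m ∧ (Even n → Odd d → 0 < r) := by
      obtain ⟨r, hr, hr1⟩ := H.sw_real hσ hinv h hp hdk hn hν hνu
      by_cases hc : Even n ∧ Odd d ∧ r < 0
      · obtain ⟨h1, h2, h3⟩ := hc
        have hm : Odd m := by
          rw [hdk] at h2
          have : Even (n * k) := h1.mul_right k
          by_contra hm
          rw [Nat.not_odd_iff_even] at hm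
          exact Nat.not_even_iff_odd.2 h2 (hm.add this)
        refine ⟨-ν, by rw [neg_sq, hν], by simpa using hνu, by rw [h1.neg_pow, hνn], -r, neg_ne_zero.2 hr, ?_,
          fun _ _ => by linarith⟩
        rw [hm.neg_pow, hr1]; push_cast; ring
      · refine ⟨ν, hν, hνu, hνn, r, hr, hr1, fun h1 h2 => ?_⟩
        rcases lt_or_gt_of_ne hr with h | h
        · exact absurd ⟨h1, h2, h⟩ hc
        · exact h
    obtain ⟨ν, hν, hνu, hνn, r, hr, hr1, hpos⟩ := key
    obtain ⟨b, γ, hγ, hγb, hb⟩ := sgn_ex r hr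
    have hγ0 : (γ : ℂ) ≠ 0 := by exact_mod_cast hγ
    refine ⟨0, b, c, ν, (γ : ℂ) • x, (γ : ℂ)⁻¹ • y, z, H.scale hγ0, hνu, hνn, by rw [hz, hν], Or.inr ⟨rfl, ?_⟩, hc,
      fun h1 h2 => hb (hpos h1 h2)⟩
    rw [hσ.smul, h.2.2.1, smul_smul, smul_smul, hr1, ← hγb, Complex.conj_ofReal]
    congr 1
    field_simp

end abs

lemma conj_kap (b : Fin 2) : starRingEnd ℂ (kap b) = kap b := by
  fin_cases b <;> simp [kap]

section dat
variable {S : Type} [CommRing S] [Algebra ℝ S] {v : Fin 3 → S} {m : ℕ} {i : Fin 2 × Fin 2 × Fin 2} {ν : ℂ}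

lemma cj_gn (j : Fin 3) : cj S (gn v j) = gn v j := by
  rw [gn, cj_tmul, map_one]

lemma cj_smul (c : ℂ) (t : ℂ ⊗[ℝ] S) : cj S (c • t) = starRingEnd ℂ c • cj S t := (cj_CJ S).smul c t

lemma cj_tz (hu : starRingEnd ℂ ν * ν = 1) : cj S (tz v ν) = ν ^ 2 • tz v ν := by
  have hν0 : ν ≠ 0 := right_ne_zero_of_mul_eq_one hu
  have hcν : starRingEnd ℂ ν = ν⁻¹ := eq_inv_of_mul_eq_one_left hu
  rw [tz, cj_smul, cj_gn, smul_smul, map_inv₀, hcν, inv_inv]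
  congr 1
  field_simp

lemma cj_tx_one (h : i.1 = 1) : cj S (tx v i) = tx v i := by
  rw [tx, map_add, cj_smul, cj_gn, cj_gn, h]
  simp [iot]

lemma cj_ty_one (h : i.1 = 1) (hu : starRingEnd ℂ ν * ν = 1) : cj S (ty m v i ν) = (ν ^ 2) ^ m • ty m v i ν := by
  have hν0 : ν ≠ 0 := right_ne_zero_of_mul_eq_one hu
  have hcν : starRingEnd ℂ ν = ν⁻¹ := eq_inv_of_mul_eq_one_left hu
  have e : starRingEnd ℂ (iot i.1) = iot i.1 := by rw [h]; simp [iot]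
  rw [ty, cj_smul, map_sub, cj_smul, cj_gn, cj_gn, e, smul_smul, map_mul, map_pow, map_inv₀, hcν, inv_inv, conj_kap]
  congr 1
  rw [mul_left_comm, ← mul_pow]
  congr 2
  field_simp

lemma cj_tx_zero (h : i.1 = 0) (hν0 : ν ≠ 0) : cj S (tx v i) = (kap i.2.1 * ν ^ m) • ty m v i ν := by
  have e : starRingEnd ℂ (iot i.1) = - iot i.1 := by rw [h]; simp [iot]
  rw [ty, smul_smul, mul_mul_mul_comm, kap_sq, ← mul_pow, mul_inv_cancel₀ hν0, one_pow, one_mul, one_smul]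
  rw [tx, map_add, cj_smul, cj_gn, cj_gn, e, neg_smul, sub_eq_add_neg]

lemma cj_ty_zero (h : i.1 = 0) (hu : starRingEnd ℂ ν * ν = 1) : cj S (ty m v i ν) = (kap i.2.1 * ν ^ m) • tx v i := by
  have hν0 : ν ≠ 0 := right_ne_zero_of_mul_eq_one hu
  have hcν : starRingEnd ℂ ν = ν⁻¹ := eq_inv_of_mul_eq_one_left hu
  have e : starRingEnd ℂ (iot i.1) = - iot i.1 := by rw [h]; simp [iot]
  rw [ty, cj_smul, map_sub, cj_smul, cj_gn, cj_gn, e, neg_smul, map_mul, map_pow, map_inv₀, hcν, inv_inv, conj_kap,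
    sub_neg_eq_add]
  rfl

lemma NS_S (h : i.1 = 1) (hu : starRingEnd ℂ ν * ν = 1) :
    Dan.NS (cj S) (tx v i) (ty m v i ν) (tz v ν) (ν ^ 2) := by
  have hν0 : ν ≠ 0 := right_ne_zero_of_mul_eq_one hu
  exact ⟨⟨1, one_ne_zero, by rw [cj_tx_one h, one_smul]⟩, ⟨(ν ^ 2) ^ m, by simp [hν0], cj_ty_one h hu⟩, cj_tz hu⟩

lemma SW_S (h : i.1 = 0) (hu : starRingEnd ℂ ν * ν = 1) :
    Dan.SW (cj S) (tx v i) (ty m v i ν) (tz v ν) (kap i.2.1 * ν ^ m) (kap i.2.1 * ν ^ m) (ν ^ 2) := by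
  have hν0 : ν ≠ 0 := right_ne_zero_of_mul_eq_one hu
  exact ⟨by simp [hν0, kap_ne], by simp [hν0, kap_ne], cj_tx_zero h hν0, cj_ty_zero h hu, cj_tz hu⟩

end dat

lemma exhaust {p : Polynomial ℝ} {d : ℕ} (hd : 3 ≤ d)
    (hdeg : p.natDegree = d) (hmonic : p.Monic) (hred : p.coeff (d - 1) = 0)
    {m n : ℕ} {q : Polynomial ℝ} (hn : 1 ≤ n)
    (hqmonic : q.Monic) (hqdeg : 1 ≤ q.natDegree) (hq0 : q.eval 0 ≠ 0)
    (hpq : p = Polynomial.X ^ m * q.comp (Polynomial.X ^ n))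
    (hmax : ∀ (m' n' : ℕ) (q' : Polynomial ℝ), 1 ≤ n' → q'.eval 0 ≠ 0 →
      p = Polynomial.X ^ m' * q'.comp (Polynomial.X ^ n') → n' ≤ n)
    (A : Type) [CommRing A] [Algebra ℝ A] (hA : IsRealForm A (BpC p)) :
    ∃ i : Fin 2 × Fin 2 × Fin 2, Nonempty (A ≃ₐ[ℝ] SAlg m n q i) ∧ (i.1 = 1 → i.2.1 = 1) ∧
      (Odd n → i.2.2 = 0) ∧ (Even n → Odd d → i.2.1 = 1) := by
  obtain ⟨e⟩ := hA
  obtain ⟨x, y, z, H⟩ := Dan_BpC hd hdeg hmonic hred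
  have H1 := H.mapE e.symm
  have hdk := deg_pq hqmonic hn hpq
  rw [hdeg] at hdk
  obtain ⟨a, b, c, ν, x, y, z, H, hu, hνn, hz, hx, h1, h2⟩ := H1.normal hdk
    (fun ω h0 h => sym_pow hdeg hn hqmonic hqdeg hq0 hpq hmax h0 h) (cj_CJ A) cj_cj
  have hν0 : ν ≠ 0 := right_ne_zero_of_mul_eq_one hu
  refine ⟨(a, b, c), ?_, ?_, h1, h2⟩
  · obtain ⟨v, hv⟩ := Pres_S m n q (a, b, c)
    have H' := Dan_S hd hdeg hmonic hred hpq hv hν0 hνn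
    obtain ⟨f, fx, fy, fz⟩ := H.equivE H'
    refine descent f (H.equiv_comm H' (cj_CJ A) (cj_CJ _) ?_ ?_)
    · rcases hx with ⟨rfl, -, hx⟩ | ⟨rfl, hx⟩
      · rw [hx, fx, cj_tx_one rfl]
      · rw [hx, fx, cj_tx_zero (m := m) rfl hν0, map_smul, fy]
    · rw [hz, fz, cj_tz hu, map_smul, fz]
  · rintro rfl
    rcases hx with ⟨-, hb, -⟩ | ⟨h, -⟩
    · exact hb
    · exact absurd h (by decide)

end
end RF

namespace RF
open scoped TensorProduct

noncomputable section

lemma unit_of_norm {a : ℂ} (h : ‖a‖ = 1) : starRingEnd ℂ a * a = 1 := by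
  rw [mul_comm, Complex.mul_conj, Complex.normSq_eq_norm_sq, h]; simp

lemma nuc {n : ℕ} (hn : 1 ≤ n) (c : Fin 2) : ∃ ν : ℂ, starRingEnd ℂ ν * ν = 1 ∧ ν ^ n = (-1) ^ (c : ℕ) := by
  obtain ⟨ν, hν⟩ := IsAlgClosed.exists_pow_nat_eq ((-1 : ℂ) ^ (c : ℕ)) (n := n) (by omega)
  refine ⟨ν, unit_of_norm ?_, hν⟩
  have h : ‖ν‖ ^ n = 1 := by rw [← norm_pow, hν]; simp
  exact (pow_eq_one_iff_of_nonneg (norm_nonneg _) (by omega)).1 h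

lemma c_eq {n : ℕ} (hn : 1 ≤ n) {a ν ν' : ℂ} {c c' : Fin 2} (ha : a ^ n = 1) (hν : ν ^ n = (-1) ^ (c : ℕ))
    (hν' : ν' ^ n = (-1) ^ (c' : ℕ)) (h : starRingEnd ℂ a * ν ^ 2 = ν' ^ 2 * a) (he : Even n) : c' = c := by
  have hu := unit_of_norm (Complex.norm_eq_one_of_pow_eq_one ha (by omega))
  have h1 : ν ^ 2 = ν' ^ 2 * a ^ 2 := by linear_combination a * h - ν ^ 2 * hu
  obtain ⟨k, rfl⟩ := he
  have h2 : ν ^ (k + k) = ν' ^ (k + k) := by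
    have := congrArg (fun t => t ^ k) h1
    simp only [mul_pow, ← pow_mul] at this
    rw [← two_mul] at ha ⊢
    rw [this, ha, mul_one]
  rw [hν, hν'] at h2
  fin_cases c <;> fin_cases c' <;> first | rfl | norm_num at h2

lemma noniso {p : Polynomial ℝ} {d : ℕ} (hd : 3 ≤ d)
    (hdeg : p.natDegree = d) (hmonic : p.Monic) (hred : p.coeff (d - 1) = 0)
    {m n : ℕ} {q : Polynomial ℝ} (hn : 1 ≤ n)
    (hqmonic : q.Monic) (hqdeg : 1 ≤ q.natDegree) (hq0 : q.eval 0 ≠ 0)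
    (hpq : p = Polynomial.X ^ m * q.comp (Polynomial.X ^ n))
    (hmax : ∀ (m' n' : ℕ) (q' : Polynomial ℝ), 1 ≤ n' → q'.eval 0 ≠ 0 →
      p = Polynomial.X ^ m' * q'.comp (Polynomial.X ^ n') → n' ≤ n)
    {i j : Fin 2 × Fin 2 × Fin 2} (ψ : SAlg m n q i ≃ₐ[ℝ] SAlg m n q j) :
    i.1 = j.1 ∧ (Even n → i.2.2 = j.2.2) ∧
      (i.2.2 = j.2.2 → i.1 = 0 → i.2.1 ≠ j.2.1 → Even n ∧ Odd d) := by
  obtain ⟨E, hE⟩ := ascent ψ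
  choose ν hu hνn using nuc hn
  have hν0 : ∀ c, ν c ≠ 0 := fun c => right_ne_zero_of_mul_eq_one (hu c)
  obtain ⟨v, hv⟩ := Pres_S m n q i
  obtain ⟨w, hw⟩ := Pres_S m n q j
  have Hi := Dan_S hd hdeg hmonic hred hpq hv (hν0 i.2.2) (hνn _)
  have Hj := Dan_S hd hdeg hmonic hred hpq hw (hν0 j.2.2) (hνn _)
  have Hi' := Hi.mapE E
  have hσ := cj_CJ (SAlg m n q j)
  have hsym := fun {a : ℂ} (h0 : a ≠ 0) h => sym_pow hdeg hn hqmonic hqdeg hq0 hpq hmax (ω := a) h0 h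
  have hns : i.1 = 1 → Dan.NS (cj (SAlg m n q j)) (E (tx v i)) (E (ty m v i (ν i.2.2))) (E (tz v (ν i.2.2)))
      (ν i.2.2 ^ 2) := by
    intro h
    obtain ⟨⟨a, ha, h1⟩, ⟨b, hb, h2⟩, h3⟩ := NS_S (m := m) (v := v) h (hu i.2.2)
    exact ⟨⟨a, ha, by rw [← hE, h1, map_smul]⟩, ⟨b, hb, by rw [← hE, h2, map_smul]⟩, by rw [← hE, h3, map_smul]⟩
  have hsw : i.1 = 0 → Dan.SW (cj (SAlg m n q j)) (E (tx v i)) (E (ty m v i (ν i.2.2))) (E (tz v (ν i.2.2)))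
      (kap i.2.1 * ν i.2.2 ^ m) (kap i.2.1 * ν i.2.2 ^ m) (ν i.2.2 ^ 2) := by
    intro h
    obtain ⟨a, b, h1, h2, h3⟩ := SW_S (m := m) (v := v) h (hu i.2.2)
    exact ⟨a, b, by rw [← hE, h1, map_smul], by rw [← hE, h2, map_smul], by rw [← hE, h3, map_smul]⟩
  have f2 : ∀ a : Fin 2, a = 0 ∨ a = 1 := by decide
  rcases f2 i.1 with hi | hi <;> rcases f2 j.1 with hj | hj
  · obtain ⟨a, u, ha, h0, hp, h1, h2⟩ := Hj.both_swap hσ (SW_S hj (hu _)) Hi' (hsw hi)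
    have han := hsym ha hp
    refine ⟨by rw [hi, hj], c_eq hn han (hνn _) (hνn _) h1, ?_⟩
    intro hc _ hb
    rw [or_self] at h2
    rw [← hc] at h1 h2
    have hau := unit_of_norm (Complex.norm_eq_one_of_pow_eq_one han (by omega))
    have h3 : starRingEnd ℂ a = a := by
      have := pow_ne_zero 2 (hν0 i.2.2)
      rw [mul_comm] at h1
      exact mul_left_cancel₀ this h1
    rw [h3] at hau
    have h4 : starRingEnd ℂ u * u * kap j.2.1 = kap i.2.1 * a ^ d := by
      have := pow_ne_zero m (hν0 i.2.2)
      apply mul_right_cancel₀ this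
      linear_combination h2
    have h5 : kap i.2.1 = - kap j.2.1 := by
      rcases f2 i.2.1 with h | h <;> rcases f2 j.2.1 with h' | h' <;> rw [h, h'] <;> simp_all [kap]
    rw [h5] at h4
    have h6 : starRingEnd ℂ u * u = - a ^ d := by
      apply mul_right_cancel₀ (kap_ne j.2.1)
      linear_combination h4
    have h7 : a ^ d ≠ 1 := by
      intro h
      rw [h, mul_comm, Complex.mul_conj] at h6
      have h8 : Complex.normSq u = -1 := by exact_mod_cast h6
      have := Complex.normSq_nonneg u
      linarith
    rcases mul_self_eq_one_iff.1 hau with rfl | rfl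
    · exact absurd (one_pow d) h7
    · constructor
      · by_contra h
        rw [Nat.not_even_iff_odd] at h
        rw [h.neg_one_pow] at han
        norm_num at han
      · by_contra h
        rw [Nat.not_odd_iff_even] at h
        exact h7 h.neg_one_pow
  · exact (Hi'.not_mixed hσ (hsw hi) Hj (NS_S hj (hu _))).elim
  · exact (Hj.not_mixed hσ (SW_S hj (hu _)) Hi' (hns hi)).elim
  · obtain ⟨a, ha, hp, h1⟩ := Hj.both_ns hσ (pow_ne_zero 2 (hν0 _)) (NS_S hj (hu _)) Hi' (hns hi)
    have han := hsym ha hp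
    refine ⟨by rw [hi, hj], c_eq hn han (hνn _) (hνn _) h1, ?_⟩
    intro _ h
    rw [hi] at h
    exact absurd h (by decide)

end
end RF

open MvPolynomial
open scoped TensorProduct

/-- Real forms of the surfaces `xy = p(z)` with `p ∈ ℝ[z]` reduced of degree `d ≥ 3`,
`p = z^m q(z^n)` with `q` monic nonconstant, `q(0) ≠ 0` and `n` maximal: there are
exactly three, four, or six isomorphism classes of real forms according to the
parities of `n` and `d`. -/
theorem real_forms_Danielewski_deg_ge_three (p : Polynomial ℝ) (d : ℕ) (hd : 3 ≤ d)
    (hdeg : p.natDegree = d) (hmonic : p.Monic) (hred : p.coeff (d - 1) = 0)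
    (m n : ℕ) (q : Polynomial ℝ) (hn : 1 ≤ n)
    (hqmonic : q.Monic) (hqdeg : 1 ≤ q.natDegree) (hq0 : q.eval 0 ≠ 0)
    (hpq : p = Polynomial.X ^ m * q.comp (Polynomial.X ^ n))
    (hmax : ∀ (m' n' : ℕ) (q' : Polynomial ℝ), 1 ≤ n' → q'.eval 0 ≠ 0 →
      p = Polynomial.X ^ m' * q'.comp (Polynomial.X ^ n') → n' ≤ n) :
    (Odd n → ClassifiedBy p m n q [(0, 0, 0), (0, 1, 0), (1, 1, 0)]) ∧
    (Even n → Odd d →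
      ClassifiedBy p m n q [(0, 1, 0), (0, 1, 1), (1, 1, 0), (1, 1, 1)]) ∧
    (Even n → Even d →
      ClassifiedBy p m n q
        [(0, 0, 0), (0, 0, 1), (0, 1, 0), (0, 1, 1), (1, 1, 0), (1, 1, 1)]) := by
  have hex := fun (A : Type) [CommRing A] [Algebra ℝ A] (hA : IsRealForm A (BpC p)) =>
    RF.exhaust hd hdeg hmonic hred hn hqmonic hqdeg hq0 hpq hmax A hA
  have hno := fun {i j : Fin 2 × Fin 2 × Fin 2} (ψ : SAlg m n q i ≃ₐ[ℝ] SAlg m n q j) =>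
    RF.noniso hd hdeg hmonic hred hn hqmonic hqdeg hq0 hpq hmax ψ
  refine ⟨fun hodd => ⟨?_, ?_⟩, fun he hodd => ⟨?_, ?_⟩, fun he hev => ⟨?_, ?_⟩⟩
  · intro i hi j hj hij
    refine ⟨fun ψ => ?_⟩
    obtain ⟨h1, -, h3⟩ := hno ψ
    have h3' : i.2.2 = j.2.2 → i.1 = 0 → i.2.1 = j.2.1 := by
      intro a b
      by_contra h
      exact Nat.not_even_iff_odd.2 hodd (h3 a b h).1
    clear h3 ψ
    revert i j
    decide
  · intro A _ _ hA
    obtain ⟨i, hi, h1, h2, -⟩ := hex A hA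
    refine ⟨i, ?_, hi⟩
    have h2' := h2 hodd
    clear hi h2
    revert i
    decide
  · intro i hi j hj hij
    refine ⟨fun ψ => ?_⟩
    obtain ⟨h1, h2, -⟩ := hno ψ
    have h2' := h2 he
    clear h2 ψ
    revert i j
    decide
  · intro A _ _ hA
    obtain ⟨i, hi, -, -, h3⟩ := hex A hA
    refine ⟨i, ?_, hi⟩
    have h3' := h3 he hodd
    clear hi h3
    revert i
    decide
  · intro i hi j hj hij
    refine ⟨fun ψ => ?_⟩
    obtain ⟨h1, h2, h3⟩ := hno ψ
    have h2' := h2 he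
    have h3' : i.2.2 = j.2.2 → i.1 = 0 → i.2.1 = j.2.1 := by
      intro a b
      by_contra h
      exact Nat.not_even_iff_odd.2 (h3 a b h).2 hev
    clear h2 h3 ψ
    revert i j
    decide
  · intro A _ _ hA
    obtain ⟨i, hi, h1, -, -⟩ := hex A hA
    refine ⟨i, ?_, hi⟩
    clear hi
    revert i
    decide
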